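/- Let D₁, D₂ be semilocal Prüfer domains, and suppose there is an order isomorphism ν : hiSpec(D₁) → hiSpec(D₂) such that, for every P ∈ hiSpec(D₁), there is an order isomorphism ν_P : FStar(Z(P)) → FStar(Z(ν(P))). Then there are order isomorphisms 𝛎 : SStar(D₁) → SStar(D₂) and 𝛎_F : FStar(D₁) → FStar(D₂) such that 𝛎(SStar_Δ(D₁)) = SStar_{ν̄(Δ)}(D₂) for every Δ ⊆ SkOver(D₁), where ν̄ : SkOver(D₁) → SkOver(D₂) is the order isomorphism of skeletons induced by ν. -/

import Mathlib

/- Common background: Prüfer domains, semistar and (fractional) star operations,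
standard decomposition, skeleton, supports, `hiSpec`, the rings `Z(P)`,
and the invariants `ω` and `ε`, following Spirito,
"Semistar operations on semilocal Prüfer domains". -/

set_option linter.unusedSectionVars false
set_option maxHeartbeats 1000000

open Pointwise

noncomputable section

namespace Paper

variable (D : Type*) [CommRing D] [IsDomain D]
variable (K : Type*) [Field K] [Algebra D K] [IsFractionRing D K]

/-- The localization of `D` at a prime ideal `P`, viewed as an overring of `D`
inside its quotient field `K`. -/
def locAt (P : Ideal D) (hP : P.IsPrime) : Subalgebra D K :=
  Localization.subalgebra K (@Ideal.primeCompl D _ P hP)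
    (fun _ hx => mem_nonZeroDivisors_of_ne_zero fun h => hx (h ▸ P.zero_mem))

/-- A Prüfer domain: every localization at a prime ideal is a valuation domain
(any two elements are comparable w.r.t. divisibility). -/
def IsPrufer : Prop :=
  ∀ (P : Ideal D) (hP : P.IsPrime), ∀ x y : locAt D K P hP, ∃ z, x * z = y ∨ y * z = x

/-- A semilocal ring: finitely many maximal ideals. -/
def IsSemilocal : Prop := {I : Ideal D | I.IsMaximal}.Finite

/-- Two ideals are dependent if some nonzero prime ideal is contained in both. -/
def Dependent (M N : Ideal D) : Prop :=
  ∃ P : Ideal D, P.IsPrime ∧ P ≠ ⊥ ∧ P ≤ M ∧ P ≤ N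

/-- The member of the standard decomposition corresponding to the dependence class
of the maximal ideal `M`: the intersection of the localizations of `D` at the
maximal ideals dependent on `M`. -/
def TOf (M : Ideal D) : Subalgebra D K :=
  sInf {A | ∃ (N : Ideal D) (hN : N.IsMaximal), Dependent D M N ∧ A = locAt D K N hN.isPrime}

/-- The standard decomposition of `D`. -/
def stdDecomp : Set (Subalgebra D K) :=
  {T | ∃ M : Ideal D, M.IsMaximal ∧ T = TOf D K M}

/-- The skeleton of `Over(D)`: all intersections of subsets of the standard
decomposition (including the empty intersection `K` and the total one `D`). -/
def SkOver : Set (Subalgebra D K) :=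
  {A | ∃ S ⊆ stdDecomp D K, A = sInf S}

/-- `I` is a fractional ideal of the overring `A` of `D`: it is an `A`-submodule
of `K` and `dI ⊆ A` for some nonzero `d ∈ K`. -/
def IsFracOf (A : Subalgebra D K) (I : Submodule D K) : Prop :=
  (∀ a ∈ A, ∀ x ∈ I, a * x ∈ I) ∧ ∃ d : K, d ≠ 0 ∧ ∀ x ∈ I, d * x ∈ A

end Paper

namespace Paper

/-- A semistar operation on a domain `R` with quotient field `K`: an extensive,
order-preserving, idempotent self-map of the set of `R`-submodules of `K` such
that `(xI)^⋆ = x·I^⋆` for every nonzero `x ∈ K`. -/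
structure Semistar (R : Type*) [CommRing R] (K : Type*) [Field K] [Algebra R K] where
  toFun : Submodule R K → Submodule R K
  le_star' : ∀ I, I ≤ toFun I
  mono' : ∀ ⦃I J⦄, I ≤ J → toFun I ≤ toFun J
  idem' : ∀ I, toFun (toFun I) = toFun I
  smul' : ∀ (x : K), x ≠ 0 → ∀ I,
    toFun (Submodule.span R {x} * I) = Submodule.span R {x} * toFun I

namespace Semistar

variable {R : Type*} [CommRing R] {K : Type*} [Field K] [Algebra R K]

theorem ext' {s t : Semistar R K} (h : s.toFun = t.toFun) : s = t := by
  cases s; cases t; cases h; rfl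

instance : PartialOrder (Semistar R K) where
  le s t := ∀ I, s.toFun I ≤ t.toFun I
  le_refl _ _ := le_rfl
  le_trans _ _ _ hab hbc I := (hab I).trans (hbc I)
  le_antisymm _ _ h h' := ext' (funext fun I => le_antisymm (h I) (h' I))

end Semistar

/-- The identity semistar operation `d`. -/
def dOp (R : Type*) [CommRing R] (K : Type*) [Field K] [Algebra R K] : Semistar R K where
  toFun I := I
  le_star' _ := le_rfl
  mono' _ _ h := h
  idem' _ := rfl
  smul' _ _ _ := rfl

end Paper

namespace Paper

variable (D : Type*) [CommRing D] [IsDomain D]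
variable (K : Type*) [Field K] [Algebra D K] [IsFractionRing D K]

/-- A fractional star operation on an overring `A` of `D` (inside `K`): a
semistar-like closure operation defined on the fractional ideals of `A`.
In particular `FracStar D K ⊥` is the set of fractional star operations on `D`. -/
structure FracStar (A : Subalgebra D K) where
  toFun : {I : Submodule D K // IsFracOf D K A I} → {I : Submodule D K // IsFracOf D K A I}
  le_star' : ∀ I, I.1 ≤ (toFun I).1
  mono' : ∀ I J, I.1 ≤ J.1 → (toFun I).1 ≤ (toFun J).1
  idem' : ∀ I, toFun (toFun I) = toFun I
  smul' : ∀ (x : K), x ≠ 0 → ∀ I J, J.1 = Submodule.span D {x} * I.1 →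
    (toFun J).1 = Submodule.span D {x} * (toFun I).1

namespace FracStar

variable {D K} {A : Subalgebra D K}

theorem ext' {s t : FracStar D K A} (h : s.toFun = t.toFun) : s = t := by
  cases s; cases t; cases h; rfl

instance : PartialOrder (FracStar D K A) where
  le s t := ∀ I, (s.toFun I).1 ≤ (t.toFun I).1
  le_refl _ _ := le_rfl
  le_trans _ _ _ hab hbc I := (hab I).trans (hbc I)
  le_antisymm _ _ h h' := ext' (funext fun I => Subtype.ext (le_antisymm (h I) (h' I)))

end FracStar

/-- A fractional star operation on the overring `A` is a *star operation* if it
closes `A` itself. -/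
def FracStar.IsStarOp {A : Subalgebra D K} (f : FracStar D K A) : Prop :=
  ∀ h : IsFracOf D K A (Subalgebra.toSubmodule A),
    (f.toFun ⟨Subalgebra.toSubmodule A, h⟩).1 = Subalgebra.toSubmodule A

/-- The support of a semistar operation on `D`: the elements `A` of the skeleton
such that `A^⋆` is a fractional ideal of `A`. -/
def supp (s : Semistar D K) : Set (Subalgebra D K) :=
  {A | A ∈ SkOver D K ∧ IsFracOf D K A (s.toFun (Subalgebra.toSubmodule A))}

/-- The image of an ideal of `D` inside `K`. -/
def idealToK (P : Ideal D) : Submodule D K := Submodule.map (Algebra.linearMap D K) P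

end Paper

namespace Paper

/-- An abstract fractional star operation on a commutative ring `A`, acting on
the fractional ideals of `A` inside its fraction ring. -/
structure AFracStar (A : Type*) [CommRing A] where
  toFun : FractionalIdeal (nonZeroDivisors A) (FractionRing A) →
    FractionalIdeal (nonZeroDivisors A) (FractionRing A)
  le_star' : ∀ I, I ≤ toFun I
  mono' : ∀ ⦃I J⦄, I ≤ J → toFun I ≤ toFun J
  idem' : ∀ I, toFun (toFun I) = toFun I
  smul' : ∀ (x : FractionRing A), x ≠ 0 → ∀ I,
    toFun (FractionalIdeal.spanSingleton (nonZeroDivisors A) x * I) =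
      FractionalIdeal.spanSingleton (nonZeroDivisors A) x * toFun I

namespace AFracStar

variable {A : Type*} [CommRing A]

theorem ext' {s t : AFracStar A} (h : s.toFun = t.toFun) : s = t := by
  cases s; cases t; cases h; rfl

instance : PartialOrder (AFracStar A) where
  le s t := ∀ I, s.toFun I ≤ t.toFun I
  le_refl _ _ := le_rfl
  le_trans _ _ _ hab hbc I := (hab I).trans (hbc I)
  le_antisymm _ _ h h' := ext' (funext fun I => le_antisymm (h I) (h' I))

end AFracStar

/-- Abstract star operations on `A`: fractional star operations closing `A`. -/
def AStar (A : Type*) [CommRing A] : Type _ := {s : AFracStar A // s.toFun 1 = 1}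

instance (A : Type*) [CommRing A] : PartialOrder (AStar A) :=
  inferInstanceAs (PartialOrder {s : AFracStar A // s.toFun 1 = 1})

end Paper

namespace Paper

variable (D : Type*) [CommRing D] [IsDomain D]

/-- `P` is a branching point of `Spec(D)`: the infimum (among the primes) of a
family of pairwise incomparable primes not containing `P`. -/
def IsBranchPoint (P : Ideal D) : Prop :=
  ∃ S : Set (Ideal D), (∀ Q ∈ S, Q.IsPrime) ∧
    (S.Pairwise fun Q₁ Q₂ => ¬Q₁ ≤ Q₂ ∧ ¬Q₂ ≤ Q₁) ∧ P ∉ S ∧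
    (∀ Q ∈ S, P ≤ Q) ∧ ∀ P' : Ideal D, P'.IsPrime → (∀ Q ∈ S, P' ≤ Q) → P' ≤ P

/-- The homeomorphically irreducible tree underlying `Spec(D)`: the zero ideal,
the maximal ideals and the branching points, ordered by inclusion. -/
def hiSpec : Set (Ideal D) :=
  {P | P.IsPrime ∧ (P = ⊥ ∨ P.IsMaximal ∨ IsBranchPoint D P)}

/-- `Q` is the element of `hiSpec D` directly below `P`. -/
def DirectlyBelow (Q P : Ideal D) : Prop :=
  Q ∈ hiSpec D ∧ P ∈ hiSpec D ∧ Q < P ∧ ∀ R ∈ hiSpec D, Q < R → ¬R < P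

/-- The localization of `D` at the prime ideal `P`, as an abstract ring. -/
abbrev locRing (P : Ideal D) (hP : P.IsPrime) : Type _ :=
  Localization (@Ideal.primeCompl D _ P hP)

/-- The valuation ring `Z(P) = D_P / Q·D_P`. -/
abbrev Zring (P Q : Ideal D) (hP : P.IsPrime) : Type _ :=
  locRing D P hP ⧸ Ideal.map (algebraMap D (locRing D P hP)) Q

/-- `ω(P) = |FStar(Z(P))|`, where `Q` is the element of `hiSpec D` directly
below `P`. -/
def omegaAt (P Q : Ideal D) (hP : P.IsPrime) : ℕ :=
  Nat.card (AFracStar (Zring D P Q hP))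

open Classical in
/-- `ε(P) = |Star(D_P)| ∈ {1,2}` for a (nonzero) prime `P`. -/
def epsilonOf (A : Ideal D) : ℕ :=
  if h : A.IsPrime then Nat.card (AStar (locRing D A h)) else 0

end Paper

namespace Paper

theorem mem_hiSpec_prime {D : Type*} [CommRing D] [IsDomain D] {P : Ideal D}
    (h : P ∈ hiSpec D) : P.IsPrime := h.1

theorem maximal_mem_hiSpec {D : Type*} [CommRing D] [IsDomain D] {M : Ideal D}
    (h : M.IsMaximal) : M ∈ hiSpec D := ⟨h.isPrime, Or.inr (Or.inl h)⟩

end Paper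

namespace Paper

/-- Closure operations on a subset `X` of an ordered `G`-set that commute with the
partial action of `G` on `X`. -/
structure Clo (G : Type*) {α : Type*} [PartialOrder α] [SMul G α] (X : Set α) where
  toFun : X → X
  le_cl' : ∀ x, x ≤ toFun x
  mono' : ∀ ⦃x y⦄, x ≤ y → toFun x ≤ toFun y
  idem' : ∀ x, toFun (toFun x) = toFun x
  smul' : ∀ (g : G) (x y : X), y.1 = g • x.1 → (toFun y).1 = g • (toFun x).1

namespace Clo

variable {G α : Type*} [PartialOrder α] [SMul G α] {X : Set α}

theorem ext' {s t : Clo G X} (h : ∀ x, s.toFun x = t.toFun x) : s = t := by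
  cases s; cases t; congr; exact funext h

instance : PartialOrder (Clo G X) where
  le s t := ∀ x, s.toFun x ≤ t.toFun x
  le_refl _ _ := le_rfl
  le_trans _ _ _ hab hbc x := (hab x).trans (hbc x)
  le_antisymm _ _ h h' := ext' fun x => le_antisymm (h x) (h' x)

/-- The closure operation sending everything to the largest element of `X`. -/
def const (T : X) (hT : ∀ x, x ≤ T) (hg : ∀ (g : G) (x y : X), y.1 = g • x.1 → T.1 = g • T.1) :
    Clo G X where
  toFun _ := T
  le_cl' x := hT x
  mono' _ _ _ := le_rfl
  idem' _ := rfl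
  smul' g x y h := hg g x y h

/-- The identity closure operation. -/
def id (X : Set α) : Clo G X where
  toFun x := x
  le_cl' _ := le_rfl
  mono' _ _ h := h
  idem' _ := rfl
  smul' _ _ _ h := h

theorem isBot_iff {s : Clo G X} : IsBot s ↔ ∀ x, s.toFun x = x :=
  ⟨fun h x => le_antisymm (h (id X) x) (s.le_cl' x), fun h t x => (h x).le.trans (t.le_cl' x)⟩

end Clo

/-- Families of elements of posets `C i`, indexed by subsets `S` of the index set, which are
trivial outside `S`, are decreasing in `S`, and only depend on the set of nontrivial components. -/
structure Dat {ι : Type*} (C : ι → Type*) [∀ i, PartialOrder (C i)] where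
  val : Set ι → ∀ i, C i
  isTop' : ∀ S i, i ∉ S → IsTop (val S i)
  anti' : ∀ S S', S ⊆ S' → val S' ≤ val S
  interior' : ∀ S, val {i | ¬IsTop (val S i)} = val S

theorem OrderIso.isTop_apply_iff {A B : Type*} [Preorder A] [Preorder B] (e : A ≃o B) {a : A} :
    IsTop (e a) ↔ IsTop a :=
  ⟨fun h b => e.le_iff_le.1 (h _), fun h b => by
    have := h (e.symm b); rwa [← e.le_iff_le, e.apply_symm_apply] at this⟩

theorem OrderIso.isBot_apply_iff {A B : Type*} [Preorder A] [Preorder B] (e : A ≃o B) {a : A} :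
    IsBot (e a) ↔ IsBot a :=
  ⟨fun h b => e.le_iff_le.1 (h _), fun h b => by
    have := h (e.symm b); rwa [← e.le_iff_le, e.apply_symm_apply] at this⟩

namespace Dat

variable {ι κ : Type*} {C : ι → Type*} [∀ i, PartialOrder (C i)]
  {E : κ → Type*} [∀ i, PartialOrder (E i)]

/-- The set of index sets on which a family is everywhere nontrivial. -/
def supp (f : Dat C) : Set (Set ι) := {S | ∀ i ∈ S, ¬IsTop (f.val S i)}

theorem ext' {f f' : Dat C} (h : ∀ S i, f.val S i = f'.val S i) : f = f' := by
  cases f; cases f'; congr; exact funext fun S => funext (h S)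

instance : PartialOrder (Dat C) where
  le f f' := ∀ S i, f.val S i ≤ f'.val S i
  le_refl _ _ _ := le_rfl
  le_trans _ _ _ h h' S i := (h S i).trans (h' S i)
  le_antisymm _ _ h h' := ext' fun S i => le_antisymm (h S i) (h' S i)

theorem le_def {f f' : Dat C} : f ≤ f' ↔ ∀ S i, f.val S i ≤ f'.val S i := Iff.rfl

theorem exists_orderIso (σ : κ ≃ ι) (ψ : ∀ k, C (σ k) ≃o E k) :
    ∃ Ψ : Dat C ≃o Dat E, ∀ f S, σ '' S ∈ f.supp ↔ S ∈ (Ψ f).supp := by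
  have key : ∀ f : Dat C, ∃ g : Dat E, ∀ S k, g.val S k = ψ k (f.val (σ '' S) (σ k)) := by
    intro f
    refine ⟨⟨fun S k => ψ k (f.val (σ '' S) (σ k)), ?_, ?_, ?_⟩, fun _ _ => rfl⟩
    · intro S i hi
      rw [OrderIso.isTop_apply_iff]
      exact f.isTop' _ _ (by simpa using hi)
    · intro S S' h i
      exact (ψ i).monotone (f.anti' _ _ (Set.image_mono h) _)
    · intro S
      funext k
      simp only [OrderIso.isTop_apply_iff]
      congr 1
      conv_rhs => rw [← f.interior' (σ '' S)]
      congr 1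
      refine Set.ext fun i => ?_
      obtain ⟨k, rfl⟩ := σ.surjective i
      simp
  have key' : ∀ g : Dat E, ∃ f : Dat C, ∀ S k, g.val S k = ψ k (f.val (σ '' S) (σ k)) := by
    intro g
    obtain ⟨F, h⟩ : ∃ F : Set ι → ∀ i, C i, ∀ S k, F S (σ k) =
        (ψ k).symm (g.val (σ ⁻¹' S) k) :=
      ⟨fun S => Equiv.piCongrLeft C σ (fun k => (ψ k).symm (g.val (σ ⁻¹' S) k)),
        fun S k => Equiv.piCongrLeft_apply_apply C σ _ k⟩
    refine ⟨⟨F, ?_, ?_, ?_⟩, fun S k => ?_⟩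
    · intro S i hi
      obtain ⟨k, rfl⟩ := σ.surjective i
      rw [h, OrderIso.isTop_apply_iff]
      exact g.isTop' _ _ hi
    · intro S S' hS i
      obtain ⟨k, rfl⟩ := σ.surjective i
      rw [h, h]
      exact (ψ k).symm.monotone (g.anti' _ _ (Set.preimage_mono hS) _)
    · intro S
      funext i
      obtain ⟨k, rfl⟩ := σ.surjective i
      rw [h, h]
      congr 1
      conv_rhs => rw [← g.interior' (σ ⁻¹' S)]
      congr 2
      ext i
      simp only [Set.mem_preimage, Set.mem_ofPred_eq]
      rw [h, OrderIso.isTop_apply_iff]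
    · exact ((congrArg _ (h _ _)).trans (by simp)).symm
  choose Φ hΦ using key
  refine ⟨RelIso.ofSurjective (OrderEmbedding.ofMapLEIff Φ ?_) ?_, ?_⟩
  · intro f f'
    rw [le_def, le_def]
    simp only [hΦ, OrderIso.le_iff_le]
    refine ⟨fun h S i => ?_, fun h S k => h _ _⟩
    obtain ⟨k, rfl⟩ := σ.surjective i
    simpa [Set.image_preimage_eq _ σ.surjective] using h (σ ⁻¹' S) k
  · intro g
    obtain ⟨f, hf⟩ := key' g
    refine ⟨f, Dat.ext' fun S k => ?_⟩
    exact (hΦ f S k).trans (hf S k).symm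
  · intro f S
    change _ ↔ S ∈ (Φ f).supp
    simp only [supp, Set.mem_ofPred_eq, hΦ, OrderIso.isTop_apply_iff, Set.forall_mem_image]

end Dat

end Paper

namespace Paper

/-- An equivariant identification of a set `X` with largest element `T` in an ordered `G`-set
with a product of sets `Y i` with the same largest element, such that the elements of the group
can be chosen independently enough on the different factors. -/
structure Decomp (G : Type*) {α : Type*} [PartialOrder α] [SMul G α] (T : α) (X : Set α)
    {ι : Type*} (Y : ι → Set α) where
  e : X ≃o ∀ i, Y i
  H : Set G
  mem_Y : ∀ i, T ∈ Y i
  le_Y : ∀ i, ∀ y ∈ Y i, y ≤ T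
  mem_of_X : ∀ g, ∀ x ∈ X, g • x ∈ X → g ∈ H
  mem_of_Y : ∀ g i, ∀ y ∈ Y i, g • y ∈ Y i → g ∈ H
  smul_X : ∀ g ∈ H, ∀ x ∈ X, g • x ∈ X
  smul_T : ∀ g ∈ H, g • T = T
  e_smul : ∀ g ∈ H, ∀ x y : X, y.1 = g • x.1 → ∀ i, (e y i).1 = g • (e x i).1
  mono : ∀ (g : G) (x y : α), x ≤ y → g • x ≤ g • y
  inj : ∀ (g : G) (x y : α), g • x = g • y → x = y
  cof : ∀ i (z z' : Y i), z.1 ≠ T → z'.1 ≠ T → ∃ g ∈ H, z.1 ≤ g • z'.1 ∧ g • z'.1 ∈ Y i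
  indep : ∀ i (y y' : ∀ j, Y j), (∀ j, (y j).1 ≠ T) → (∀ j, (y' j).1 ≠ T) →
    ∃ g ∈ H, (∀ z ∈ Y i, g • z = z) ∧ ∀ j, j ≠ i → (y j).1 ≤ g • (y' j).1
  base : ∀ i, Y i
  base_ne : ∀ i, (base i).1 ≠ T

namespace Decomp

variable {G α : Type*} [PartialOrder α] [SMul G α] {T : α} {X : Set α}
  {ι : Type*} {Y : ι → Set α} (d : Decomp G T X Y)

/-- The set of indices at which an element is not the largest one. -/
def pat (x : X) : Set ι := {i | (d.e x i).1 ≠ T}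

theorem notMem_pat {x : X} {i : ι} : i ∉ d.pat x ↔ (d.e x i).1 = T := by
  simp [pat]

include d in
theorem isTop_iff {i : ι} {c : Clo G (Y i)} : IsTop c ↔ ∀ y, (c.toFun y).1 = T := by
  constructor
  · intro h y
    have hs := h (Clo.const ⟨T, d.mem_Y i⟩ (fun y => d.le_Y i _ y.2)
      (fun g x y hxy => (d.smul_T g (d.mem_of_Y g i x.1 x.2 (hxy ▸ y.2))).symm)) y
    exact le_antisymm (d.le_Y i _ (c.toFun y).2) hs
  · intro h c' y
    change (c'.toFun y).1 ≤ (c.toFun y).1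
    rw [h]
    exact d.le_Y i _ (c'.toFun y).2

include d in
theorem isTop_of_eq {i : ι} {c : Clo G (Y i)} {z : Y i} (hz : z.1 ≠ T)
    (h : (c.toFun z).1 = T) : IsTop c := by
  rw [d.isTop_iff]
  intro y
  by_cases hy : y.1 = T
  · exact le_antisymm (d.le_Y i _ (c.toFun y).2) (hy ▸ c.le_cl' y)
  obtain ⟨g, hg, hle, hm⟩ := d.cof i z y hz hy
  have h1 : (c.toFun z).1 ≤ (c.toFun ⟨_, hm⟩).1 := c.mono' hle
  rw [c.smul' g y ⟨_, hm⟩ rfl, h] at h1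
  have h2 : g • (c.toFun y).1 ≤ T := by
    rw [← d.smul_T g hg]; exact d.mono g _ _ (d.le_Y i _ (c.toFun y).2)
  have h3 := le_antisymm h2 h1
  rw [← d.smul_T g hg] at h3
  exact d.inj g _ _ h3

theorem eq_smul {g : G} (hg : g ∈ d.H) {x y : X} (h : ∀ i, (d.e y i).1 = g • (d.e x i).1) :
    y.1 = g • x.1 := by
  have : y = ⟨g • x.1, d.smul_X g hg _ x.2⟩ := by
    apply d.e.injective
    funext i
    exact Subtype.ext ((h i).trans (d.e_smul g hg x ⟨_, d.smul_X g hg _ x.2⟩ rfl i).symm)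
  rw [this]

theorem smul_eq_iff {g : G} (hg : g ∈ d.H) {x : α} : g • x = T ↔ x = T := by
  refine ⟨fun h => d.inj g _ _ (h.trans (d.smul_T g hg).symm), fun h => ?_⟩
  rw [h, d.smul_T g hg]

theorem eq_of_le {x y : X} (h : x ≤ y) {i : ι} (hx : (d.e x i).1 = T) : (d.e y i).1 = T :=
  le_antisymm (d.le_Y i _ (d.e y i).2) (hx.symm.le.trans (d.e.monotone h i))

theorem pat_anti {x y : X} (h : x ≤ y) : d.pat y ⊆ d.pat x := by
  exact fun i hi hx => hi (d.eq_of_le h hx)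

theorem pat_smul {g : G} (hg : g ∈ d.H) {x y : X} (h : y.1 = g • x.1) : d.pat y = d.pat x := by
  ext i
  simp only [pat, Set.mem_ofPred_eq, ne_eq, d.e_smul g hg x y h i,
    d.smul_eq_iff hg]

/-- A component of a closure depends on the corresponding component only,
once the pattern is fixed. -/
theorem apply_eq_of_eq (c : Clo G X) {x x' : X} {i : ι} (hi : d.e x i = d.e x' i)
    (hp : d.pat x = d.pat x') : d.e (c.toFun x) i = d.e (c.toFun x') i := by
  classical
  have key : ∀ x x' : X, d.e x i = d.e x' i → d.pat x = d.pat x' →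
      d.e (c.toFun x) i ≤ d.e (c.toFun x') i := by
    intro x x' hi hp
    let y : X → ∀ j, Y j := fun x j => if (d.e x j).1 = T then d.base j else d.e x j
    have hy : ∀ x j, (y x j).1 ≠ T := fun x j => by
      by_cases h : (d.e x j).1 = T <;> simp [y, h, d.base_ne]
    obtain ⟨g, hg, hfix, hle⟩ := d.indep i (y x) (y x') (hy x) (hy x')
    have h1 : x ≤ ⟨g • x'.1, d.smul_X g hg _ x'.2⟩ := by
      rw [← d.e.le_iff_le]
      intro j
      change (d.e x j).1 ≤ _
      rw [d.e_smul g hg x' ⟨_, d.smul_X g hg _ x'.2⟩ rfl j]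
      by_cases hj : j = i
      · subst hj
        rw [hi, hfix _ (d.e x' j).2]
      · have := hle j hj
        by_cases h : (d.e x' j).1 = T
        · rw [h, d.smul_T g hg]
          exact d.le_Y j _ (d.e x j).2
        · have h' : (d.e x j).1 ≠ T := by
            change j ∈ d.pat x
            rw [hp]
            exact h
          simpa [y, h, h'] using this
    have h2 := d.e.monotone (c.mono' h1) i
    refine h2.trans (le_of_eq (Subtype.ext ?_))
    rw [d.e_smul g hg _ _ (c.smul' g x' ⟨_, d.smul_X g hg _ x'.2⟩ rfl) i, hfix _ (d.e _ i).2]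
  exact le_antisymm (key x x' hi hp) (key x' x hi.symm hp.symm)

open Classical in
/-- The base point on `S`, extended by the largest element. -/
def baseOn (S : Set ι) : ∀ i, Y i := fun i => if i ∈ S then d.base i else ⟨T, d.mem_Y i⟩

theorem baseOn_eq_iff {S : Set ι} {i : ι} : (d.baseOn S i).1 = T ↔ i ∉ S := by
  by_cases h : i ∈ S <;> simp [baseOn, h, d.base_ne]

theorem baseOn_anti {S S' : Set ι} (h : S ⊆ S') : d.baseOn S' ≤ d.baseOn S := by
  intro i
  by_cases hi : i ∈ S
  · simp [baseOn, hi, h hi]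
  · rw [show d.baseOn S i = ⟨T, d.mem_Y i⟩ by simp [baseOn, hi]]
    exact d.le_Y i _ (d.baseOn S' i).2

open Classical in
/-- The base point on `S` with the `i`-th component replaced. -/
def pt (S : Set ι) (i : ι) (z : Y i) : X := d.e.symm (Function.update (d.baseOn S) i z)

theorem e_pt_self (S : Set ι) (i : ι) (z : Y i) : d.e (d.pt S i z) i = z := by
  simp [pt]

theorem e_pt_ne (S : Set ι) {i j : ι} (h : j ≠ i) (z : Y i) :
    d.e (d.pt S i z) j = d.baseOn S j := by
  simp [pt, h]

theorem pt_mono {S S' : Set ι} (h : S ⊆ S') {i : ι} {z z' : Y i} (hz : z ≤ z') :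
    d.pt S' i z ≤ d.pt S i z' := by
  classical
  apply d.e.symm.monotone
  exact update_le_update_iff.2 ⟨hz, fun j _ => d.baseOn_anti h j⟩

theorem pat_pt {S : Set ι} {i : ι} (hi : i ∈ S) {z : Y i} (hz : z.1 ≠ T) :
    d.pat (d.pt S i z) = S := by
  ext j
  by_cases hj : j = i
  · subst hj; simp [pat, e_pt_self, hi, hz]
  · simp [pat, e_pt_ne, hj, baseOn_eq_iff]

/-- The closure operation on a product determined by a family of closure operations. -/
def clo (f : Dat fun i => Clo G (Y i)) : Clo G X where
  toFun x := d.e.symm fun i => (f.val (d.pat x) i).toFun (d.e x i)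
  le_cl' x := by
    rw [← d.e.le_iff_le, OrderIso.apply_symm_apply]
    exact fun i => (f.val _ i).le_cl' _
  mono' x y h := by
    apply d.e.symm.monotone
    intro i
    exact (f.anti' _ _ (d.pat_anti h) i _).trans
      ((f.val _ i).mono' (d.e.monotone h i))
  idem' x := by
    have : d.pat (d.e.symm fun i => (f.val (d.pat x) i).toFun (d.e x i)) =
        {i | ¬IsTop (f.val (d.pat x) i)} := by
      ext i
      simp only [pat, OrderIso.apply_symm_apply, ne_eq, Set.mem_ofPred_eq, not_iff_not]
      constructor
      · intro h
        by_cases hi : (d.e x i).1 = T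
        · exact f.isTop' _ _ (d.notMem_pat.2 hi)
        · exact d.isTop_of_eq hi h
      · intro h
        exact d.isTop_iff.1 h _
    rw [this, f.interior']
    simp [Clo.idem']
  smul' g x y h := by
    have hg := d.mem_of_X g x.1 x.2 (h ▸ y.2)
    apply d.eq_smul hg
    intro i
    simp only [OrderIso.apply_symm_apply]
    rw [d.pat_smul hg h]
    exact (f.val _ i).smul' g _ _ (d.e_smul g hg x y h i)

theorem e_clo (f : Dat fun i => Clo G (Y i)) (x : X) (i : ι) :
    d.e ((d.clo f).toFun x) i = (f.val (d.pat x) i).toFun (d.e x i) := by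
  simp [clo]

theorem clo_le_iff {f f' : Dat fun i => Clo G (Y i)} : d.clo f ≤ d.clo f' ↔ f ≤ f' := by
  constructor
  · intro h S i
    by_cases hi : i ∈ S
    · intro z
      by_cases hz : z.1 = T
      · exact (d.le_Y i _ ((f.val S i).toFun z).2).trans (hz ▸ (f'.val S i).le_cl' z)
      · have := d.e.monotone (h (d.pt S i z)) i
        rwa [e_clo, e_clo, d.pat_pt hi hz, e_pt_self] at this
    · exact f'.isTop' _ _ hi _
  · intro h x
    rw [← d.e.le_iff_le]
    intro i
    rw [e_clo, e_clo]
    exact h _ _ _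

open Classical in
/-- The component at `(S, i)` of a closure operation on a product. -/
def comp (c : Clo G X) (S : Set ι) (i : ι) : Clo G (Y i) :=
  if i ∈ S then
    { toFun := fun z => d.e (c.toFun (d.pt S i z)) i
      le_cl' := fun z => by
        have := d.e.monotone (c.le_cl' (d.pt S i z)) i
        rwa [e_pt_self] at this
      mono' := fun z z' h => d.e.monotone (c.mono' (d.pt_mono subset_rfl h)) i
      idem' := fun z => by
        refine le_antisymm ?_ ?_
        · have : d.pt S i (d.e (c.toFun (d.pt S i z)) i) ≤ c.toFun (d.pt S i z) := by
            rw [← d.e.le_iff_le]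
            intro j
            by_cases hj : j = i
            · subst hj; rw [e_pt_self]
            · rw [e_pt_ne _ _ hj, ← d.e_pt_ne S hj z]
              exact d.e.monotone (c.le_cl' _) j
          have := d.e.monotone (c.mono' this) i
          rwa [c.idem'] at this
        · have := d.e.monotone (c.le_cl' (d.pt S i (d.e (c.toFun (d.pt S i z)) i))) i
          rwa [e_pt_self] at this
      smul' := fun g z z' h => by
        have hg := d.mem_of_Y g i z.1 z.2 (h ▸ z'.2)
        let x : X := ⟨g • (d.pt S i z).1, d.smul_X g hg _ (d.pt S i z).2⟩
        rw [← d.e_smul g hg _ _ (c.smul' g (d.pt S i z) x rfl) i]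
        refine congrArg _ (d.apply_eq_of_eq c ?_ ?_)
        · apply Subtype.ext
          rw [d.e_smul g hg _ x rfl, e_pt_self, e_pt_self, h]
        · rw [d.pat_smul hg (x := d.pt S i z) (y := x) rfl]
          ext j
          by_cases hj : j = i
          · subst hj
            simp only [pat, e_pt_self, Set.mem_ofPred_eq, ne_eq, h,
              d.smul_eq_iff hg]
          · simp [pat, e_pt_ne, hj] }
  else Clo.const ⟨T, d.mem_Y i⟩ (fun y => d.le_Y i _ y.2)
      (fun g x y hxy => (d.smul_T g (d.mem_of_Y g i x.1 x.2 (hxy ▸ y.2))).symm)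

theorem comp_apply (c : Clo G X) {S : Set ι} {i : ι} (hi : i ∈ S) (z : Y i) :
    (d.comp c S i).toFun z = d.e (c.toFun (d.pt S i z)) i := by
  simp [comp, hi]

theorem isTop_comp (c : Clo G X) {S : Set ι} {i : ι} (hi : i ∉ S) : IsTop (d.comp c S i) := by
  rw [d.isTop_iff]
  simp [comp, hi, Clo.const]

theorem comp_anti (c : Clo G X) {S S' : Set ι} (h : S ⊆ S') (i : ι) :
    d.comp c S' i ≤ d.comp c S i := by
  by_cases hi : i ∈ S
  · intro z
    rw [d.comp_apply c hi, d.comp_apply c (h hi)]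
    exact d.e.monotone (c.mono' (d.pt_mono h le_rfl)) i
  · exact d.isTop_comp c hi _

theorem comp_interior (c : Clo G X) (S : Set ι) :
    d.comp c {i | ¬IsTop (d.comp c S i)} = d.comp c S := by
  set S₂ := {i | ¬IsTop (d.comp c S i)} with hS₂
  have hsub : S₂ ⊆ S := fun i hi => by
    by_contra h; exact hi (d.isTop_comp c h)
  funext i
  refine le_antisymm ?_ (d.comp_anti c hsub i)
  by_cases hi : i ∈ S₂
  · have hiS := hsub hi
    intro z
    by_cases hz : z.1 = T
    · exact (d.le_Y i _ ((d.comp c S₂ i).toFun z).2).trans (hz ▸ (d.comp c S i).le_cl' z)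
    set w := c.toFun (d.pt S i z) with hw
    have hne : ∀ j ∈ S, (d.e w j).1 ≠ T ↔ j ∈ S₂ := by
      intro j hj
      rw [hS₂, Set.mem_ofPred_eq, not_iff_not]
      by_cases hji : j = i
      · subst hji
        rw [hw, ← d.comp_apply c hj]
        exact ⟨d.isTop_of_eq hz, fun h => d.isTop_iff.1 h _⟩
      · have h1 : d.e w j = (d.comp c S j).toFun (d.base j) := by
          rw [hw, d.comp_apply c hj]
          apply d.apply_eq_of_eq
          · rw [e_pt_ne _ _ hji, e_pt_self]; simp [baseOn, hj]
          · rw [d.pat_pt hiS hz, d.pat_pt hj (d.base_ne j)]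
        rw [h1]
        exact ⟨d.isTop_of_eq (d.base_ne j), fun h => d.isTop_iff.1 h _⟩
    have hpat : d.pat w = S₂ := by
      ext j
      by_cases hj : j ∈ S
      · exact hne j hj
      · refine ⟨fun h => absurd ?_ h, fun h => absurd (hsub h) hj⟩
        have := d.pat_anti (c.le_cl' (d.pt S i z))
        rw [d.pat_pt hiS hz] at this
        exact d.notMem_pat.1 fun h' => hj (this h')
    have hwi : (d.e w i).1 ≠ T := (hne i hiS).2 hi
    have h2 : d.e (c.toFun (d.pt S₂ i (d.e w i))) i = d.e w i := by
      have : d.e (c.toFun (d.pt S₂ i (d.e w i))) i = d.e (c.toFun w) i := by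
        apply d.apply_eq_of_eq
        · rw [e_pt_self]
        · rw [d.pat_pt hi hwi, hpat]
      rw [this, hw, c.idem']
    rw [d.comp_apply c hi, d.comp_apply c hiS, ← hw, ← h2]
    refine d.e.monotone (c.mono' (d.pt_mono subset_rfl ?_)) i
    have := d.e.monotone (c.le_cl' (d.pt S i z)) i
    rwa [e_pt_self] at this
  · rw [hS₂, Set.mem_ofPred_eq, not_not] at hi
    exact hi _

/-- Closure operations on a product correspond to families of closure operations on the factors. -/
def orderIso : (Dat fun i => Clo G (Y i)) ≃o Clo G X :=
  RelIso.ofSurjective (OrderEmbedding.ofMapLEIff d.clo fun _ _ => d.clo_le_iff) fun c =>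
    ⟨⟨d.comp c, fun _ _ h => d.isTop_comp c h, fun _ _ h i => d.comp_anti c h i,
      d.comp_interior c⟩, Clo.ext' fun x => d.e.injective (funext fun i => by
        change d.e ((d.clo _).toFun x) i = _
        rw [d.e_clo]
        by_cases hi : i ∈ d.pat x
        · rw [d.comp_apply c hi]
          apply d.apply_eq_of_eq
          · rw [e_pt_self]
          · rw [d.pat_pt hi hi]
        · apply Subtype.ext
          rw [d.isTop_iff.1 (d.isTop_comp c hi)]
          exact (d.eq_of_le (c.le_cl' x) (d.notMem_pat.1 hi)).symm)⟩

theorem e_orderIso (f : Dat fun i => Clo G (Y i)) (x : X) (i : ι) :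
    d.e ((d.orderIso f).toFun x) i = (f.val (d.pat x) i).toFun (d.e x i) :=
  d.e_clo f x i

theorem pat_subset_pat_orderIso_iff (f : Dat fun i => Clo G (Y i)) (x : X) :
    d.pat x ⊆ d.pat ((d.orderIso f).toFun x) ↔ d.pat x ∈ f.supp := by
  refine forall₂_congr fun i hi => ?_
  rw [pat, Set.mem_ofPred_eq, e_orderIso, not_iff_not]
  exact ⟨d.isTop_of_eq hi, fun h => d.isTop_iff.1 h _⟩

end Decomp

end Paper

namespace Paper

namespace Clo

variable {G α : Type*} [PartialOrder α] [SMul G α] {X : Set α}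

open Classical in
/-- The closure of an element of `X`, extended by the identity outside `X`. -/
def val (c : Clo G X) (x : α) : α := if h : x ∈ X then (c.toFun ⟨x, h⟩).1 else x

theorem val_eq (c : Clo G X) {x : α} (h : x ∈ X) : c.val x = (c.toFun ⟨x, h⟩).1 := by
  simp [val, h]

theorem val_coe (c : Clo G X) (x : X) : c.val x.1 = (c.toFun x).1 := c.val_eq x.2

theorem val_mem (c : Clo G X) {x : α} (h : x ∈ X) : c.val x ∈ X := by
  rw [c.val_eq h]; exact (c.toFun ⟨x, h⟩).2

theorem le_val (c : Clo G X) {x : α} (h : x ∈ X) : x ≤ c.val x := by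
  rw [c.val_eq h]; exact c.le_cl' ⟨x, h⟩

theorem val_mono (c : Clo G X) {x y : α} (hx : x ∈ X) (hy : y ∈ X) (h : x ≤ y) :
    c.val x ≤ c.val y := by
  rw [c.val_eq hx, c.val_eq hy]; exact c.mono' h

theorem val_idem (c : Clo G X) {x : α} (h : x ∈ X) : c.val (c.val x) = c.val x := by
  rw [c.val_eq h, c.val_eq (c.toFun ⟨x, h⟩).2, c.idem']

theorem val_smul (c : Clo G X) (g : G) {x : α} (h : x ∈ X) (h' : g • x ∈ X) :
    c.val (g • x) = g • c.val x := by
  rw [c.val_eq h, c.val_eq h', c.smul' g ⟨x, h⟩ ⟨_, h'⟩ rfl]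

theorem val_le_of_le (c : Clo G X) {x y : α} (hx : x ∈ X) (hy : y ∈ X) (h : x ≤ c.val y) :
    c.val x ≤ c.val y := by
  rw [← c.val_idem hy]; exact c.val_mono hx (c.val_mem hy) h

theorem le_iff_val {c c' : Clo G X} : c ≤ c' ↔ ∀ x ∈ X, c.val x ≤ c'.val x := by
  constructor
  · intro h x hx
    rw [c.val_eq hx, c'.val_eq hx]; exact h _
  · intro h x
    have := h x.1 x.2
    rwa [val_coe, val_coe] at this

theorem ext_val {c c' : Clo G X} (h : ∀ x ∈ X, c.val x = c'.val x) : c = c' :=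
  le_antisymm (le_iff_val.2 fun x hx => (h x hx).le) (le_iff_val.2 fun x hx => (h x hx).ge)

/-- A closure operation on `X` from a self-map of the ambient set. -/
def ofFun (f : α → α) (mem : ∀ x ∈ X, f x ∈ X) (le : ∀ x ∈ X, x ≤ f x)
    (mono : ∀ x ∈ X, ∀ y ∈ X, x ≤ y → f x ≤ f y) (idem : ∀ x ∈ X, f (f x) = f x)
    (smul : ∀ g : G, ∀ x ∈ X, g • x ∈ X → f (g • x) = g • f x) : Clo G X where
  toFun x := ⟨f x.1, mem x.1 x.2⟩
  le_cl' x := le x.1 x.2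
  mono' x y h := mono x.1 x.2 y.1 y.2 h
  idem' x := Subtype.ext (idem x.1 x.2)
  smul' g x y h := by
    change f y.1 = g • f x.1
    rw [h]
    exact smul g x.1 x.2 (h ▸ y.2)

theorem val_ofFun {f : α → α} {mem le mono idem smul} {x : α} (h : x ∈ X) :
    (ofFun (G := G) (X := X) f mem le mono idem smul).val x = f x := by
  rw [val_eq _ h]; rfl

end Clo

/-- Pairs of elements of two posets such that the first one is the largest element or
the second one is the smallest element. -/
abbrev Glue (A B : Type*) [PartialOrder A] [PartialOrder B] : Type _ :=
  {p : A × B // IsTop p.1 ∨ IsBot p.2}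

/-- Gluing is functorial for order isomorphisms. -/
def Glue.congr {A A' B B' : Type*} [PartialOrder A] [PartialOrder B] [PartialOrder A']
    [PartialOrder B'] (e : A ≃o A') (f : B ≃o B') : Glue A B ≃o Glue A' B' where
  toFun p := ⟨(e p.1.1, f p.1.2), p.2.imp (OrderIso.isTop_apply_iff e).2
    (OrderIso.isBot_apply_iff f).2⟩
  invFun p := ⟨(e.symm p.1.1, f.symm p.1.2), p.2.imp (OrderIso.isTop_apply_iff e.symm).2
    (OrderIso.isBot_apply_iff f.symm).2⟩
  left_inv p := by simp
  right_inv p := by simp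
  map_rel_iff' {p q} := by
    change (e p.1.1 ≤ e q.1.1 ∧ f p.1.2 ≤ f q.1.2) ↔ (p.1.1 ≤ q.1.1 ∧ p.1.2 ≤ q.1.2)
    simp

/-- A subset `Y` of an ordered `G`-set obtained from a linearly ordered subset `V` by inserting
translates of the interval `(w, v]`. -/
structure GlueData (G : Type*) [Group G] {α : Type*} [PartialOrder α] [MulAction G α]
    (Y V : Set α) (w v : α) where
  H : Subgroup G
  V_sub : V ⊆ Y
  Ioc_sub : Set.Ioc w v ⊆ Y
  w_mem : w ∈ V
  v_mem : v ∈ V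
  lt : w < v
  mono : ∀ (g : G) (x y : α), x ≤ y → g • x ≤ g • y
  mem_of_Y : ∀ g : G, ∀ y ∈ Y, g • y ∈ Y → g ∈ H
  smul_Y : ∀ g ∈ H, ∀ y ∈ Y, g • y ∈ Y
  smul_V : ∀ g ∈ H, ∀ y ∈ V, g • y ∈ V
  cover : ∀ y ∈ Y, y ∈ V ∨ ∃ g ∈ H, g⁻¹ • y ∈ Set.Ioc w v
  lin : ∀ u ∈ V, u ≤ w ∨ v ≤ u
  sep : ∀ u ∈ V, ∀ u' ∈ V, ¬u' ≤ u → ∃ g ∈ H, u ≤ g • w ∧ g • v ≤ u'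
  fixed : ∀ x ∈ Set.Ioc w v, (∀ g : G, g • v = v → g • x = x) → x = v
  stab : ∀ g : G, g • v = v → g • w = w
  stab_of_Ioc : ∀ g : G, ∀ x ∈ Set.Ioc w v, g • x ∈ Set.Ioc w v → g • v = v

namespace GlueData

variable {G : Type*} [Group G] {α : Type*} [PartialOrder α] [MulAction G α]
    {Y V : Set α} {w v : α} (d : GlueData G Y V w v)

include d

theorem le_smul_iff {g : G} {x y : α} : x ≤ g • y ↔ g⁻¹ • x ≤ y :=
  ⟨fun h => by simpa using d.mono g⁻¹ _ _ h, fun h => by simpa using d.mono g _ _ h⟩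

theorem smul_le_iff {g : G} {x y : α} : g • x ≤ y ↔ x ≤ g⁻¹ • y :=
  ⟨fun h => by simpa using d.mono g⁻¹ _ _ h, fun h => by simpa using d.mono g _ _ h⟩

theorem v_mem_Ioc : v ∈ Set.Ioc w v := ⟨d.lt, le_rfl⟩

theorem lin_smul {g : G} (hg : g ∈ d.H) {u : α} (hu : u ∈ V) : u ≤ g • w ∨ g • v ≤ u := by
  exact (d.lin _ (d.smul_V _ (inv_mem hg) _ hu)).imp d.le_smul_iff.2 d.smul_le_iff.2

theorem eq_of_mem_V {g : G} (hg : g ∈ d.H) {y : α} (hy : g⁻¹ • y ∈ Set.Ioc w v) (hV : y ∈ V) :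
    y = g • v := by
  have h := d.lin _ (d.smul_V _ (inv_mem hg) _ hV)
  rw [← inv_smul_eq_iff]
  rcases h with h | h
  · exact absurd h (not_le_of_gt hy.1)
  · exact le_antisymm hy.2 h

theorem smul_w_le {g : G} {y : α} (hy : g⁻¹ • y ∈ Set.Ioc w v) : g • w ≤ y :=
  d.smul_le_iff.2 hy.1.le

theorem le_smul_v {g : G} {y : α} (hy : g⁻¹ • y ∈ Set.Ioc w v) : y ≤ g • v :=
  d.le_smul_iff.2 hy.2

theorem w_mem_Y : w ∈ Y := d.V_sub d.w_mem

theorem v_mem_Y : v ∈ Y := d.V_sub d.v_mem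

theorem val_mem_V (c : Clo G Y) {u : α} (hu : u ∈ V) : c.val u ∈ V := by
  have huY := d.V_sub hu
  rcases d.cover _ (c.val_mem huY) with h | ⟨g, hg, h⟩
  · exact h
  have hgw := d.smul_Y g hg _ d.w_mem_Y
  rcases d.lin_smul hg hu with h1 | h1
  · have h2 : c.val (g • w) = c.val u := le_antisymm
      (c.val_le_of_le hgw huY (d.smul_w_le h)) (c.val_mono huY hgw h1)
    rw [c.val_smul g d.w_mem_Y hgw] at h2
    rw [← h2, inv_smul_smul] at h
    have h3 := d.fixed _ h fun k hk => by
      have hw := d.stab k hk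
      rw [← c.val_smul k d.w_mem_Y (hw.symm ▸ d.w_mem_Y), hw]
    rw [← h2, h3]
    exact d.smul_V g hg _ d.v_mem
  · rw [le_antisymm (d.le_smul_v h) (h1.trans (c.le_val huY))]
    exact d.smul_V g hg _ d.v_mem

theorem le_val_w (c : Clo G Y) {u : α} (hu : u ∈ V) (h : c.val u ≠ u) : v ≤ c.val w := by
  have huY := d.V_sub hu
  obtain ⟨g, hg, h1, h2⟩ := d.sep u hu _ (d.val_mem_V c hu)
    fun h' => h (le_antisymm h' (c.le_val huY))
  have hgw := d.smul_Y g hg _ d.w_mem_Y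
  have h3 := h2.trans (c.val_mono huY hgw h1)
  rw [c.val_smul g d.w_mem_Y hgw, d.smul_le_iff, inv_smul_smul] at h3
  exact h3

theorem val_eq_of_le_val_w (c : Clo G Y) (h : v ≤ c.val w) {g : G} (hg : g ∈ d.H) {y : α}
    (hY : y ∈ Y) (hy : g⁻¹ • y ∈ Set.Ioc w v) : c.val y = c.val (g • v) := by
  have hgv := d.smul_Y g hg _ d.v_mem_Y
  have hgw := d.smul_Y g hg _ d.w_mem_Y
  refine le_antisymm (c.val_mono hY hgv (d.le_smul_v hy)) (c.val_le_of_le hgv hY ?_)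
  refine le_trans ?_ (c.val_mono hgw hY (d.smul_w_le hy))
  rw [c.val_smul g d.w_mem_Y hgw]
  exact d.mono g _ _ h

/-- Restriction of a closure operation to `V`. -/
def resV (c : Clo G Y) : Clo G V :=
  Clo.ofFun c.val (fun _ h => d.val_mem_V c h) (fun _ h => c.le_val (d.V_sub h))
    (fun _ h _ h' => c.val_mono (d.V_sub h) (d.V_sub h')) (fun _ h => c.val_idem (d.V_sub h))
    (fun _ _ h h' => c.val_smul _ (d.V_sub h) (d.V_sub h'))

open Classical in
/-- The closure operation on the interval `(w, v]` induced by a closure operation on `Y`. -/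
def resIoc (c : Clo G Y) : Clo G (Set.Ioc w v) :=
  if h : c.val v = v then
    Clo.ofFun c.val
      (fun _ hx => Set.mem_Ioc.2 ⟨hx.1.trans_le (c.le_val (d.Ioc_sub hx)),
        (c.val_mono (d.Ioc_sub hx) d.v_mem_Y hx.2).trans h.le⟩)
      (fun _ hx => c.le_val (d.Ioc_sub hx))
      (fun _ h _ h' => c.val_mono (d.Ioc_sub h) (d.Ioc_sub h'))
      (fun _ h => c.val_idem (d.Ioc_sub h))
      (fun _ _ h h' => c.val_smul _ (d.Ioc_sub h) (d.Ioc_sub h'))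
  else Clo.const ⟨v, d.v_mem_Ioc⟩ (fun x => x.2.2)
    (fun g x y h => (d.stab_of_Ioc g x.1 x.2 (h ▸ y.2)).symm)

theorem resIoc_val_of_eq {c : Clo G Y} (h : c.val v = v) {x : α} (hx : x ∈ Set.Ioc w v) :
    (d.resIoc c).val x = c.val x := by
  simp only [resIoc, dif_pos h]
  exact Clo.val_ofFun hx

theorem isTop_Ioc_iff {c : Clo G (Set.Ioc w v)} :
    IsTop c ↔ ∀ x ∈ Set.Ioc w v, c.val x = v := by
  constructor
  · intro h x hx
    have hs := Clo.le_iff_val.1 (h (Clo.const ⟨v, d.v_mem_Ioc⟩ (fun x => x.2.2)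
      (fun g x y h => (d.stab_of_Ioc g x.1 x.2 (h ▸ y.2)).symm))) x hx
    rw [Clo.val_eq _ hx] at hs
    exact le_antisymm (c.val_mem hx).2 hs
  · intro h c'
    rw [Clo.le_iff_val]
    intro x hx
    rw [h x hx]
    exact (c'.val_mem hx).2

theorem isTop_resIoc_of_ne {c : Clo G Y} (h : c.val v ≠ v) : IsTop (d.resIoc c) := by
  rw [d.isTop_Ioc_iff]
  intro x hx
  rw [resIoc, dif_neg h, Clo.val_eq _ hx]
  rfl

theorem isBot_V_iff {c : Clo G V} : IsBot c ↔ ∀ x ∈ V, c.val x = x := by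
  rw [Clo.isBot_iff]
  exact ⟨fun h x hx => by rw [c.val_eq hx, h], fun h x => by
    have := h x.1 x.2; rw [Clo.val_coe] at this; exact Subtype.ext this⟩

theorem resV_val (c : Clo G Y) {u : α} (hu : u ∈ V) : (d.resV c).val u = c.val u :=
  Clo.val_ofFun hu

theorem isTop_or_isBot (c : Clo G Y) : IsTop (d.resIoc c) ∨ IsBot (d.resV c) := by
  by_cases hb : IsBot (d.resV c)
  · exact Or.inr hb
  left
  by_cases h : c.val v = v
  · rw [d.isBot_V_iff] at hb
    push Not at hb
    obtain ⟨u, hu, hne⟩ := hb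
    rw [d.resV_val c hu] at hne
    have hw := d.le_val_w c hu hne
    rw [d.isTop_Ioc_iff]
    intro x hx
    rw [d.resIoc_val_of_eq h hx, d.val_eq_of_le_val_w c hw (one_mem _) (d.Ioc_sub hx)
      (by simpa using hx), one_smul, h]
  · exact d.isTop_resIoc_of_ne h

theorem smul_inv_smul_val (c : Clo G Y) {g : G} {y : α} (hY : y ∈ Y) (hy : g⁻¹ • y ∈ Set.Ioc w v) :
    c.val y = g • c.val (g⁻¹ • y) := by
  rw [← c.val_smul g (d.Ioc_sub hy) (by simpa using hY), smul_inv_smul]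

theorem le_iff (c c' : Clo G Y) :
    d.resIoc c ≤ d.resIoc c' ∧ d.resV c ≤ d.resV c' ↔ c ≤ c' := by
  constructor
  · rintro ⟨ha, hb⟩
    have hV : ∀ u ∈ V, c.val u ≤ c'.val u := fun u hu => by
      have := Clo.le_iff_val.1 hb u hu
      rwa [d.resV_val _ hu, d.resV_val _ hu] at this
    rw [Clo.le_iff_val]
    intro y hY
    rcases d.cover y hY with hy | ⟨g, hg, hy⟩
    · exact hV y hy
    by_cases hbot : IsBot (d.resV c')
    · rw [d.isBot_V_iff] at hbot
      have hv' : c'.val v = v := by rw [← d.resV_val _ d.v_mem, hbot _ d.v_mem]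
      have hv : c.val v = v := le_antisymm ((hV v d.v_mem).trans hv'.le) (c.le_val d.v_mem_Y)
      have := Clo.le_iff_val.1 ha _ hy
      rw [d.resIoc_val_of_eq hv hy, d.resIoc_val_of_eq hv' hy] at this
      rw [d.smul_inv_smul_val c hY hy, d.smul_inv_smul_val c' hY hy]
      exact d.mono g _ _ this
    · rw [d.isBot_V_iff] at hbot
      push Not at hbot
      obtain ⟨u, hu, hne⟩ := hbot
      rw [d.resV_val _ hu] at hne
      rw [d.val_eq_of_le_val_w c' (d.le_val_w c' hu hne) hg hY hy]
      have hgv := d.smul_V g hg _ d.v_mem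
      exact (c.val_mono hY (d.V_sub hgv) (d.le_smul_v hy)).trans (hV _ hgv)
  · intro h
    rw [Clo.le_iff_val] at h
    constructor
    · by_cases hv' : c'.val v = v
      · have hv : c.val v = v := le_antisymm ((h v d.v_mem_Y).trans hv'.le) (c.le_val d.v_mem_Y)
        rw [Clo.le_iff_val]
        intro x hx
        rw [d.resIoc_val_of_eq hv hx, d.resIoc_val_of_eq hv' hx]
        exact h _ (d.Ioc_sub hx)
      · exact d.isTop_resIoc_of_ne hv' _
    · rw [Clo.le_iff_val]
      intro u hu
      rw [d.resV_val _ hu, d.resV_val _ hu]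
      exact h _ (d.V_sub hu)

theorem stab_of_Ioc_Ioc {g g' : G} {y : α} (hy : g⁻¹ • y ∈ Set.Ioc w v)
    (hy' : g'⁻¹ • y ∈ Set.Ioc w v) : g • v = g' • v := by
  have := d.stab_of_Ioc (g'⁻¹ * g) _ hy (by simpa [mul_smul] using hy')
  rw [mul_smul, inv_smul_eq_iff] at this
  exact this

/-- The smallest element of `V` above an element of `Y`. -/
theorem exists_hull : ∃ f : α → α, (∀ u ∈ V, f u = u) ∧
    ∀ g ∈ d.H, ∀ y ∈ Y, g⁻¹ • y ∈ Set.Ioc w v → f y = g • v := by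
  classical
  refine ⟨fun y => if h : y ∉ V ∧ ∃ g ∈ d.H, g⁻¹ • y ∈ Set.Ioc w v then h.2.choose • v else y,
    fun u hu => by simp [hu], fun g hg y hY hy => ?_⟩
  by_cases hV : y ∈ V
  · simpa [hV] using d.eq_of_mem_V hg hy hV
  · have h : y ∉ V ∧ ∃ g ∈ d.H, g⁻¹ • y ∈ Set.Ioc w v := ⟨hV, g, hg, hy⟩
    simp only [dif_pos h]
    exact d.stab_of_Ioc_Ioc h.2.choose_spec.2 hy

theorem exists_of_isTop (a : Clo G (Set.Ioc w v)) (b : Clo G V) (ha : IsTop a) :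
    ∃ c : Clo G Y, d.resIoc c = a ∧ d.resV c = b := by
  obtain ⟨f, hfV, hfY⟩ := d.exists_hull
  have mem : ∀ y ∈ Y, f y ∈ V := fun y hY => by
    rcases d.cover y hY with h | ⟨g, hg, h⟩
    · rwa [hfV y h]
    · rw [hfY g hg y hY h]; exact d.smul_V g hg _ d.v_mem
  have le : ∀ y ∈ Y, y ≤ f y := fun y hY => by
    rcases d.cover y hY with h | ⟨g, hg, h⟩
    · rw [hfV y h]
    · rw [hfY g hg y hY h]; exact d.le_smul_v h
  have least : ∀ y ∈ Y, ∀ u ∈ V, y ≤ u → f y ≤ u := fun y hY u hu hle => by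
    rcases d.cover y hY with h | ⟨g, hg, h⟩
    · rwa [hfV y h]
    · rw [hfY g hg y hY h]
      refine (d.lin_smul hg hu).resolve_left fun h' => ?_
      exact absurd (d.le_smul_iff.1 (hle.trans h')) (not_le_of_gt h.1)
  have smul : ∀ g ∈ d.H, ∀ y ∈ Y, f (g • y) = g • f y := fun g hg y hY => by
    have hgY := d.smul_Y g hg y hY
    apply le_antisymm
    · exact least _ hgY _ (d.smul_V g hg _ (mem y hY)) (d.mono g _ _ (le y hY))
    · rw [d.smul_le_iff]
      exact least _ hY _ (d.smul_V _ (inv_mem hg) _ (mem _ hgY))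
        (d.smul_le_iff.1 (le _ hgY))
  let c : Clo G Y := Clo.ofFun (fun y => b.val (f y))
    (fun y hY => d.V_sub (b.val_mem (mem y hY)))
    (fun y hY => (le y hY).trans (b.le_val (mem y hY)))
    (fun x hx y hy h => b.val_mono (mem x hx) (mem y hy)
      (least x hx _ (mem y hy) (h.trans (le y hy))))
    (fun y hY => by rw [hfV _ (b.val_mem (mem y hY)), b.val_idem (mem y hY)])
    (fun g y hY hgY => by
      have hg := d.mem_of_Y g y hY hgY
      rw [smul g hg y hY, b.val_smul g (mem y hY) (d.smul_V g hg _ (mem y hY))])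
  have hc : ∀ y ∈ Y, c.val y = b.val (f y) := fun y hY => Clo.val_ofFun hY
  refine ⟨c, le_antisymm (ha _) fun x => ?_, Clo.ext_val fun u hu => ?_⟩
  · revert x
    change a ≤ d.resIoc c
    refine (?_ : IsTop (d.resIoc c)) _
    by_cases h : c.val v = v
    · rw [d.isTop_Ioc_iff]
      intro x hx
      rw [d.resIoc_val_of_eq h hx, hc x (d.Ioc_sub hx),
        hfY 1 (one_mem _) x (d.Ioc_sub hx) (by simpa using hx), one_smul]
      rw [hc v d.v_mem_Y, hfV v d.v_mem] at h
      exact h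
    · exact d.isTop_resIoc_of_ne h
  · rw [d.resV_val _ hu, hc u (d.V_sub hu), hfV u hu]

theorem exists_of_isBot (a : Clo G (Set.Ioc w v)) (b : Clo G V) (hb : IsBot b) :
    ∃ c : Clo G Y, d.resIoc c = a ∧ d.resV c = b := by
  classical
  have av : a.val v = v := le_antisymm (a.val_mem d.v_mem_Ioc).2 (a.le_val d.v_mem_Ioc)
  obtain ⟨f, hfV, hfY⟩ : ∃ f : α → α, (∀ u ∈ V, f u = u) ∧
      ∀ g ∈ d.H, ∀ y ∈ Y, g⁻¹ • y ∈ Set.Ioc w v → f y = g • a.val (g⁻¹ • y) := by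
    refine ⟨fun y => if h : y ∉ V ∧ ∃ g ∈ d.H, g⁻¹ • y ∈ Set.Ioc w v then
      h.2.choose • a.val (h.2.choose⁻¹ • y) else y, fun u hu => by simp [hu],
      fun g hg y hY hy => ?_⟩
    by_cases hV : y ∈ V
    · have h := d.eq_of_mem_V hg hy hV
      subst h
      simp [hV, av]
    · have h : y ∉ V ∧ ∃ g ∈ d.H, g⁻¹ • y ∈ Set.Ioc w v := ⟨hV, g, hg, hy⟩
      simp only [dif_pos h]
      have hk := h.2.choose_spec.2
      set k := h.2.choose
      have h1 : k⁻¹ • y = (k⁻¹ * g) • g⁻¹ • y := by simp [mul_smul]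
      rw [h1, a.val_smul _ hy (h1 ▸ hk), mul_smul, smul_inv_smul]
  have mem : ∀ y ∈ Y, f y ∈ Y := fun y hY => by
    rcases d.cover y hY with h | ⟨g, hg, h⟩
    · rwa [hfV y h]
    · rw [hfY g hg y hY h]; exact d.smul_Y g hg _ (d.Ioc_sub (a.val_mem h))
  have le : ∀ y ∈ Y, y ≤ f y := fun y hY => by
    rcases d.cover y hY with h | ⟨g, hg, h⟩
    · rw [hfV y h]
    · rw [hfY g hg y hY h, d.le_smul_iff]; exact a.le_val h
  have smul : ∀ g ∈ d.H, ∀ y ∈ Y, f (g • y) = g • f y := fun g hg y hY => by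
    have hgY := d.smul_Y g hg y hY
    rcases d.cover y hY with h | ⟨k, hk, h⟩
    · rw [hfV y h, hfV _ (d.smul_V g hg _ h)]
    · have h1 : (g * k)⁻¹ • g • y = k⁻¹ • y := by simp [mul_smul]
      rw [hfY k hk y hY h, hfY (g * k) (mul_mem hg hk) _ hgY (h1 ▸ h), h1, mul_smul]
  let c : Clo G Y := Clo.ofFun f mem le
    (fun x hx y hy h => by
      rcases d.cover y hy with hyV | ⟨g, hg, hyg⟩
      · rcases d.cover x hx with hxV | ⟨k, hk, hxk⟩
        · rwa [hfV x hxV, hfV y hyV]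
        · rw [hfV y hyV, hfY k hk x hx hxk]
          have h1 : k • v ≤ y := (d.lin_smul hk hyV).resolve_left fun h' =>
            absurd (d.le_smul_iff.1 (h.trans h')) (not_le_of_gt hxk.1)
          exact (d.mono k _ _ (a.val_mem hxk).2).trans h1
      · rcases d.cover x hx with hxV | ⟨k, hk, hxk⟩
        · rw [hfV x hxV]; exact h.trans (le y hy)
        · have hgv := d.smul_V g hg _ d.v_mem
          have h1 : k • v ≤ g • v := (d.lin_smul hk hgv).resolve_left fun h' =>
            absurd (d.le_smul_iff.1 ((h.trans (d.le_smul_v hyg)).trans h')) (not_le_of_gt hxk.1)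
          rcases d.lin_smul hg (d.smul_V k hk _ d.v_mem) with h2 | h2
          · rw [hfY k hk x hx hxk]
            exact ((d.mono k _ _ (a.val_mem hxk).2).trans (h2.trans (d.smul_w_le hyg))).trans
              (le y hy)
          · have h3 := le_antisymm h1 h2
            have h4 : (g⁻¹ * k) • v = v := by rw [mul_smul, h3, inv_smul_smul]
            have h5 : g • w = k • w := by
              have := d.stab _ h4
              rw [mul_smul, inv_smul_eq_iff] at this
              exact this.symm
            have hyk : k⁻¹ • y ∈ Set.Ioc w v := by
              refine ⟨lt_of_le_of_ne ?_ fun h' => ?_, ?_⟩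
              · rw [← d.smul_le_iff, ← h5]; exact d.smul_w_le hyg
              · rw [eq_inv_smul_iff, ← h5] at h'
                have := hyg.1
                rw [← h', inv_smul_smul] at this
                exact lt_irrefl _ this
              · rw [← d.le_smul_iff, h3]; exact d.le_smul_v hyg
            rw [hfY k hk x hx hxk, hfY k hk y hy hyk]
            exact d.mono k _ _ (a.val_mono hxk hyk (d.mono _ _ _ h)))
    (fun y hY => by
      rcases d.cover y hY with h | ⟨g, hg, h⟩
      · rw [hfV y h, hfV y h]
      · have := a.val_mem h
        rw [hfY g hg y hY h, hfY g hg _ (d.smul_Y g hg _ (d.Ioc_sub this))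
          (by rwa [inv_smul_smul]), inv_smul_smul, a.val_idem h])
    (fun g y hY hgY => smul g (d.mem_of_Y g y hY hgY) y hY)
  have hc : ∀ y ∈ Y, c.val y = f y := fun y hY => Clo.val_ofFun hY
  refine ⟨c, Clo.ext_val fun x hx => ?_, Clo.ext_val fun u hu => ?_⟩
  · rw [d.resIoc_val_of_eq (by rw [hc v d.v_mem_Y, hfV v d.v_mem]) hx, hc x (d.Ioc_sub hx),
      hfY 1 (one_mem _) x (d.Ioc_sub hx) (by simpa using hx)]
    simp
  · rw [d.resV_val _ hu, hc u (d.V_sub hu), hfV u hu, d.isBot_V_iff.1 hb u hu]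

/-- Closure operations on `Y` are glued from closure operations on `(w, v]` and on `V`. -/
def orderIso : Clo G Y ≃o Glue (Clo G (Set.Ioc w v)) (Clo G V) :=
  RelIso.ofSurjective (OrderEmbedding.ofMapLEIff
    (fun c => ⟨(d.resIoc c, d.resV c), d.isTop_or_isBot c⟩) fun c c' => d.le_iff c c') fun p => by
      obtain ⟨c, h1, h2⟩ := p.2.elim (d.exists_of_isTop p.1.1 p.1.2)
        (d.exists_of_isBot p.1.1 p.1.2)
      exact ⟨c, Subtype.ext (Prod.ext h1 h2)⟩

end GlueData

end Paper

namespace Paper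

section

variable {D : Type*} [CommRing D] [IsDomain D]
variable {K : Type*} [Field K] [Algebra D K] [IsFractionRing D K]

theorem Submodule.mem_units_smul_iff {g : Kˣ} {I : Submodule D K} {x : K} :
    x ∈ g • I ↔ (g : K)⁻¹ * x ∈ I := by
  refine (Submodule.mem_smul_pointwise_iff_exists x (g : K) I).trans ⟨?_, fun h => ?_⟩
  · rintro ⟨b, hb, rfl⟩
    simpa using hb
  · exact ⟨_, h, by simp⟩

theorem Submodule.mul_mem_units_smul {g : Kˣ} {I : Submodule D K} {x : K} (h : x ∈ I) :
    (g : K) * x ∈ g • I := by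
  rw [Submodule.mem_units_smul_iff]; simpa using h

theorem Submodule.units_smul_mono (g : Kˣ) (I J : Submodule D K) (h : I ≤ J) : g • I ≤ g • J :=
  fun x hx => by
    rw [Submodule.mem_units_smul_iff] at hx ⊢
    exact h hx

/-- The elements of `K` lying in the localization of `I` at every prime of a given family. -/
def hull (S : Set (Ideal D)) (I : Submodule D K) : Submodule D K where
  carrier := {x | ∀ M ∈ S, M.IsPrime → ∃ d : D, d ∉ M ∧ d • x ∈ I}
  zero_mem' M _ hM := ⟨1, fun h => hM.ne_top ((Ideal.eq_top_iff_one _).2 h), by simp⟩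
  add_mem' {x y} hx hy M h hM := by
    obtain ⟨d, hd, hdx⟩ := hx M h hM
    obtain ⟨e, he, hey⟩ := hy M h hM
    refine ⟨d * e, hM.mul_notMem hd he, ?_⟩
    rw [smul_add, mul_comm d e, mul_smul, mul_comm e d, mul_smul]
    exact I.add_mem (I.smul_mem _ hdx) (I.smul_mem _ hey)
  smul_mem' c x hx M h hM := by
    obtain ⟨d, hd, hdx⟩ := hx M h hM
    refine ⟨d, hd, ?_⟩
    rw [smul_comm]
    exact I.smul_mem _ hdx

variable {S : Set (Ideal D)} {I J : Submodule D K}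

theorem mem_hull {x : K} :
    x ∈ hull S I ↔ ∀ M ∈ S, M.IsPrime → ∃ d : D, d ∉ M ∧ d • x ∈ I := Iff.rfl

theorem one_notMem_prime {M : Ideal D} (hM : M.IsPrime) : (1 : D) ∉ M :=
  fun h => hM.ne_top ((Ideal.eq_top_iff_one _).2 h)

theorem le_hull : I ≤ hull S I :=
  fun x hx _ _ hM => ⟨1, one_notMem_prime hM, by simpa using hx⟩

theorem hull_mono (h : I ≤ J) : hull S I ≤ hull S J := fun _ hx M hMS hM =>
  (hx M hMS hM).imp fun _ hd => ⟨hd.1, h hd.2⟩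

theorem hull_hull : hull S (hull S I) = hull S I := by
  refine le_antisymm (fun x hx M hMS hM => ?_) le_hull
  obtain ⟨d, hd, hdx⟩ := hx M hMS hM
  obtain ⟨e, he, hex⟩ := hdx M hMS hM
  exact ⟨e * d, hM.mul_notMem he hd, by rwa [mul_smul]⟩

theorem hull_smul (g : Kˣ) : hull S (g • I) = g • hull S I := by
  ext x
  rw [Submodule.mem_units_smul_iff]
  simp only [mem_hull, Submodule.mem_units_smul_iff, mul_smul_comm]

/-- The localization of `I` at the prime ideal `P`. -/
def loc (P : Ideal D) (I : Submodule D K) : Submodule D K := hull {P} I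

/-- The intersection of the localizations of `I` at the maximal ideals containing `P`. -/
def sat (P : Ideal D) (I : Submodule D K) : Submodule D K :=
  hull {M | M.IsMaximal ∧ P ≤ M} I

theorem mem_loc {P : Ideal D} [hP : P.IsPrime] {x : K} :
    x ∈ loc P I ↔ ∃ d : D, d ∉ P ∧ d • x ∈ I := by
  simp [loc, mem_hull, hP]

theorem mem_sat {P : Ideal D} {x : K} :
    x ∈ sat P I ↔ ∀ M : Ideal D, M.IsMaximal → P ≤ M → ∃ d : D, d ∉ M ∧ d • x ∈ I :=
  ⟨fun h M hM hP => h M ⟨hM, hP⟩ hM.isPrime, fun h M hM _ => h M hM.1 hM.2⟩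

theorem sat_le_loc {P : Ideal D} [hP : P.IsPrime] : sat P I ≤ loc P I := by
  intro x hx
  obtain ⟨M, hM, hPM⟩ := Ideal.exists_le_maximal P hP.ne_top
  obtain ⟨d, hd, hdx⟩ := mem_sat.1 hx M hM hPM
  exact mem_loc.2 ⟨d, fun h => hd (hPM h), hdx⟩

theorem le_sat {P : Ideal D} : I ≤ sat P I := le_hull

theorem loc_mono {P : Ideal D} (h : I ≤ J) : loc P I ≤ loc P J := hull_mono h

theorem loc_le_loc {P M : Ideal D} [hP : P.IsPrime] [hM : M.IsPrime] (h : P ≤ M) :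
    loc M I ≤ loc P I := fun x hx => by
  rw [mem_loc] at hx ⊢
  exact hx.imp fun d hd => ⟨fun h' => hd.1 (h h'), hd.2⟩

variable (K) in
/-- The localization of `D` at `P`, as a submodule of `K`. -/
def O (P : Ideal D) : Submodule D K := loc P 1

variable (K) in
/-- The maximal ideal of the localization of `D` at `P`. -/
def m (P : Ideal D) : Submodule D K := loc P (idealToK D K P)

theorem mem_O {P : Ideal D} [hP : P.IsPrime] {x : K} :
    x ∈ O K P ↔ ∃ d : D, d ∉ P ∧ ∃ a : D, d • x = algebraMap D K a := by
  simp only [O, mem_loc, Submodule.mem_one, eq_comm]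

theorem mem_m {P : Ideal D} [hP : P.IsPrime] {x : K} :
    x ∈ m K P ↔ ∃ d : D, d ∉ P ∧ ∃ a ∈ P, d • x = algebraMap D K a := by
  simp only [m, mem_loc, idealToK, Submodule.mem_map, eq_comm, Algebra.linearMap_apply]

variable {P Q M : Ideal D} [hP : P.IsPrime] [hQ : Q.IsPrime] [hM : M.IsPrime]

theorem mem_locAt {hP : P.IsPrime} {x : K} : x ∈ locAt D K P hP ↔ x ∈ O K P := by
  have : x ∈ locAt D K P hP ↔ ∃ a s : D, ∃ hs : s ∈ P.primeCompl,
      x = IsLocalization.mk' K a (⟨s, mem_nonZeroDivisors_of_ne_zero fun h =>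
        hs (h ▸ P.zero_mem)⟩ : nonZeroDivisors D) := Iff.rfl
  rw [this, mem_O]
  constructor
  · rintro ⟨a, s, hs, rfl⟩
    refine ⟨s, hs, a, ?_⟩
    rw [Algebra.smul_def]
    exact IsLocalization.mk'_spec' (M := nonZeroDivisors D) K a ⟨s, _⟩
  · rintro ⟨s, hs, a, h⟩
    refine ⟨a, s, hs, ?_⟩
    rw [Algebra.smul_def] at h
    rw [IsLocalization.eq_mk'_iff_mul_eq, ← h, mul_comm]

theorem m_le_O : m K P ≤ O K P := fun x hx => by
  obtain ⟨d, hd, a, _, h⟩ := mem_m.1 hx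
  exact mem_O.2 ⟨d, hd, a, h⟩

theorem one_mem_O : (1 : K) ∈ O K P := mem_O.2 ⟨1, one_notMem_prime hP, 1, by simp⟩

theorem algebraMap_mem_O (a : D) : algebraMap D K a ∈ O K P :=
  mem_O.2 ⟨1, one_notMem_prime hP, a, by simp⟩

theorem one_notMem_m : (1 : K) ∉ m K P := fun h => by
  obtain ⟨d, hd, a, ha, h⟩ := mem_m.1 h
  rw [Algebra.smul_def, mul_one] at h
  exact hd (IsFractionRing.injective D K h ▸ ha)

theorem mul_mem_O {x y : K} (hx : x ∈ O K P) (hy : y ∈ O K P) : x * y ∈ O K P := by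
  obtain ⟨d, hd, a, hx⟩ := mem_O.1 hx
  obtain ⟨e, he, b, hy⟩ := mem_O.1 hy
  refine mem_O.2 ⟨d * e, hP.mul_notMem hd he, a * b, ?_⟩
  rw [map_mul, ← hx, ← hy, smul_mul_smul_comm]

theorem mul_mem_m {x y : K} (hx : x ∈ O K P) (hy : y ∈ m K P) : x * y ∈ m K P := by
  obtain ⟨d, hd, a, hx⟩ := mem_O.1 hx
  obtain ⟨e, he, b, hb, hy⟩ := mem_m.1 hy
  refine mem_m.2 ⟨d * e, hP.mul_notMem hd he, a * b, P.mul_mem_left _ hb, ?_⟩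
  rw [map_mul, ← hx, ← hy, smul_mul_smul_comm]

theorem ne_zero_of_notMem {x : K} (hx : x ∉ I) : x ≠ 0 := fun h => hx (h ▸ I.zero_mem)

theorem inv_mem_O_of_mem {x : K} (hx : x ∈ O K P) (hx' : x ∉ m K P) : x⁻¹ ∈ O K P := by
  have h0 := ne_zero_of_notMem hx'
  obtain ⟨d, hd, a, h⟩ := mem_O.1 hx
  refine mem_O.2 ⟨a, fun ha => hx' (mem_m.2 ⟨d, hd, a, ha, h⟩), d, ?_⟩
  rw [Algebra.smul_def, ← h, Algebra.smul_def, mul_assoc, mul_inv_cancel₀ h0, mul_one]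

theorem inv_algebraMap_mem_O {d : D} (hd : d ∉ P) : (algebraMap D K d)⁻¹ ∈ O K P := by
  refine mem_O.2 ⟨d, hd, 1, ?_⟩
  rw [Algebra.smul_def, map_one]
  exact mul_inv_cancel₀ fun h => hd (by
    rw [(map_eq_zero_iff _ (IsFractionRing.injective D K)).1 h]; exact P.zero_mem)

theorem algebraMap_mem_m_iff {a : D} : algebraMap D K a ∈ m K P ↔ a ∈ P := by
  refine ⟨fun h => by_contra fun ha => ?_, fun h =>
    mem_m.2 ⟨1, one_notMem_prime hP, a, h, by simp⟩⟩
  have := mul_mem_m (inv_algebraMap_mem_O (K := K) ha) h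
  rw [inv_mul_cancel₀ (ne_zero_of_notMem (I := (⊥ : Submodule D K)) ?_)] at this
  · exact one_notMem_m this
  · intro h0
    rw [Submodule.mem_bot, map_eq_zero_iff _ (IsFractionRing.injective D K)] at h0
    exact ha (h0 ▸ P.zero_mem)

/-- A submodule is closed under localization at `P` if and only if it is stable under
multiplication by elements of the localization of `D`. -/
theorem loc_le_iff : loc P I ≤ I ↔ ∀ c ∈ O K P, ∀ x ∈ I, c * x ∈ I := by
  constructor
  · intro h c hc x hx
    obtain ⟨d, hd, a, hc⟩ := mem_O.1 hc
    apply h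
    refine mem_loc.2 ⟨d, hd, ?_⟩
    rw [← smul_mul_assoc, hc, ← Algebra.smul_def]
    exact I.smul_mem _ hx
  · intro h x hx
    obtain ⟨d, hd, hx⟩ := mem_loc.1 hx
    have := h _ (inv_algebraMap_mem_O hd) _ hx
    rwa [Algebra.smul_def, inv_mul_cancel_left₀] at this
    exact fun h => hd (by
      rw [(map_eq_zero_iff _ (IsFractionRing.injective D K)).1 h]; exact P.zero_mem)

theorem O_le_O (h : P ≤ M) : O K M ≤ O K P := loc_le_loc h

theorem loc_O_le (h : P ≤ M) : loc M (O K P) ≤ O K P :=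
  loc_le_iff.2 fun _ hc _ hx => mul_mem_O (O_le_O h hc) hx

theorem loc_m_le (h : P ≤ M) : loc M (m K P) ≤ m K P :=
  loc_le_iff.2 fun _ hc _ hx => mul_mem_m (O_le_O h hc) hx

theorem m_lt_O : m K P < O K P :=
  lt_of_le_of_ne m_le_O fun h => one_notMem_m (h ▸ one_mem_O)

section

variable (hp : IsPrufer D K)
include hp

theorem inv_mem_m {x : K} (hx : x ∉ O K P) : x⁻¹ ∈ m K P := by
  have h0 := ne_zero_of_notMem hx
  suffices x⁻¹ ∈ O K P by
    by_contra h
    have := inv_mem_O_of_mem this h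
    rw [inv_inv] at this
    exact hx this
  obtain ⟨a, b, hb, rfl⟩ := IsFractionRing.div_surjective (A := D) x
  have hb0 : algebraMap D K b ≠ 0 := by
    rw [Ne, map_eq_zero_iff _ (IsFractionRing.injective D K)]
    exact nonZeroDivisors.ne_zero hb
  obtain ⟨⟨z, hz⟩, h | h⟩ := hp P hP ⟨algebraMap D K a, mem_locAt.2 (algebraMap_mem_O a)⟩
    ⟨algebraMap D K b, mem_locAt.2 (algebraMap_mem_O b)⟩
  · have h' : algebraMap D K a * z = algebraMap D K b := congrArg Subtype.val h
    rw [inv_div, ← h', mul_div_cancel_left₀]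
    · exact mem_locAt.1 hz
    · intro h; simp [h] at h0
  · have h' : algebraMap D K b * z = algebraMap D K a := congrArg Subtype.val h
    rw [← h', mul_div_cancel_left₀ _ hb0] at hx
    exact absurd (mem_locAt.1 hz) hx

theorem inv_mem_O {x : K} (hx : x ∉ m K P) : x⁻¹ ∈ O K P := by
  by_cases h : x ∈ O K P
  · exact inv_mem_O_of_mem h hx
  · exact m_le_O (inv_mem_m hp h)

theorem m_le_m (h : Q ≤ P) : m K Q ≤ m K P := by
  intro x hx
  by_contra h'
  have := mul_mem_m (O_le_O h (inv_mem_O hp h')) hx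
  rw [inv_mul_cancel₀ (ne_zero_of_notMem h')] at this
  exact one_notMem_m this

theorem m_lt_m (h : Q < P) : m K Q < m K P := by
  refine lt_of_le_of_ne (m_le_m hp h.le) fun h' => ?_
  obtain ⟨a, ha, ha'⟩ := Set.not_subset.1 (not_le_of_gt h)
  exact ha' (algebraMap_mem_m_iff.1 (h'.symm ▸ algebraMap_mem_m_iff.2 ha))

theorem m_le_O_of_le (h : Q ≤ P) : m K Q ≤ O K P := (m_le_m hp h).trans m_le_O

/-- If `I` is a module over the localization at `P` and `x ∉ I`, then `I` is contained
in `x` times the maximal ideal. -/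
theorem le_smul_m (hI : loc P I ≤ I) {g : Kˣ} (hx : (g : K) ∉ I) : I ≤ g • m K P := by
  intro y hy
  rw [Submodule.mem_units_smul_iff]
  by_cases hy0 : y = 0
  · simp [hy0]
  by_contra h
  have h1 := inv_mem_O hp h
  have := loc_le_iff.1 hI _ h1 _ hy
  rw [mul_inv, inv_inv, mul_assoc, inv_mul_cancel₀ hy0, mul_one] at this
  exact hx this

omit hp in
theorem smul_O_le (hI : loc P I ≤ I) {g : Kˣ} (hx : (g : K) ∈ I) : g • O K P ≤ I := by
  intro y hy
  rw [Submodule.mem_units_smul_iff] at hy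
  simpa [mul_comm, mul_left_comm] using loc_le_iff.1 hI _ hy _ hx

theorem exists_of_not_le (h : ¬I ≤ J) : ∃ g : Kˣ, (g : K) ∈ I ∧ (g : K) ∉ J := by
  obtain ⟨x, hx, hx'⟩ := Set.not_subset.1 h
  exact ⟨Units.mk0 x (ne_zero_of_notMem hx'), hx, hx'⟩

theorem loc_total (hI : loc P I ≤ I) (hJ : loc P J ≤ J) : I ≤ J ∨ J ≤ I := by
  by_cases h : I ≤ J
  · exact Or.inl h
  · obtain ⟨g, hg, hg'⟩ := exists_of_not_le hp h
    exact Or.inr ((le_smul_m hp hJ hg').trans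
      ((Submodule.units_smul_mono _ _ _ m_le_O).trans (smul_O_le hI hg)))

end

theorem mem_stabilizer_O {g : Kˣ} :
    g ∈ MulAction.stabilizer Kˣ (O K P) ↔ (g : K) ∈ O K P ∧ (g : K)⁻¹ ∈ O K P := by
  rw [MulAction.mem_stabilizer_iff]
  constructor
  · intro h
    constructor
    · rw [← h]; simpa using Submodule.mul_mem_units_smul (g := g) (one_mem_O (K := K) (P := P))
    · have := one_mem_O (K := K) (P := P)
      rw [← h, Submodule.mem_units_smul_iff, mul_one] at this
      exact this
  · rintro ⟨h1, h2⟩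
    ext x
    rw [Submodule.mem_units_smul_iff]
    refine ⟨fun h => ?_, fun h => mul_mem_O h2 h⟩
    simpa using mul_mem_O h1 h

theorem smul_m_of_stabilizer {g : Kˣ} (hg : g ∈ MulAction.stabilizer Kˣ (O K P)) :
    g • m K P = m K P := by
  obtain ⟨h1, h2⟩ := mem_stabilizer_O.1 hg
  ext x
  rw [Submodule.mem_units_smul_iff]
  refine ⟨fun h => ?_, fun h => mul_mem_m h2 h⟩
  simpa using mul_mem_m h1 h

theorem smul_mem_Ioc {g : Kˣ} (hg : g ∈ MulAction.stabilizer Kˣ (O K P))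
    (h : I ∈ Set.Ioc (m K P) (O K P)) : g • I ∈ Set.Ioc (m K P) (O K P) := by
  have h2 := (MulAction.mem_stabilizer_iff.1 hg)
  have h3 := smul_m_of_stabilizer hg
  refine ⟨lt_of_le_of_ne ?_ fun h' => h.1.ne ?_, ?_⟩
  · rw [← h3]; exact Submodule.units_smul_mono _ _ _ h.1.le
  · rw [← h3] at h'; exact MulAction.injective g h'
  · rw [← h2]; exact Submodule.units_smul_mono _ _ _ h.2

theorem exists_unit_mem (h : I ∈ Set.Ioc (m K P) (O K P)) :
    ∃ u ∈ MulAction.stabilizer Kˣ (O K P), (u : K) ∈ I := by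
  obtain ⟨x, hx, hx'⟩ := Set.not_subset.1 (not_le_of_gt h.1)
  exact ⟨Units.mk0 x (ne_zero_of_notMem hx'),
    mem_stabilizer_O.2 ⟨h.2 hx, inv_mem_O_of_mem (h.2 hx) hx'⟩, hx⟩

theorem mem_stabilizer_of_Ioc {g : Kˣ} (h : I ∈ Set.Ioc (m K P) (O K P))
    (h' : g • I ∈ Set.Ioc (m K P) (O K P)) : g ∈ MulAction.stabilizer Kˣ (O K P) := by
  have key : ∀ (g : Kˣ) (I : Submodule D K), I ∈ Set.Ioc (m K P) (O K P) →
      g • I ∈ Set.Ioc (m K P) (O K P) → (g : K) ∈ O K P := by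
    intro g I h h'
    obtain ⟨u, hu, huI⟩ := exists_unit_mem h
    have := mul_mem_O (mem_stabilizer_O.1 hu).2 (h'.2 (Submodule.mul_mem_units_smul (g := g) huI))
    simpa [mul_comm, mul_left_comm] using this
  rw [mem_stabilizer_O]
  refine ⟨key g I h h', ?_⟩
  have := key g⁻¹ (g • I) h' (by rwa [inv_smul_smul])
  simpa using this

end

end Paper

namespace Paper

section

variable {D : Type*} [CommRing D] [IsDomain D]
variable {K : Type*} [Field K] [Algebra D K] [IsFractionRing D K]
variable {P Q M : Ideal D} [hP : P.IsPrime] [hQ : Q.IsPrime] [hM : M.IsPrime]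
variable {I J : Submodule D K}

instance (P : ↥(hiSpec D)) : P.1.IsPrime := P.2.1

theorem bot_mem_hiSpec : (⊥ : Ideal D) ∈ hiSpec D := ⟨Ideal.isPrime_bot, Or.inl rfl⟩

omit hP hQ in
theorem DirectlyBelow.isPrime_left (h : DirectlyBelow D Q P) : Q.IsPrime := h.1.1

omit hP hQ in
theorem DirectlyBelow.isPrime_right (h : DirectlyBelow D Q P) : P.IsPrime := h.2.1.1

omit hP hQ hM in
theorem DirectlyBelow.eq_of_le (h : DirectlyBelow D Q P) (h' : DirectlyBelow D Q M)
    (hle : P ≤ M) : P = M :=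
  by_contra fun hne => h'.2.2.2 P h.2.1 h.2.2.1 (lt_of_le_of_ne hle hne)

theorem ne_zero_of_notMem_prime {s : D} (hs : s ∉ P) : algebraMap D K s ≠ 0 := fun h => hs (by
  rw [(map_eq_zero_iff _ (IsFractionRing.injective D K)).1 h]; exact P.zero_mem)

variable (hp : IsPrufer D K)

include hp in
/-- The primes of a Prüfer domain contained in a given prime form a chain. -/
theorem prime_total (h : P ≤ M) (h' : Q ≤ M) : P ≤ Q ∨ Q ≤ P := by
  refine (loc_total hp (loc_m_le (K := K) h) (loc_m_le h')).imp ?_ ?_ <;>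
  · intro hle a ha
    exact algebraMap_mem_m_iff.1 (hle (algebraMap_mem_m_iff.2 ha))

include hp in
theorem eq_of_maximals_eq (hPh : P ∈ hiSpec D) (hP0 : P ≠ ⊥) (hle : P ≤ Q)
    (h : ∀ M : Ideal D, M.IsMaximal → (P ≤ M ↔ Q ≤ M)) : P = Q := by
  by_contra hne
  have hlt := lt_of_le_of_ne hle hne
  rcases hPh.2 with h0 | hmax | ⟨S, hS, hinc, hPS, hPle, hinf⟩
  · exact hP0 h0
  · exact hne (hmax.eq_of_le hQ.ne_top hle)
  have hcomp : ∀ R ∈ S, R ≤ Q ∨ Q ≤ R := fun R hR => by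
    have := hS R hR
    obtain ⟨M, hM, hRM⟩ := Ideal.exists_le_maximal R this.ne_top
    have := hM.isPrime
    exact prime_total hp hRM ((h M hM).1 ((hPle R hR).trans hRM))
  have : ∃ R ∈ S, ¬Q ≤ R := by
    by_contra! hall
    exact not_le_of_gt hlt (hinf Q hQ hall)
  obtain ⟨R, hR, hQR⟩ := this
  have hRQ := (hcomp R hR).resolve_right hQR
  have hRprime := hS R hR
  have hRP : R ≤ P := hinf R hRprime fun R' hR' => by
    by_cases heq : R = R'
    · exact heq.le
    exfalso
    have hRprime' := hS R' hR'
    have hn := hinc hR hR' heq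
    rcases hcomp R' hR' with h1 | h1
    · rcases prime_total hp hRQ h1 with h2 | h2
      · exact hn.1 h2
      · exact hn.2 h2
    · exact hn.1 (hRQ.trans h1)
  exact hPS ((le_antisymm hRP (hPle R hR)) ▸ hR)

include hp in
theorem hiSpec_finite (hsl : IsSemilocal D) : (hiSpec D).Finite := by
  have hfin : (𝒫 {I : Ideal D | I.IsMaximal}).Finite := Set.Finite.powerset hsl
  have h1 : (hiSpec D \ {⊥}).Finite := by
    refine Set.Finite.of_injOn (f := fun P => {M : Ideal D | M.IsMaximal ∧ P ≤ M}) (t := 𝒫 _)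
      (fun P _ M hM => hM.1) ?_ hfin
    intro P hPh Q hQh heq
    have hP := hPh.1.1
    have hQ := hQh.1.1
    have h : ∀ M : Ideal D, M.IsMaximal → (P ≤ M ↔ Q ≤ M) := fun M hM => by
      have := Set.ext_iff.1 heq M
      simpa [hM] using this
    obtain ⟨M, hM, hPM⟩ := Ideal.exists_le_maximal P hP.ne_top
    have := hM.isPrime
    rcases prime_total hp hPM ((h M hM).1 hPM) with hle | hle
    · exact eq_of_maximals_eq hp hPh.1 hPh.2 hle h
    · exact (eq_of_maximals_eq hp hQh.1 hQh.2 hle fun M hM => (h M hM).symm).symm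
  exact (h1.union (Set.finite_singleton ⊥)).subset fun P hP => by
    by_cases h : P = ⊥ <;> simp [h, hP]

omit hM in
include hp in
theorem exists_directlyBelow (hsl : IsSemilocal D) (hQ : Q ∈ hiSpec D) (hM : M ∈ hiSpec D)
    (h : Q < M) : ∃ P, DirectlyBelow D Q P ∧ P ≤ M := by
  have hfin : {P | P ∈ hiSpec D ∧ Q < P ∧ P ≤ M}.Finite :=
    (hiSpec_finite hp hsl).subset fun P hP => hP.1
  obtain ⟨P, hPm⟩ := hfin.exists_minimal ⟨M, hM, h, le_rfl⟩
  refine ⟨P, ⟨hQ, hPm.1.1, hPm.1.2.1, fun R hR hQR hRP => ?_⟩, hPm.1.2.2⟩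
  exact not_le_of_gt hRP (hPm.2 ⟨hR, hQR, hRP.le.trans hPm.1.2.2⟩ hRP.le)

include hp in
/-- A prime contained in two different covers of `Q` is contained in `Q`. -/
theorem le_of_le_of_le {P₁ P₂ P' : Ideal D} (h₁ : DirectlyBelow D Q P₁)
    (h₂ : DirectlyBelow D Q P₂) (hne : P₁ ≠ P₂) (hP' : P'.IsPrime) (h1 : P' ≤ P₁)
    (h2 : P' ≤ P₂) : P' ≤ Q := by
  have i₁ := h₁.isPrime_right
  have i₂ := h₂.isPrime_right
  let C : Set (Ideal D) := {R | R.IsPrime ∧ R ≤ P₁ ∧ R ≤ P₂}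
  have hchain : IsChain (· ≤ ·) C := fun R hR R' hR' _ => by
    have := hR.1
    have := hR'.1
    exact prime_total hp hR.2.1 hR'.2.1
  have hne' : C.Nonempty := ⟨P', hP', h1, h2⟩
  have hmem : ∀ a, a ∈ sSup C ↔ ∃ R ∈ C, a ∈ R := fun a =>
    Submodule.mem_sSup_of_directed hne' hchain.directedOn
  have hW1 : sSup C ≤ P₁ := sSup_le fun R hR => hR.2.1
  have hW2 : sSup C ≤ P₂ := sSup_le fun R hR => hR.2.2
  have hW : (sSup C).IsPrime := by
    refine ⟨fun h => i₁.ne_top (top_le_iff.1 (h ▸ hW1)), fun {a b} hab => ?_⟩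
    obtain ⟨R, hR, hab⟩ := (hmem _).1 hab
    exact (hR.1.mem_or_mem hab).imp (fun h => (hmem _).2 ⟨R, hR, h⟩)
      fun h => (hmem _).2 ⟨R, hR, h⟩
  have hn12 : ¬P₁ ≤ P₂ := fun h => hne (h₁.eq_of_le h₂ h)
  have hn21 : ¬P₂ ≤ P₁ := fun h => hne (h₂.eq_of_le h₁ h).symm
  have hWh : sSup C ∈ hiSpec D := by
    refine ⟨hW, Or.inr (Or.inr ⟨{P₁, P₂}, ?_, ?_, ?_, ?_, ?_⟩)⟩
    · rintro R (rfl | rfl) <;> assumption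
    · rintro R (rfl | rfl) R' (rfl | rfl) h
      · exact absurd rfl h
      · exact ⟨hn12, hn21⟩
      · exact ⟨hn21, hn12⟩
      · exact absurd rfl h
    · rintro (h | h)
      · exact hn12 (h ▸ hW2)
      · exact hn21 ((Set.mem_singleton_iff.1 h) ▸ hW1)
    · rintro R (rfl | rfl) <;> assumption
    · intro R hR hle
      exact le_sSup ⟨hR, hle _ (Or.inl rfl), hle _ (Or.inr rfl)⟩
  have hQW : Q ≤ sSup C := le_sSup ⟨h₁.isPrime_left, h₁.2.2.1.le, h₂.2.2.1.le⟩
  rcases eq_or_lt_of_le hQW with h | h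
  · rw [h]; exact le_sSup ⟨hP', h1, h2⟩
  · exact absurd (lt_of_le_of_ne hW1 fun h' => hn12 (h' ▸ hW2)) (h₁.2.2.2 _ hWh h)

/-- The conductor of an element into the maximal ideal of the localization. -/
def condIdeal (P : Ideal D) (c : K) : Ideal D :=
  (m K P).comap (LinearMap.toSpanSingleton D K c)

theorem mem_condIdeal {c : K} {d : D} : d ∈ condIdeal P c ↔ d • c ∈ m K P := Iff.rfl

theorem smul_mem_O (d : D) {c : K} (hc : c ∈ O K P) : d • c ∈ O K P :=
  (O K P).smul_mem _ hc

theorem exists_smul_mem_m (h : Q < P) {c : K} (hc : c ∈ O K Q) :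
    ∃ s : D, s ∉ Q ∧ s • c ∈ m K P := by
  obtain ⟨s, hs, a, hsa⟩ := mem_O.1 hc
  obtain ⟨t, ht, ht'⟩ := Set.not_subset.1 (not_le_of_gt h)
  refine ⟨t * s, hQ.mul_notMem ht' hs, ?_⟩
  rw [mul_smul, hsa, Algebra.smul_def, ← map_mul, algebraMap_mem_m_iff]
  exact P.mul_mem_right _ ht

include hp in
theorem radical_condIdeal_isPrime {c : K} (hc : c ∉ m K P) : (condIdeal P c).radical.IsPrime := by
  refine ⟨fun h => hc ?_, fun {a b} hab => ?_⟩
  · rw [Ideal.radical_eq_top, Ideal.eq_top_iff_one, mem_condIdeal, one_smul] at h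
    exact h
  · have key : ∀ a b : D, ∀ z ∈ O K P, algebraMap D K a = z * algebraMap D K b →
        a * b ∈ (condIdeal P c).radical → a ∈ (condIdeal P c).radical := by
      rintro a b z hz hab ⟨n, hn⟩
      refine ⟨2 * n, ?_⟩
      rw [mem_condIdeal] at hn ⊢
      have hzn : z ^ n ∈ O K P := by
        clear hn
        induction n with
        | zero => simpa using one_mem_O
        | succ n ih => rw [pow_succ]; exact mul_mem_O ih hz
      have := mul_mem_m hzn hn
      convert this using 1
      rw [Algebra.smul_def, Algebra.smul_def]
      simp only [map_pow, map_mul, hab]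
      ring
    by_cases hb : b = 0
    · right; simp [hb]
    by_cases ha : a = 0
    · left; simp [ha]
    have hb' : algebraMap D K b ≠ 0 := by
      rwa [Ne, map_eq_zero_iff _ (IsFractionRing.injective D K)]
    have ha' : algebraMap D K a ≠ 0 := by
      rwa [Ne, map_eq_zero_iff _ (IsFractionRing.injective D K)]
    by_cases hz : algebraMap D K a / algebraMap D K b ∈ O K P
    · exact Or.inl (key a b _ hz (by field_simp) hab)
    · have hz' := m_le_O (inv_mem_m hp hz)
      rw [inv_div] at hz'
      exact Or.inr (key b a _ hz' (by field_simp) (by rwa [mul_comm]))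

include hp in
theorem exists_notMem_smul_mem_m {P₀ : Ideal D} (h : DirectlyBelow D Q P)
    (h₀ : DirectlyBelow D Q P₀) (hne : P ≠ P₀) (hM : P₀ ≤ M) {c : K} (hc : c ∈ O K Q) :
    ∃ d : D, d ∉ M ∧ d • c ∈ m K P := by
  have i₀ := h₀.isPrime_right
  by_contra! hall
  have hle : condIdeal P c ≤ M := fun d hd => by_contra fun hdM => hall d hdM hd
  have hcm : c ∉ m K P := by simpa using hall 1 (one_notMem_prime inferInstance)
  have hrad := radical_condIdeal_isPrime hp hcm
  have hradM : (condIdeal P c).radical ≤ M := (Ideal.IsPrime.radical_le_iff inferInstance).2 hle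
  have hradP : (condIdeal P c).radical ≤ P := by
    rw [Ideal.IsPrime.radical_le_iff hP]
    intro d hd
    rw [← algebraMap_mem_m_iff (K := K)]
    rw [mem_condIdeal, Algebra.smul_def] at hd
    have := mul_mem_m (inv_mem_O hp hcm) hd
    rwa [mul_comm, mul_assoc, mul_inv_cancel₀ (ne_zero_of_notMem hcm), mul_one] at this
  obtain ⟨s, hs, hsc⟩ := exists_smul_mem_m h.2.2.1 hc
  have hnot : ¬(condIdeal P c).radical ≤ Q := fun hle => hs (hle (Ideal.le_radical hsc))
  rcases prime_total hp hradM hM with h1 | h1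
  · exact hnot (le_of_le_of_le hp h h₀ hne hrad hradP h1)
  · exact hne (h₀.eq_of_le h (h1.trans hradP)).symm

include hp in
theorem m_mul_mem_of_sat (hI : sat P I ≤ I) {z x : K} (hz : z ∈ m K P) (hx : x ∈ I) :
    z * x ∈ I := by
  refine hI (mem_sat.2 fun M hM hPM => ?_)
  have := hM.isPrime
  obtain ⟨d, hd, a, h⟩ := mem_O.1 (m_le_O_of_le hp hPM hz)
  refine ⟨d, hd, ?_⟩
  rw [← smul_mul_assoc, h, ← Algebra.smul_def]
  exact I.smul_mem _ hx

include hp in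
theorem le_smul_O_of_sat (hI : sat P I ≤ I) {g : Kˣ} (hg : (g : K) ∉ I) : I ≤ g • O K P := by
  intro z hz
  rw [Submodule.mem_units_smul_iff]
  by_contra h
  have h0 := ne_zero_of_notMem (I := (⊥ : Submodule D K)) (x := z) fun h0 => h (by
    rw [(Submodule.mem_bot D).1 h0, mul_zero]; exact zero_mem _)
  have := m_mul_mem_of_sat hp hI (inv_mem_m hp h) hz
  rw [mul_inv, inv_inv, mul_assoc, inv_mul_cancel₀ h0, mul_one] at this
  exact hg this

theorem O_lt_O (h : Q < P) : O K P < O K Q := by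
  refine lt_of_le_of_ne (O_le_O h.le) fun h' => ?_
  obtain ⟨t, ht, ht'⟩ := Set.not_subset.1 (not_le_of_gt h)
  have h1 : (algebraMap D K t)⁻¹ ∈ O K P := h' ▸ inv_algebraMap_mem_O ht'
  have := mul_mem_m h1 (algebraMap_mem_m_iff.2 ht)
  rw [inv_mul_cancel₀ (ne_zero_of_notMem_prime ht')] at this
  exact one_notMem_m this

end

end Paper

namespace Paper

section

variable {D : Type*} [CommRing D] [IsDomain D]
variable {K : Type*} [Field K] [Algebra D K] [IsFractionRing D K]

variable (K) in
/-- The submodules strictly between the maximal ideal and the localization at `Q`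
(the latter included). -/
abbrev Xset (Q : Ideal D) : Set (Submodule D K) := Set.Ioc (m K Q) (O K Q)

variable (K) in
/-- The members of `Xset K Q` that are determined by the maximal ideals containing `P`. -/
def Yset (Q P : Ideal D) : Set (Submodule D K) := {I | I ∈ Xset K Q ∧ sat P I ≤ I}

variable (K) in
/-- The members of `Xset K Q` that are modules over the localization at `P`. -/
def Vset (Q P : Ideal D) : Set (Submodule D K) := {I | I ∈ Xset K Q ∧ loc P I ≤ I}

/-- The points of `hiSpec D` directly above `Q`. -/
abbrev Cov (Q : Ideal D) : Type _ := {P : Ideal D // DirectlyBelow D Q P}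

variable {Q : Ideal D}

instance (P : Cov Q) : P.1.IsPrime := P.2.isPrime_right

theorem Cov.lt (P : Cov Q) : Q < P.1 := P.2.2.2.1

theorem top_mem_Xset [Q.IsPrime] : O K Q ∈ Xset K Q := ⟨m_lt_O, le_rfl⟩

theorem top_mem_Vset {P : Ideal D} [Q.IsPrime] [P.IsPrime] (h : Q ≤ P) : O K Q ∈ Vset K Q P :=
  ⟨top_mem_Xset, loc_O_le h⟩

theorem Vset_subset_Yset {P : Ideal D} [P.IsPrime] : Vset K Q P ⊆ Yset K Q P :=
  fun _ h => ⟨h.1, sat_le_loc.trans h.2⟩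

theorem smul_mem_Yset {P : Ideal D} [Q.IsPrime] {g : Kˣ} {I : Submodule D K}
    (hg : g ∈ MulAction.stabilizer Kˣ (O K Q)) (h : I ∈ Yset K Q P) : g • I ∈ Yset K Q P :=
  ⟨smul_mem_Ioc hg h.1, by
    rw [sat, hull_smul]; exact Submodule.units_smul_mono _ _ _ h.2⟩

theorem smul_mem_Vset {P : Ideal D} [Q.IsPrime] {g : Kˣ} {I : Submodule D K}
    (hg : g ∈ MulAction.stabilizer Kˣ (O K Q)) (h : I ∈ Vset K Q P) : g • I ∈ Vset K Q P :=
  ⟨smul_mem_Ioc hg h.1, by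
    rw [loc, hull_smul]; exact Submodule.units_smul_mono _ _ _ h.2⟩

theorem sat_mem_Yset {P : Ideal D} [Q.IsPrime] [P.IsPrime] (h : Q ≤ P) {I : Submodule D K}
    (hI : I ∈ Xset K Q) : sat P I ∈ Yset K Q P :=
  ⟨⟨hI.1.trans_le le_sat, (hull_mono hI.2).trans (sat_le_loc.trans (loc_O_le h))⟩,
    hull_hull.le⟩

variable [hQ : Q.IsPrime] (hp : IsPrufer D K) (hsl : IsSemilocal D)

theorem mem_of_smul_notMem {s : D} {P : Ideal D} [P.IsPrime] {I : Submodule D K}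
    (hI : sat P I ≤ I) (hs : ∀ M : Ideal D, M.IsMaximal → P ≤ M → s ∉ M) {x : K}
    (h : s • x ∈ I) : x ∈ I :=
  hI (mem_sat.2 fun M hM hPM => ⟨s, hs M hM hPM, h⟩)

theorem exists_finset_prod {ι : Type*} [Finite ι] {Q : Ideal D} [hQ : Q.IsPrime]
    (I : ι → Submodule D K) (x : ι → K) (h : ∀ i, ∃ d : D, d ∉ Q ∧ d • x i ∈ I i) :
    ∃ d : D, d ∉ Q ∧ ∀ i, d • x i ∈ I i := by
  classical
  have := Fintype.ofFinite ι
  choose d hd hdx using h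
  refine ⟨∏ i, d i, fun h => ?_, fun i => ?_⟩
  · obtain ⟨i, _, hi⟩ := (hQ.prod_mem_iff).1 h
    exact hd i hi
  · rw [← Finset.prod_erase_mul _ _ (Finset.mem_univ i), mul_smul]
    exact (I i).smul_mem _ (hdx i)

include hp hsl

theorem Cov.finite : Finite (Cov Q) :=
  Set.Finite.to_subtype ((hiSpec_finite hp hsl).subset fun _ hP => hP.2.1)

omit hsl in
theorem exists_notMem_smul_mem_Yset {P : Ideal D} [P.IsPrime] (h : Q < P) {I : Submodule D K}
    (hI : I ∈ Yset K Q P) : ∃ s : D, s ∉ Q ∧ s • (1 : K) ∈ I := by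
  obtain ⟨u, hu, huI⟩ := exists_unit_mem hI.1
  obtain ⟨s, hs, hsu⟩ := exists_smul_mem_m h (mem_stabilizer_O.1 hu).2
  refine ⟨s, hs, ?_⟩
  have := m_mul_mem_of_sat hp hI.2 hsu huI
  rwa [smul_mul_assoc, inv_mul_cancel₀ u.ne_zero] at this

omit hsl in
theorem exists_notMem_smul_mem_Yset_of_ne {P P₀ : Cov Q} (hne : P ≠ P₀) {M : Ideal D}
    [M.IsPrime] (hM : P₀.1 ≤ M) {I : Submodule D K} (hI : I ∈ Yset K Q P.1) {x : K}
    (hx : x ∈ O K Q) : ∃ d : D, d ∉ M ∧ d • x ∈ I := by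
  obtain ⟨u, hu, huI⟩ := exists_unit_mem hI.1
  obtain ⟨s, hs, hsu⟩ := exists_notMem_smul_mem_m hp P.2 P₀.2 (fun h => hne (Subtype.ext h)) hM
    (mul_mem_O hx (mem_stabilizer_O.1 hu).2)
  refine ⟨s, hs, ?_⟩
  have := m_mul_mem_of_sat hp hI.2 hsu huI
  rwa [smul_mul_assoc, inv_mul_cancel_right₀ u.ne_zero] at this

theorem inf_mem_Xset (y : ∀ P : Cov Q, Yset K Q P.1) : O K Q ⊓ ⨅ P, (y P).1 ∈ Xset K Q := by
  have := Cov.finite (Q := Q) hp hsl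
  refine ⟨lt_of_le_not_ge (le_inf m_le_O (le_iInf fun P => (y P).2.1.1.le)) fun hle => ?_,
    inf_le_left⟩
  obtain ⟨d, hd, hdy⟩ := exists_finset_prod (fun P => (y P).1) (fun _ => (1 : K))
    fun P => exists_notMem_smul_mem_Yset hp P.lt (y P).2
  have h1 : d • (1 : K) ∈ O K Q ⊓ ⨅ P, (y P).1 :=
    ⟨smul_mem_O d one_mem_O, (Submodule.mem_iInf _).2 hdy⟩
  have h2 := hle h1
  rw [Algebra.smul_def, mul_one, algebraMap_mem_m_iff] at h2
  exact hd h2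

theorem eq_inf_sat (hQh : Q ∈ hiSpec D) {I : Submodule D K} (hI : I ∈ Xset K Q) :
    O K Q ⊓ ⨅ P : Cov Q, sat P.1 I = I := by
  refine le_antisymm ?_ (le_inf hI.2 (le_iInf fun P => le_sat))
  rintro x ⟨hx, hxs⟩
  rw [SetLike.mem_coe, Submodule.mem_iInf] at hxs
  let 𝔞 : Ideal D := I.comap (LinearMap.toSpanSingleton D K x)
  have h𝔞 : ∀ d, d ∈ 𝔞 ↔ d • x ∈ I := fun d => Iff.rfl
  suffices 𝔞 = ⊤ by
    have := (h𝔞 1).1 ((Ideal.eq_top_iff_one _).1 this)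
    rwa [one_smul] at this
  by_contra hne
  obtain ⟨M, hM, hle⟩ := Ideal.exists_le_maximal _ hne
  have := hM.isPrime
  have hQ𝔞 : Q ≤ 𝔞 := fun q hq => (h𝔞 q).2 (hI.1.le (by
    rw [Algebra.smul_def, mul_comm]
    exact mul_mem_m hx (algebraMap_mem_m_iff.2 hq)))
  rcases eq_or_lt_of_le (hQ𝔞.trans hle) with rfl | hlt
  · obtain ⟨u, hu, huI⟩ := exists_unit_mem hI
    obtain ⟨d, hd, a, hda⟩ := mem_O.1 (mul_mem_O hx (mem_stabilizer_O.1 hu).2)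
    refine hd (hle ((h𝔞 d).2 ?_))
    have h1 := I.smul_mem a huI
    rwa [Algebra.smul_def, ← hda, smul_mul_assoc, inv_mul_cancel_right₀ u.ne_zero] at h1
  · obtain ⟨P, hP, hPM⟩ := exists_directlyBelow hp hsl hQh (maximal_mem_hiSpec hM) hlt
    obtain ⟨d, hd, hdx⟩ := mem_sat.1 (hxs ⟨P, hP⟩) M hM hPM
    exact hd (hle hdx)

theorem sat_inf (y : ∀ P : Cov Q, Yset K Q P.1) (P : Cov Q) :
    sat P.1 (O K Q ⊓ ⨅ P, (y P).1) = (y P).1 := by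
  have := Cov.finite (Q := Q) hp hsl
  apply le_antisymm
  · exact (hull_mono (inf_le_right.trans (iInf_le _ P))).trans (y P).2.2
  · intro x hx
    rw [mem_sat]
    intro M hM hPM
    have := hM.isPrime
    have hxO := (y P).2.1.2 hx
    obtain ⟨d, hd, hdx⟩ := exists_finset_prod (Q := M) (fun P => (y P).1) (fun _ => x)
      fun P' => by
        by_cases h : P' = P
        · subst h
          exact ⟨1, one_notMem_prime hM.isPrime, by rwa [one_smul]⟩
        · exact exists_notMem_smul_mem_Yset_of_ne hp h hPM (y P').2 hxO
    exact ⟨d, hd, smul_mem_O d hxO, (Submodule.mem_iInf _).2 hdx⟩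

/-- The components of a submodule at the covers of `Q`. -/
def satEquiv (hQh : Q ∈ hiSpec D) : Xset K Q ≃o ∀ P : Cov Q, Yset K Q P.1 where
  toFun I P := ⟨sat P.1 I.1, sat_mem_Yset P.lt.le I.2⟩
  invFun y := ⟨O K Q ⊓ ⨅ P, (y P).1, inf_mem_Xset hp hsl y⟩
  left_inv I := Subtype.ext (eq_inf_sat hp hsl hQh I.2)
  right_inv y := funext fun P => Subtype.ext (sat_inf hp hsl y P)
  map_rel_iff' {I J} := by
    constructor
    · intro h
      change I.1 ≤ J.1
      rw [← eq_inf_sat hp hsl hQh I.2, ← eq_inf_sat hp hsl hQh J.2]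
      exact inf_le_inf le_rfl (iInf_mono fun P => h P)
    · exact fun h P => hull_mono h

theorem exists_indep (P₀ : Cov Q) (c : Cov Q → K) (hc : ∀ P, c P ∈ O K Q) :
    ∃ s : D, (∀ M : Ideal D, M.IsMaximal → P₀.1 ≤ M → s ∉ M) ∧
      ∀ P, P ≠ P₀ → s • c P ∈ m K P.1 := by
  classical
  have := Cov.finite (Q := Q) hp hsl
  let 𝔞 : Ideal D := ⨅ P : {P : Cov Q // P ≠ P₀}, condIdeal P.1.1 (c P.1)
  have h𝔞 : ∀ M : Ideal D, M.IsMaximal → P₀.1 ≤ M → ¬𝔞 ≤ M := by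
    intro M hM hPM hle
    have := hM.isPrime
    obtain ⟨d, hd, hdx⟩ := exists_finset_prod (Q := M) (ι := {P : Cov Q // P ≠ P₀})
      (fun P => m K P.1.1) (fun P => c P.1) fun P =>
        exists_notMem_smul_mem_m hp P.1.2 P₀.2 (fun h => P.2 (Subtype.ext h)) hPM (hc P.1)
    exact hd (hle ((Submodule.mem_iInf _).2 hdx))
  have hfin : {M : Ideal D | M.IsMaximal ∧ P₀.1 ≤ M}.Finite := hsl.subset fun M hM => hM.1
  have hnot : ¬((𝔞 : Set D) ⊆ ⋃ M ∈ (hfin.toFinset : Set (Ideal D)), ((M : Ideal D) : Set D)) := by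
    intro h
    rw [Ideal.subset_union_prime (f := fun M : Ideal D => M) ⊤ ⊤] at h
    · obtain ⟨M, hM, hle⟩ := h
      have hM := hfin.mem_toFinset.1 hM
      exact h𝔞 M hM.1 hM.2 hle
    · exact fun M hM _ _ => (hfin.mem_toFinset.1 hM).1.isPrime
  obtain ⟨s, hs, hs'⟩ := Set.not_subset.1 hnot
  refine ⟨s, fun M hM hPM hsM => hs' ?_, fun P hP => (Submodule.mem_iInf _).1 hs ⟨P, hP⟩⟩
  exact Set.mem_biUnion (hfin.mem_toFinset.2 ⟨hM, hPM⟩) hsM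

omit hsl in
theorem exists_le_smul_O {P : Ideal D} [P.IsPrime] {I : Submodule D K}
    (hI : I ∈ Yset K Q P) (hne : I ≠ O K Q) : ∃ c : Kˣ, (c : K) ∈ O K Q ∧ I ≤ c • O K P := by
  obtain ⟨c, hc, hc'⟩ := exists_of_not_le hp fun h => hne (le_antisymm hI.1.2 h)
  exact ⟨c, hc, le_smul_O_of_sat hp hI.2 hc'⟩

omit hsl in
theorem smul_O_le_smul {P : Ideal D} [P.IsPrime] {I : Submodule D K} (hI : sat P I ≤ I)
    {u c : Kˣ} (hu : (u : K) ∈ I) {s : Kˣ} (h : (s : K) * (c * (u : K)⁻¹) ∈ m K P) :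
    c • O K P ≤ s⁻¹ • I := by
  intro x hx
  rw [Submodule.mem_units_smul_iff] at hx ⊢
  have := m_mul_mem_of_sat hp hI (mul_mem_m hx h) hu
  have h0 := u.ne_zero
  have h1 := c.ne_zero
  convert this using 1
  rw [Units.val_inv_eq_inv_val, inv_inv]
  field_simp

omit hp hsl in
theorem mk0_inv_mem_stabilizer {s : D} (hs : s ∉ Q) (h0 : algebraMap D K s ≠ 0) :
    (Units.mk0 _ h0)⁻¹ ∈ MulAction.stabilizer Kˣ (O K Q) := by
  rw [inv_mem_iff, mem_stabilizer_O]
  exact ⟨algebraMap_mem_O s, inv_algebraMap_mem_O hs⟩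

/-- The decomposition of `Xset K Q` along the covers of `Q`. -/
def decomp (hQh : Q ∈ hiSpec D) :
    Decomp Kˣ (O K Q) (Xset K Q) fun P : Cov Q => Yset K Q P.1 where
  e := satEquiv hp hsl hQh
  H := MulAction.stabilizer Kˣ (O K Q)
  mem_Y P := Vset_subset_Yset (top_mem_Vset P.lt.le)
  le_Y P y hy := hy.1.2
  mem_of_X g x hx hx' := mem_stabilizer_of_Ioc hx hx'
  mem_of_Y g P y hy hy' := mem_stabilizer_of_Ioc hy.1 hy'.1
  smul_X g hg x hx := smul_mem_Ioc hg hx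
  smul_T g hg := hg
  e_smul g hg x y h P := by
    change sat P.1 y.1 = g • sat P.1 x.1
    rw [h, sat, hull_smul]; rfl
  mono := Submodule.units_smul_mono
  inj g x y h := MulAction.injective g h
  cof P z z' hz hz' := by
    obtain ⟨c, hc, hzc⟩ := exists_le_smul_O hp z.2 hz
    obtain ⟨u, hu, huI⟩ := exists_unit_mem z'.2.1
    obtain ⟨s, hs, hsc⟩ := exists_smul_mem_m P.lt (mul_mem_O hc (mem_stabilizer_O.1 hu).2)
    have h0 := ne_zero_of_notMem_prime (K := K) hs
    have hg := mk0_inv_mem_stabilizer hs h0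
    refine ⟨_, hg, hzc.trans (smul_O_le_smul hp z'.2.2 huI ?_), smul_mem_Yset hg z'.2⟩
    rwa [Algebra.smul_def] at hsc
  indep P₀ y y' hy hy' := by
    choose c hc hyc using fun P => exists_le_smul_O hp (y P).2 (hy P)
    choose u hu huI using fun P => exists_unit_mem (y' P).2.1
    obtain ⟨s, hs, hsc⟩ := exists_indep hp hsl P₀ (fun P => (c P : K) * (u P : K)⁻¹)
      fun P => mul_mem_O (hc P) (mem_stabilizer_O.1 (hu P)).2
    obtain ⟨M, hM, hPM⟩ := Ideal.exists_le_maximal P₀.1 P₀.2.isPrime_right.ne_top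
    have hsQ : s ∉ Q := fun h => hs M hM hPM (hPM (P₀.lt.le h))
    have h0 := ne_zero_of_notMem_prime (K := K) hsQ
    refine ⟨_, mk0_inv_mem_stabilizer hsQ h0, fun z hz => ?_, fun P hP =>
      (hyc P).trans (smul_O_le_smul hp (y' P).2.2 (huI P) ?_)⟩
    · rw [inv_smul_eq_iff]
      ext x
      rw [Submodule.mem_units_smul_iff, Units.val_mk0]
      refine ⟨fun h => mem_of_smul_notMem hz.2 hs ?_, fun h => ?_⟩
      · rw [Algebra.smul_def, mul_inv_cancel_left₀ h0]; exact h
      · have := z.smul_mem s h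
        rwa [Algebra.smul_def, mul_inv_cancel_left₀ h0] at this
    · have := hsc P hP
      rwa [Algebra.smul_def] at this
  base P := ⟨O K P.1, ⟨(m_lt_m hp P.lt).trans m_lt_O, O_le_O P.lt.le⟩,
    sat_le_loc.trans (loc_O_le le_rfl)⟩
  base_ne P := (O_lt_O P.lt).ne

omit hsl in
theorem mem_stabilizer_of_mem_smul_m {c : Kˣ} {P : Ideal D} [P.IsPrime] (h : Q ≤ P)
    {I : Submodule D K} (hI : I ∈ Xset K Q) (hc : (c : K) ∈ O K Q) (hIc : I ≤ c • O K P) :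
    c ∈ MulAction.stabilizer Kˣ (O K Q) := by
  refine mem_stabilizer_O.2 ⟨hc, ?_⟩
  obtain ⟨u, hu, huI⟩ := exists_unit_mem hI
  have h1 := O_le_O h (Submodule.mem_units_smul_iff.1 (hIc huI))
  simpa using mul_mem_O h1 (mem_stabilizer_O.1 hu).2

/-- `Yset K Q P` is obtained from `Vset K Q P` by inserting translates of `Xset K P`. -/
def glueData {P : Ideal D} [hP : P.IsPrime] (h : Q < P) :
    GlueData Kˣ (Yset K Q P) (Vset K Q P) (m K P) (O K P) where
  H := MulAction.stabilizer Kˣ (O K Q)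
  V_sub := Vset_subset_Yset
  Ioc_sub I hI := by
    refine ⟨⟨(m_lt_m hp h).trans hI.1, hI.2.trans (O_le_O h.le)⟩, fun x hx => ?_⟩
    have hxO : x ∈ O K P := loc_O_le le_rfl (loc_mono hI.2 (sat_le_loc hx))
    let 𝔞 : Ideal D := I.comap (LinearMap.toSpanSingleton D K x)
    have h𝔞 : ∀ d, d ∈ 𝔞 ↔ d • x ∈ I := fun d => Iff.rfl
    have hP𝔞 : P ≤ 𝔞 := fun a ha => (h𝔞 a).2 (hI.1.le (by
      rw [Algebra.smul_def, mul_comm]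
      exact mul_mem_m hxO (algebraMap_mem_m_iff.2 ha)))
    by_contra hxI
    have hne : 𝔞 ≠ ⊤ := fun h => hxI (by
      have := (h𝔞 1).1 ((Ideal.eq_top_iff_one _).1 h)
      rwa [one_smul] at this)
    obtain ⟨M, hM, hle⟩ := Ideal.exists_le_maximal _ hne
    obtain ⟨d, hd, hdx⟩ := mem_sat.1 hx M hM (hP𝔞.trans hle)
    exact hd (hle hdx)
  w_mem := ⟨⟨m_lt_m hp h, m_le_O.trans (O_le_O h.le)⟩, loc_m_le le_rfl⟩
  v_mem := ⟨⟨(m_lt_m hp h).trans m_lt_O, O_le_O h.le⟩, loc_O_le le_rfl⟩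
  lt := m_lt_O
  mono := Submodule.units_smul_mono
  mem_of_Y g y hy hy' := mem_stabilizer_of_Ioc hy.1 hy'.1
  smul_Y g hg y hy := smul_mem_Yset hg hy
  smul_V g hg y hy := smul_mem_Vset hg hy
  cover y hy := by
    refine or_iff_not_imp_left.2 fun hyV => ?_
    obtain ⟨x, hx, hxy⟩ := exists_of_not_le hp fun h => hyV ⟨hy.1, h⟩
    have hle := le_smul_O_of_sat hp hy.2 hxy
    have hxO : (x : K) ∈ O K Q := loc_O_le h.le (loc_mono hy.1.2 hx)
    obtain ⟨d, hd, hdx⟩ := mem_loc.1 hx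
    have hd0 := ne_zero_of_notMem_prime (K := K) hd
    refine ⟨x, mem_stabilizer_of_mem_smul_m hp h.le hy.1 hxO hle, lt_of_le_not_ge ?_ ?_, ?_⟩
    · intro z hz
      rw [Submodule.mem_units_smul_iff, Units.val_inv_eq_inv_val, inv_inv]
      have := m_mul_mem_of_sat hp hy.2 (mul_mem_m (inv_algebraMap_mem_O hd) hz) hdx
      rw [Algebra.smul_def] at this
      convert this using 1
      field_simp
    · intro h
      have h1 : algebraMap D K d ∈ x⁻¹ • y := by
        rw [Submodule.mem_units_smul_iff, Units.val_inv_eq_inv_val, inv_inv, mul_comm,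
          ← Algebra.smul_def]
        exact hdx
      exact hd (algebraMap_mem_m_iff.1 (h h1))
    · have := Submodule.units_smul_mono x⁻¹ _ _ hle
      rwa [inv_smul_smul] at this
  lin u hu := by
    by_cases h1 : (1 : K) ∈ u
    · right
      simpa using smul_O_le (g := 1) hu.2 (by simpa using h1)
    · left
      simpa using le_smul_m (g := 1) hp hu.2 (by simpa using h1)
  sep u hu u' hu' hne := by
    obtain ⟨z, hz, hz'⟩ := exists_of_not_le hp hne
    have hle := le_smul_m hp hu.2 hz'
    exact ⟨z, mem_stabilizer_of_mem_smul_m hp h.le hu.1 (hu'.1.2 hz)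
      (hle.trans (Submodule.units_smul_mono _ _ _ m_le_O)), hle, smul_O_le hu'.2 hz⟩
  fixed I hI hfix := by
    refine le_antisymm hI.2 fun x hx => ?_
    obtain ⟨u, hu, huI⟩ := exists_unit_mem hI
    have h1 : (1 : K) ∈ I := by
      rw [← hfix u⁻¹ (inv_mem hu), Submodule.mem_units_smul_iff]
      simpa using huI
    by_cases hxm : x ∈ m K P
    · exact hI.1.le hxm
    have h0 := ne_zero_of_notMem hxm
    rw [← hfix (Units.mk0 x h0) (mem_stabilizer_O.2 ⟨hx, inv_mem_O_of_mem hx hxm⟩),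
      Submodule.mem_units_smul_iff]
    simpa [h0] using h1
  stab g hg := smul_m_of_stabilizer hg
  stab_of_Ioc g x hx hx' := mem_stabilizer_of_Ioc hx hx'

end

end Paper

namespace Paper

/-- Transport of closure operations along an order isomorphism compatible with the actions. -/
def Clo.congr {G α G' β : Type*} [PartialOrder α] [SMul G α] [PartialOrder β] [SMul G' β]
    {X : Set α} {Y : Set β} (e : X ≃o Y)
    (h : ∀ (g : G) (x x' : X), x'.1 = g • x.1 →
      ∃ g' : G', ∀ z z' : X, z'.1 = g • z.1 ↔ (e z').1 = g' • (e z).1)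
    (h' : ∀ (g' : G') (y y' : Y), y'.1 = g' • y.1 →
      ∃ g : G, ∀ z z' : X, z'.1 = g • z.1 ↔ (e z').1 = g' • (e z).1) :
    Clo G X ≃o Clo G' Y where
  toFun c :=
    { toFun y := e (c.toFun (e.symm y))
      le_cl' y := e.symm_apply_le.1 (c.le_cl' _)
      mono' y y' hy := e.monotone (c.mono' (e.symm.monotone hy))
      idem' y := by simp [c.idem']
      smul' g' y y' hy := by
        obtain ⟨g, hg⟩ := h' g' y y' hy
        refine (hg _ _).1 (c.smul' g _ _ ((hg _ _).2 ?_))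
        simpa using hy }
  invFun c :=
    { toFun x := e.symm (c.toFun (e x))
      le_cl' x := e.le_symm_apply.2 (c.le_cl' _)
      mono' x x' hx := e.symm.monotone (c.mono' (e.monotone hx))
      idem' x := by simp [c.idem']
      smul' g x x' hx := by
        obtain ⟨g', hg⟩ := h g x x' hx
        refine (hg _ _).2 ?_
        simpa using c.smul' g' _ _ ((hg _ _).1 hx) }
  left_inv c := Clo.ext' fun x => by simp
  right_inv c := Clo.ext' fun x => by simp
  map_rel_iff' {c c'} := by
    change (∀ y, e (c.toFun (e.symm y)) ≤ e (c'.toFun (e.symm y))) ↔ ∀ x, c.toFun x ≤ c'.toFun x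
    simp only [OrderIso.le_iff_le]
    exact ⟨fun h x => by simpa using h (e x), fun h y => h _⟩

section

open nonZeroDivisors

variable {Z : Type*} [CommRing Z] [IsDomain Z]

theorem coe_spanSingleton_mul (g : (FractionRing Z)ˣ) (J : FractionalIdeal Z⁰ (FractionRing Z)) :
    (FractionalIdeal.spanSingleton Z⁰ (g : (FractionRing Z)) * J : FractionalIdeal Z⁰ (FractionRing Z)) =
      g • (J : Submodule Z (FractionRing Z)) := by
  rw [FractionalIdeal.coe_mul, FractionalIdeal.coe_spanSingleton]
  ext x
  rw [Submodule.mem_units_smul_iff, Submodule.mem_span_singleton_mul]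
  constructor
  · rintro ⟨z, hz, rfl⟩
    simpa using hz
  · exact fun h => ⟨_, h, by simp⟩

/-- A fractional submodule, as a fractional ideal. -/
def mkFrac (J : Submodule Z (FractionRing Z)) (h : IsFractional Z⁰ J) :
    FractionalIdeal Z⁰ (FractionRing Z) := ⟨J, h⟩

theorem coe_mkFrac (J : Submodule Z (FractionRing Z)) (h : IsFractional Z⁰ J) :
    (mkFrac J h : Submodule Z (FractionRing Z)) = J := rfl

theorem mkFrac_coe (J : FractionalIdeal Z⁰ (FractionRing Z)) :
    mkFrac (J : Submodule Z (FractionRing Z)) J.isFractional = J := rfl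

theorem mkFrac_le_mkFrac {J J' : Submodule Z (FractionRing Z)} {h : IsFractional Z⁰ J}
    {h' : IsFractional Z⁰ J'} (hJ : J ≤ J') : mkFrac J h ≤ mkFrac J' h' := hJ

theorem isFractional_units_smul {J : Submodule Z (FractionRing Z)} (h : IsFractional Z⁰ J)
    (g : (FractionRing Z)ˣ) : IsFractional Z⁰ (g • J) := by
  rw [← coe_mkFrac J h, ← coe_spanSingleton_mul]
  exact FractionalIdeal.isFractional _

theorem isFractional_units_smul_iff {J : Submodule Z (FractionRing Z)} {g : (FractionRing Z)ˣ} :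
    IsFractional Z⁰ (g • J) ↔ IsFractional Z⁰ J :=
  ⟨fun h => by simpa using isFractional_units_smul h g⁻¹, fun h => isFractional_units_smul h g⟩

theorem mkFrac_units_smul {J : Submodule Z (FractionRing Z)} (h : IsFractional Z⁰ J)
    (g : (FractionRing Z)ˣ) (h' : IsFractional Z⁰ (g • J)) :
    mkFrac (g • J) h' =
      FractionalIdeal.spanSingleton Z⁰ (g : FractionRing Z) * mkFrac J h := by
  apply FractionalIdeal.coeToSubmodule_injective
  exact (coe_spanSingleton_mul g (mkFrac J h)).symm

theorem units_smul_top (g : (FractionRing Z)ˣ) :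
    g • (⊤ : Submodule Z (FractionRing Z)) = ⊤ := by
  ext x; simp [Submodule.mem_units_smul_iff]

variable (htop : ¬IsFractional Z⁰ (⊤ : Submodule Z (FractionRing Z)))
  (hfrac : ∀ J : Submodule Z (FractionRing Z), J ≠ ⊤ → IsFractional Z⁰ J)

theorem units_smul_ne_bot {J : Submodule Z (FractionRing Z)} (g : (FractionRing Z)ˣ)
    (h : J ≠ ⊥) : g • J ≠ ⊥ := fun h' => h (by
  rw [← inv_smul_smul g J, h']
  ext x
  simp [Submodule.mem_units_smul_iff])

theorem isFractional_of_le' {J J' : Submodule Z (FractionRing Z)} (h' : IsFractional Z⁰ J')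
    (h : J ≤ J') : IsFractional Z⁰ J :=
  FractionalIdeal.isFractional_of_le (J := mkFrac J' h') h

open Classical in
/-- The closure on all submodules of the quotient field induced by a fractional
star operation. -/
def AFracStar.extend (s : AFracStar Z) (J : Submodule Z (FractionRing Z)) :
    Submodule Z (FractionRing Z) :=
  if h : IsFractional Z⁰ J then s.toFun (mkFrac J h) else ⊤

theorem AFracStar.extend_of_isFractional (s : AFracStar Z) {J : Submodule Z (FractionRing Z)}
    (h : IsFractional Z⁰ J) : s.extend J = s.toFun (mkFrac J h) := dif_pos h

theorem AFracStar.extend_of_not (s : AFracStar Z) {J : Submodule Z (FractionRing Z)}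
    (h : ¬IsFractional Z⁰ J) : s.extend J = ⊤ := dif_neg h

theorem AFracStar.le_extend (s : AFracStar Z) (J : Submodule Z (FractionRing Z)) :
    J ≤ s.extend J := by
  by_cases h : IsFractional Z⁰ J
  · rw [s.extend_of_isFractional h]; exact s.le_star' (mkFrac J h)
  · rw [s.extend_of_not h]; exact le_top

theorem AFracStar.extend_ne_bot (s : AFracStar Z) {J : Submodule Z (FractionRing Z)}
    (hJ : J ≠ ⊥) : s.extend J ≠ ⊥ := fun h => hJ (le_bot_iff.1 ((s.le_extend J).trans h.le))

/-- The closure on nonzero submodules of the quotient field induced by a fractional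
star operation. -/
def AFracStar.toClo (s : AFracStar Z) :
    Clo (FractionRing Z)ˣ {J : Submodule Z (FractionRing Z) | J ≠ ⊥} where
  toFun J := ⟨s.extend J.1, s.extend_ne_bot J.2⟩
  le_cl' J := s.le_extend J.1
  mono' J J' hJ := by
    change s.extend J.1 ≤ s.extend J'.1
    by_cases h' : IsFractional Z⁰ J'.1
    · have h : IsFractional Z⁰ J.1 := isFractional_of_le' h' hJ
      rw [s.extend_of_isFractional h, s.extend_of_isFractional h']
      exact s.mono' (mkFrac_le_mkFrac hJ)
    · rw [s.extend_of_not h']; exact le_top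
  idem' J := by
    refine Subtype.ext ?_
    change s.extend (s.extend J.1) = s.extend J.1
    by_cases h : IsFractional Z⁰ J.1
    · rw [s.extend_of_isFractional h, s.extend_of_isFractional (FractionalIdeal.isFractional _),
        mkFrac_coe, s.idem']
    · rw [s.extend_of_not h]
      exact top_le_iff.1 (s.le_extend ⊤)
  smul' g J J' hJ := by
    change s.extend J'.1 = g • s.extend J.1
    rw [hJ]
    by_cases h : IsFractional Z⁰ J.1
    · have h' := isFractional_units_smul h g
      rw [s.extend_of_isFractional h, s.extend_of_isFractional h', mkFrac_units_smul h,
        s.smul' _ g.ne_zero, coe_spanSingleton_mul]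
    · have h' : ¬IsFractional Z⁰ (g • J.1) := mt isFractional_units_smul_iff.1 h
      rw [s.extend_of_not h, s.extend_of_not h', units_smul_top]

theorem AFracStar.toClo_coe (s : AFracStar Z) (J : FractionalIdeal Z⁰ (FractionRing Z))
    (hJ : (J : Submodule Z (FractionRing Z)) ≠ ⊥) :
    (s.toClo.toFun ⟨J, hJ⟩).1 = s.toFun J := s.extend_of_isFractional J.isFractional

include htop in
theorem isFractional_ne_top (J : FractionalIdeal Z⁰ (FractionRing Z)) : (J : Submodule Z (FractionRing Z)) ≠ ⊤ :=
  fun h => htop (h ▸ J.isFractional)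

include htop in
theorem AFracStar.map_zero (s : AFracStar Z) : s.toFun 0 = 0 := by
  by_contra h0
  obtain ⟨y, hy, hy0⟩ : ∃ y ∈ s.toFun 0, y ≠ 0 := by
    by_contra! hall
    exact h0 (FractionalIdeal.eq_zero_iff.2 hall)
  refine isFractional_ne_top htop (s.toFun 0) (top_le_iff.1 fun x _ => ?_)
  by_cases hx : x = 0
  · rw [hx]; exact zero_mem _
  have h1 := s.smul' _ (mul_ne_zero hx (inv_ne_zero hy0)) 0
  rw [mul_zero] at h1
  rw [h1]
  change x ∈ (FractionalIdeal.spanSingleton Z⁰ ((Units.mk0 (x * y⁻¹)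
    (mul_ne_zero hx (inv_ne_zero hy0)) : (FractionRing Z)ˣ) : (FractionRing Z)) * s.toFun 0 : FractionalIdeal Z⁰ (FractionRing Z)).coeToSubmodule
  rw [coe_spanSingleton_mul, Submodule.mem_units_smul_iff]
  have : ((Units.mk0 (x * y⁻¹) (mul_ne_zero hx (inv_ne_zero hy0)) : (FractionRing Z)ˣ) : (FractionRing Z))⁻¹ * x = y := by
    rw [Units.val_mk0]; field_simp
  rw [this]
  exact hy

theorem exists_units_smul_le {J J' : Submodule Z (FractionRing Z)} (hJ : IsFractional Z⁰ J) (hJ' : J' ≠ ⊥) :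
    ∃ g : (FractionRing Z)ˣ, g • J ≤ J' := by
  obtain ⟨b, hb, hJ⟩ := hJ
  obtain ⟨y, hy, hy0⟩ := Submodule.exists_mem_ne_zero_of_ne_bot hJ'
  have hb0 : algebraMap Z (FractionRing Z) b ≠ 0 := by
    rw [Ne, map_eq_zero_iff _ (IsFractionRing.injective Z (FractionRing Z))]
    exact nonZeroDivisors.ne_zero hb
  refine ⟨Units.mk0 (y * algebraMap Z (FractionRing Z) b) (mul_ne_zero hy0 hb0), fun x hx => ?_⟩
  rw [Submodule.mem_units_smul_iff, Units.val_mk0] at hx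
  obtain ⟨z, hz⟩ := hJ _ hx
  have : x = z • y := by
    rw [Algebra.smul_def, hz, Algebra.smul_def]
    field_simp
  rw [this]
  exact J'.smul_mem _ hy

open Classical in
/-- The closure on nonzero submodules attached to a fractional star operation, or to the
additional largest element. -/
def withTopToClo : WithTop (AFracStar Z) → Clo (FractionRing Z)ˣ {J : Submodule Z (FractionRing Z) | J ≠ ⊥} :=
  WithTop.recTopCoe (Clo.const ⟨⊤, top_ne_bot⟩ (fun _ => le_top (α := Submodule Z (FractionRing Z)))
    fun g _ _ _ => (units_smul_top g).symm) AFracStar.toClo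

include htop in
theorem withTopToClo_le_iff (s t : WithTop (AFracStar Z)) :
    withTopToClo s ≤ withTopToClo t ↔ s ≤ t := by
  induction t with
  | top =>
    simp only [le_top, iff_true]
    exact fun J => (le_top : _ ≤ (⊤ : Submodule Z (FractionRing Z)))
  | coe t =>
    induction s with
    | top =>
      simp only [WithTop.not_top_le_coe, iff_false]
      intro h
      have h0 : ((1 : FractionalIdeal Z⁰ (FractionRing Z)) : Submodule Z (FractionRing Z)) ≠ ⊥ := fun h =>
        one_ne_zero (FractionalIdeal.coeToSubmodule_eq_bot.1 h)
      have h1 : (⊤ : Submodule Z (FractionRing Z)) ≤ (t.toClo.toFun ⟨_, h0⟩).1 := h ⟨_, h0⟩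
      rw [t.toClo_coe] at h1
      exact isFractional_ne_top htop _ (top_le_iff.1 h1)
    | coe s =>
      rw [WithTop.coe_le_coe]
      constructor
      · intro h J
        by_cases hJ : (J : Submodule Z (FractionRing Z)) = ⊥
        · rw [FractionalIdeal.coeToSubmodule_eq_bot.1 hJ, s.map_zero htop, t.map_zero htop]
        · have h1 : (s.toClo.toFun ⟨J, hJ⟩).1 ≤ (t.toClo.toFun ⟨J, hJ⟩).1 := h ⟨J, hJ⟩
          rwa [s.toClo_coe, t.toClo_coe] at h1
      · intro h J
        change (s.toClo.toFun J).1 ≤ (t.toClo.toFun J).1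
        by_cases hJ : IsFractional Z⁰ J.1
        · have h1 := h (mkFrac J.1 hJ)
          exact (s.toClo_coe (mkFrac J.1 hJ) J.2).le.trans
            (le_trans h1 (t.toClo_coe (mkFrac J.1 hJ) J.2).ge)
        · exact ((s.extend_of_not hJ).trans (t.extend_of_not hJ).symm).le

include htop hfrac in
theorem withTopToClo_surjective : Function.Surjective (withTopToClo (Z := Z)) := by
  classical
  intro c
  by_cases hc : ∃ J, IsFractional Z⁰ J.1 ∧ (c.toFun J).1 = ⊤
  · refine ⟨⊤, Clo.ext' fun J' => ?_⟩
    obtain ⟨J, hJ, hcJ⟩ := hc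
    obtain ⟨g, hg⟩ := exists_units_smul_le hJ J'.2
    have h1 := c.smul' g J ⟨g • J.1, units_smul_ne_bot g J.2⟩ rfl
    have h2 : (c.toFun ⟨g • J.1, units_smul_ne_bot g J.2⟩).1 ≤ (c.toFun J').1 := c.mono' hg
    rw [h1, hcJ, units_smul_top] at h2
    exact Subtype.ext (top_le_iff.1 h2).symm
  · push Not at hc
    let f : FractionalIdeal Z⁰ (FractionRing Z) → FractionalIdeal Z⁰ (FractionRing Z) := fun J =>
      if h : (J : Submodule Z (FractionRing Z)) = ⊥ then 0
      else mkFrac (c.toFun ⟨J, h⟩) (hfrac _ (hc ⟨J, h⟩ J.isFractional))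
    have f0 : ∀ J : FractionalIdeal Z⁰ (FractionRing Z), (J : Submodule Z (FractionRing Z)) = ⊥ → f J = 0 := fun J h => by
      simp [f, h]
    have f1 : ∀ (J : FractionalIdeal Z⁰ (FractionRing Z)) (h : (J : Submodule Z (FractionRing Z)) ≠ ⊥),
        (f J : Submodule Z (FractionRing Z)) = (c.toFun ⟨J, h⟩).1 := fun J h => by
      rw [show f J = mkFrac (c.toFun ⟨J, h⟩) _ from dif_neg h, coe_mkFrac]
    have f2 : ∀ (J : FractionalIdeal Z⁰ (FractionRing Z)), (J : Submodule Z (FractionRing Z)) ≠ ⊥ →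
        (f J : Submodule Z (FractionRing Z)) ≠ ⊥ := fun J h => by
      rw [f1 J h]; exact (c.toFun ⟨J, h⟩).2
    let s : AFracStar Z :=
      { toFun := f
        le_star' J := by
          by_cases h : (J : Submodule Z (FractionRing Z)) = ⊥
          · rw [FractionalIdeal.coeToSubmodule_eq_bot.1 h]; exact FractionalIdeal.zero_le _
          · rw [← FractionalIdeal.coe_le_coe, f1 J h]; exact c.le_cl' ⟨J, h⟩
        mono' J J' hJ := by
          by_cases h : (J : Submodule Z (FractionRing Z)) = ⊥
          · rw [f0 J h]; exact FractionalIdeal.zero_le _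
          · have h' : (J' : Submodule Z (FractionRing Z)) ≠ ⊥ := fun h' =>
              h (le_bot_iff.1 (h' ▸ FractionalIdeal.coe_le_coe.2 hJ))
            rw [← FractionalIdeal.coe_le_coe, f1 J h, f1 J' h']
            exact c.mono' (show (⟨J, h⟩ : {J : Submodule Z (FractionRing Z) | J ≠ ⊥}) ≤ ⟨J', h'⟩ from hJ)
        idem' J := by
          by_cases h : (J : Submodule Z (FractionRing Z)) = ⊥
          · rw [f0 J h, f0 0 FractionalIdeal.coe_zero]
          · apply FractionalIdeal.coeToSubmodule_injective
            change (f (f J) : Submodule Z (FractionRing Z)) = f J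
            have : (⟨f J, f2 J h⟩ : {J : Submodule Z (FractionRing Z) | J ≠ ⊥}) = c.toFun ⟨J, h⟩ :=
              Subtype.ext (f1 J h)
            rw [f1 _ (f2 J h), this, c.idem', f1 J h]
        smul' x hx J := by
          by_cases h : (J : Submodule Z (FractionRing Z)) = ⊥
          · rw [FractionalIdeal.coeToSubmodule_eq_bot.1 h, mul_zero, f0 0 FractionalIdeal.coe_zero,
              mul_zero]
          · have hg : x = (Units.mk0 x hx : (FractionRing Z)ˣ) := rfl
            have h1 : ((FractionalIdeal.spanSingleton Z⁰ x * J : FractionalIdeal Z⁰ (FractionRing Z)) :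
                Submodule Z (FractionRing Z)) = Units.mk0 x hx • (J : Submodule Z (FractionRing Z)) := by
              conv_lhs => rw [hg, coe_spanSingleton_mul]
            have h2 := units_smul_ne_bot (Units.mk0 x hx) h
            apply FractionalIdeal.coeToSubmodule_injective
            change (f _ : Submodule Z (FractionRing Z)) = (FractionalIdeal.spanSingleton Z⁰ x * f J :
              FractionalIdeal Z⁰ (FractionRing Z))
            rw [f1 _ (h1 ▸ h2), c.smul' (Units.mk0 x hx) ⟨J, h⟩ _ h1]
            conv_rhs => rw [hg, coe_spanSingleton_mul, f1 J h] }
    refine ⟨s, Clo.ext' fun J => Subtype.ext ?_⟩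
    by_cases hJ : IsFractional Z⁰ J.1
    · exact (s.toClo_coe (mkFrac J.1 hJ) J.2).trans (f1 (mkFrac J.1 hJ) J.2)
    · have h1 : J.1 = ⊤ := by
        by_contra h; exact hJ (hfrac _ h)
      have h2 : ∀ c : Clo (FractionRing Z)ˣ {J : Submodule Z (FractionRing Z) | J ≠ ⊥}, (c.toFun J).1 = ⊤ := fun c =>
        top_le_iff.1 (h1 ▸ c.le_cl' J)
      rw [h2, h2]

/-- Fractional star operations of a valuation domain, together with an additional largest
element, are the closures on nonzero submodules of the quotient field. -/
def withTopOrderIso : WithTop (AFracStar Z) ≃o Clo (FractionRing Z)ˣ {J : Submodule Z (FractionRing Z) | J ≠ ⊥} :=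
  RelIso.ofSurjective (OrderEmbedding.ofMapLEIff withTopToClo (withTopToClo_le_iff htop))
    (withTopToClo_surjective htop hfrac)

end

end Paper

namespace Paper

section

open nonZeroDivisors

variable {D : Type*} [CommRing D] [IsDomain D]
variable {K : Type*} [Field K] [Algebra D K] [IsFractionRing D K]
variable {Q P : Ideal D} [hQ : Q.IsPrime] [hP : P.IsPrime]

/-- `ψ` exhibits `Z` as the quotient of the localization of `D` at `P` by the ideal generated
by the prime `Q`. -/
structure IsResidue (P Q : Ideal D) {Z : Type*} [CommRing Z] (ψ : D →+* Z) : Prop where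
  ker : ∀ a, ψ a = 0 ↔ a ∈ Q
  isUnit : ∀ s, s ∉ P → IsUnit (ψ s)
  surj : ∀ z, ∃ a s, s ∉ P ∧ ψ s * z = ψ a

variable {Z : Type*} [CommRing Z] [IsDomain Z] {ψ : D →+* Z}

variable (K Q ψ) in
open Classical in
/-- The residue map from the localization of `D` at `Q` to the quotient field of `Z`,
extended by zero. -/
def rho (x : K) : FractionRing Z :=
  if h : ∃ d : D, d ∉ Q ∧ ∃ a : D, d • x = algebraMap D K a then
    algebraMap Z _ (ψ h.choose_spec.2.choose) / algebraMap Z _ (ψ h.choose)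
  else 0

namespace IsResidue

variable (hψ : IsResidue P Q ψ)
include hψ

theorem map_ne_zero {d : D} (hd : d ∉ Q) : algebraMap Z (FractionRing Z) (ψ d) ≠ 0 := by
  rw [Ne, map_eq_zero_iff _ (IsFractionRing.injective Z (FractionRing Z)), hψ.ker]
  exact hd

theorem rho_mul_map {x : K} {d a : D} (hd : d ∉ Q) (h : d • x = algebraMap D K a) :
    rho K Q ψ x * algebraMap Z _ (ψ d) = algebraMap Z _ (ψ a) := by
  have hx : ∃ d : D, d ∉ Q ∧ ∃ a : D, d • x = algebraMap D K a := ⟨d, hd, a, h⟩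
  rw [rho, dif_pos hx]
  have h1 := hx.choose_spec.2.choose_spec
  have h2 := hψ.map_ne_zero hx.choose_spec.1
  generalize hx.choose_spec.2.choose = a' at h1 ⊢
  generalize hx.choose = d' at h1 h2 ⊢
  rw [div_mul_eq_mul_div, div_eq_iff h2, ← map_mul, ← map_mul, ← map_mul, ← map_mul]
  congr 2
  apply IsFractionRing.injective D K
  rw [map_mul, map_mul, ← h, ← h1, Algebra.smul_def, Algebra.smul_def]
  ring

theorem rho_eq {x : K} {y : FractionRing Z} {d a : D} (hd : d ∉ Q)
    (h : d • x = algebraMap D K a) (hy : y * algebraMap Z _ (ψ d) = algebraMap Z _ (ψ a)) :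
    rho K Q ψ x = y :=
  mul_right_cancel₀ (hψ.map_ne_zero hd) ((hψ.rho_mul_map hd h).trans hy.symm)

theorem rho_algebraMap (a : D) : rho K Q ψ (algebraMap D K a) = algebraMap Z _ (ψ a) :=
  hψ.rho_eq (one_notMem_prime hQ) (one_smul D _) (by simp)

theorem rho_add {x y : K} (hx : x ∈ O K Q) (hy : y ∈ O K Q) :
    rho K Q ψ (x + y) = rho K Q ψ x + rho K Q ψ y := by
  obtain ⟨d, hd, a, hda⟩ := mem_O.1 hx
  obtain ⟨e, he, b, heb⟩ := mem_O.1 hy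
  refine hψ.rho_eq (hQ.mul_notMem hd he) (a := e * a + d * b) ?_ ?_
  · rw [map_add, map_mul, map_mul, ← hda, ← heb]
    simp only [Algebra.smul_def, map_mul]
    ring
  · simp only [map_add, map_mul, ← hψ.rho_mul_map hd hda, ← hψ.rho_mul_map he heb]
    ring

theorem rho_mul {x y : K} (hx : x ∈ O K Q) (hy : y ∈ O K Q) :
    rho K Q ψ (x * y) = rho K Q ψ x * rho K Q ψ y := by
  obtain ⟨d, hd, a, hda⟩ := mem_O.1 hx
  obtain ⟨e, he, b, heb⟩ := mem_O.1 hy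
  refine hψ.rho_eq (hQ.mul_notMem hd he) (a := a * b) ?_ ?_
  · rw [map_mul, ← hda, ← heb]
    simp only [Algebra.smul_def, map_mul]
    ring
  · simp only [map_mul, ← hψ.rho_mul_map hd hda, ← hψ.rho_mul_map he heb]
    ring

theorem rho_eq_zero_iff {x : K} (hx : x ∈ O K Q) : rho K Q ψ x = 0 ↔ x ∈ m K Q := by
  obtain ⟨d, hd, a, hda⟩ := mem_O.1 hx
  have h1 : rho K Q ψ x = 0 ↔ a ∈ Q := by
    rw [← mul_eq_zero_iff_right (hψ.map_ne_zero hd), hψ.rho_mul_map hd hda,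
      map_eq_zero_iff _ (IsFractionRing.injective Z (FractionRing Z)), hψ.ker]
  rw [h1]
  constructor
  · exact fun ha => mem_m.2 ⟨d, hd, a, ha, hda⟩
  · intro h
    rw [← algebraMap_mem_m_iff (K := K), ← hda, Algebra.smul_def]
    exact mul_mem_m (algebraMap_mem_O d) h

theorem exists_rho_eq_algebraMap (h : Q ≤ P) {c : K} (hc : c ∈ O K P) :
    ∃ z, rho K Q ψ c = algebraMap Z _ z := by
  obtain ⟨d, hd, a, hda⟩ := mem_O.1 hc
  obtain ⟨u, hu⟩ := hψ.isUnit d hd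
  refine ⟨ψ a * ↑u⁻¹, hψ.rho_eq (fun h' => hd (h h')) hda ?_⟩
  rw [← hu, ← map_mul, mul_assoc, Units.inv_mul, mul_one]

theorem exists_rho_algebraMap_eq (h : Q ≤ P) (z : Z) :
    ∃ c ∈ O K P, rho K Q ψ c = algebraMap Z _ z := by
  obtain ⟨a, s, hs, hz⟩ := hψ.surj z
  have hs0 : algebraMap D K s ≠ 0 := ne_zero_of_notMem_prime hs
  have h1 : s • (algebraMap D K a / algebraMap D K s) = algebraMap D K a := by
    rw [Algebra.smul_def, mul_div_cancel₀ _ hs0]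
  refine ⟨_, mem_O.2 ⟨s, hs, a, h1⟩, hψ.rho_eq (fun h' => hs (h h')) h1 ?_⟩
  rw [← map_mul, mul_comm, hz]

theorem exists_rho_eq (h : Q ≤ P) (y : FractionRing Z) : ∃ c ∈ O K Q, rho K Q ψ c = y := by
  obtain ⟨z, w, hw, rfl⟩ := IsFractionRing.div_surjective (A := Z) y
  obtain ⟨c, hc, hcz⟩ := hψ.exists_rho_algebraMap_eq (K := K) h z
  obtain ⟨e, he, hew⟩ := hψ.exists_rho_algebraMap_eq (K := K) h w
  have hw0 : algebraMap Z (FractionRing Z) w ≠ 0 := by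
    rw [Ne, map_eq_zero_iff _ (IsFractionRing.injective Z (FractionRing Z))]
    exact nonZeroDivisors.ne_zero hw
  have he' := O_le_O h he
  have hem : e ∉ m K Q := fun hm => hw0 (hew ▸ (hψ.rho_eq_zero_iff he').2 hm)
  have he2 := inv_mem_O_of_mem he' hem
  refine ⟨c * e⁻¹, mul_mem_O (O_le_O h hc) he2, ?_⟩
  rw [eq_div_iff hw0, ← hew, ← hψ.rho_mul (mul_mem_O (O_le_O h hc) he2) he', ← hcz,
    mul_assoc, inv_mul_cancel₀ (ne_zero_of_notMem hem), mul_one]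

/-- The image of a submodule under the residue map. -/
def image (h : Q ≤ P) (I : Submodule D K) (hI : loc P I ≤ I) (hIQ : I ≤ O K Q) :
    Submodule Z (FractionRing Z) where
  carrier := {y | ∃ x ∈ I, rho K Q ψ x = y}
  zero_mem' := ⟨0, zero_mem _, (hψ.rho_eq_zero_iff (zero_mem _)).2 (zero_mem _)⟩
  add_mem' := by
    rintro _ _ ⟨x, hx, rfl⟩ ⟨y, hy, rfl⟩
    exact ⟨x + y, add_mem hx hy, hψ.rho_add (hIQ hx) (hIQ hy)⟩
  smul_mem' := by
    rintro z _ ⟨x, hx, rfl⟩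
    obtain ⟨c, hc, hcz⟩ := hψ.exists_rho_algebraMap_eq (K := K) h z
    refine ⟨c * x, loc_le_iff.1 hI c hc x hx, ?_⟩
    rw [hψ.rho_mul (O_le_O h hc) (hIQ hx), hcz, Algebra.smul_def]

/-- The preimage of a submodule under the residue map. -/
def preimage (J : Submodule Z (FractionRing Z)) : Submodule D K where
  carrier := {x | x ∈ O K Q ∧ rho K Q ψ x ∈ J}
  zero_mem' := ⟨zero_mem _, by
    rw [(hψ.rho_eq_zero_iff (zero_mem _)).2 (zero_mem _)]; exact zero_mem _⟩
  add_mem' := by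
    rintro x y ⟨hx, hx'⟩ ⟨hy, hy'⟩
    refine ⟨add_mem hx hy, ?_⟩
    rw [hψ.rho_add hx hy]
    exact add_mem hx' hy'
  smul_mem' := by
    rintro d x ⟨hx, hx'⟩
    refine ⟨Submodule.smul_mem _ d hx, ?_⟩
    rw [Algebra.smul_def, hψ.rho_mul (algebraMap_mem_O d) hx, hψ.rho_algebraMap,
      ← Algebra.smul_def]
    exact J.smul_mem _ hx'

theorem loc_preimage_le (h : Q ≤ P) (J : Submodule Z (FractionRing Z)) :
    loc P (hψ.preimage (K := K) J) ≤ hψ.preimage J := by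
  rw [loc_le_iff]
  rintro c hc x ⟨hx, hxJ⟩
  refine ⟨mul_mem_O (O_le_O h hc) hx, ?_⟩
  obtain ⟨z, hz⟩ := hψ.exists_rho_eq_algebraMap h hc
  rw [hψ.rho_mul (O_le_O h hc) hx, hz, ← Algebra.smul_def]
  exact J.smul_mem _ hxJ

/-- The residue map induces an order isomorphism between the modules over the localization
at `P` strictly above the maximal ideal of the localization at `Q` and the nonzero submodules
of the quotient field of `Z`. -/
def orderIso (h : Q ≤ P) : Vset K Q P ≃o {J : Submodule Z (FractionRing Z) | J ≠ ⊥} where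
  toFun I := ⟨hψ.image h I.1 I.2.2 I.2.1.2, fun h0 => by
    obtain ⟨x, hx, hx'⟩ := Set.not_subset.1 (not_le_of_gt I.2.1.1)
    have h1 : rho K Q ψ x ∈ hψ.image h I.1 I.2.2 I.2.1.2 := ⟨x, hx, rfl⟩
    rw [h0] at h1
    exact hx' ((hψ.rho_eq_zero_iff (I.2.1.2 hx)).1 h1)⟩
  invFun J := ⟨hψ.preimage J.1, ⟨lt_of_le_of_ne (fun x hx => ⟨m_le_O hx, by
      rw [(hψ.rho_eq_zero_iff (m_le_O hx)).2 hx]; exact zero_mem _⟩) fun h0 => by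
    obtain ⟨y, hy, hy0⟩ := Submodule.exists_mem_ne_zero_of_ne_bot J.2
    obtain ⟨c, hc, rfl⟩ := hψ.exists_rho_eq (K := K) h y
    have h1 : c ∈ hψ.preimage J.1 := ⟨hc, hy⟩
    rw [← h0] at h1
    exact hy0 ((hψ.rho_eq_zero_iff hc).2 h1), fun x hx => hx.1⟩, hψ.loc_preimage_le h J.1⟩
  left_inv I := by
    refine Subtype.ext (le_antisymm ?_ fun x hx => ⟨I.2.1.2 hx, x, hx, rfl⟩)
    rintro x ⟨hx, x', hx', hxx⟩
    have h1 : rho K Q ψ (x - x') = 0 := by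
      have h2 := hψ.rho_add (sub_mem hx (I.2.1.2 hx')) (I.2.1.2 hx')
      rw [sub_add_cancel, hxx] at h2
      simpa using h2
    rw [hψ.rho_eq_zero_iff (sub_mem hx (I.2.1.2 hx'))] at h1
    simpa using add_mem (I.2.1.1.le h1) hx'
  right_inv J := by
    refine Subtype.ext (le_antisymm ?_ fun y hy => ?_)
    · rintro _ ⟨x, hx, rfl⟩
      exact hx.2
    · obtain ⟨c, hc, rfl⟩ := hψ.exists_rho_eq (K := K) h y
      exact ⟨c, ⟨hc, hy⟩, rfl⟩
  map_rel_iff' {I I'} := by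
    constructor
    · intro hle x hx
      obtain ⟨x', hx', hxx⟩ := hle (show rho K Q ψ x ∈ _ from ⟨x, hx, rfl⟩)
      have h1 : rho K Q ψ (x - x') = 0 := by
        have h2 := hψ.rho_add (sub_mem (I.2.1.2 hx) (I'.2.1.2 hx')) (I'.2.1.2 hx')
        rw [sub_add_cancel, hxx] at h2
        simpa using h2
      rw [hψ.rho_eq_zero_iff (sub_mem (I.2.1.2 hx) (I'.2.1.2 hx'))] at h1
      simpa using add_mem (I'.2.1.1.le h1) hx'
    · rintro hle _ ⟨x, hx, rfl⟩
      exact ⟨x, hle hx, rfl⟩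

theorem mem_orderIso {h : Q ≤ P} {I : Vset K Q P} {y : FractionRing Z} :
    y ∈ (hψ.orderIso h I).1 ↔ ∃ x ∈ I.1, rho K Q ψ x = y := Iff.rfl

theorem orderIso_smul (h : Q ≤ P) {g : Kˣ} (hg : g ∈ MulAction.stabilizer Kˣ (O K Q))
    {y : (FractionRing Z)ˣ} (hy : rho K Q ψ (g : K) = y) (I I' : Vset K Q P) :
    I'.1 = g • I.1 ↔ (hψ.orderIso h I').1 = y • (hψ.orderIso h I).1 := by
  have key : ∀ I' : Vset K Q P, I'.1 = g • I.1 →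
      (hψ.orderIso h I').1 = y • (hψ.orderIso h I).1 := by
    intro I' hI'
    ext w
    rw [Submodule.mem_units_smul_iff, mem_orderIso, mem_orderIso, hI']
    have hg' := mem_stabilizer_O.1 hg
    constructor
    · rintro ⟨x, hx, rfl⟩
      rw [Submodule.mem_units_smul_iff] at hx
      refine ⟨_, hx, ?_⟩
      rw [eq_inv_mul_iff_mul_eq₀ y.ne_zero, ← hy, ← hψ.rho_mul hg'.1 (I.2.1.2 hx),
        mul_inv_cancel_left₀ g.ne_zero]
    · rintro ⟨x, hx, hxw⟩
      refine ⟨_, Submodule.mul_mem_units_smul hx, ?_⟩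
      rw [hψ.rho_mul hg'.1 (I.2.1.2 hx), hxw, hy, mul_inv_cancel_left₀ y.ne_zero]
  refine ⟨key I', fun h' => ?_⟩
  have h1 := key ⟨g • I.1, smul_mem_Vset hg I.2⟩ rfl
  have h2 := (hψ.orderIso h).injective (Subtype.ext (h'.trans h1.symm))
  exact congrArg Subtype.val h2

/-- Closures on modules over the localization at `P` correspond to closures on submodules of
the quotient field of `Z`. -/
def cloOrderIso (h : Q ≤ P) :
    Clo Kˣ (Vset K Q P) ≃o
      Clo (FractionRing Z)ˣ {J : Submodule Z (FractionRing Z) | J ≠ ⊥} :=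
  Clo.congr (hψ.orderIso h)
    (fun g x x' hx => by
      have hg := mem_stabilizer_of_Ioc x.2.1 (hx ▸ x'.2.1)
      have hg' := mem_stabilizer_O.1 hg
      have h0 : rho K Q ψ (g : K) ≠ 0 := fun h0 => one_notMem_m (K := K) (P := Q) (by
        have := mul_mem_m hg'.2 ((hψ.rho_eq_zero_iff hg'.1).1 h0)
        rwa [inv_mul_cancel₀ g.ne_zero] at this)
      exact ⟨Units.mk0 _ h0, hψ.orderIso_smul h hg rfl⟩)
    (fun y _ _ _ => by
      obtain ⟨c, hc, hcy⟩ := hψ.exists_rho_eq (K := K) h y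
      have hcm : c ∉ m K Q := fun hm => y.ne_zero (hcy ▸ (hψ.rho_eq_zero_iff hc).2 hm)
      exact ⟨Units.mk0 c (ne_zero_of_notMem hcm),
        hψ.orderIso_smul h (mem_stabilizer_O.2 ⟨hc, inv_mem_O_of_mem hc hcm⟩) hcy⟩)

theorem not_isFractional_top (h : Q < P) : ¬IsFractional Z⁰ (⊤ : Submodule Z (FractionRing Z)) := by
  rintro ⟨b, hb, hall⟩
  obtain ⟨t, htP, htQ⟩ := Set.not_subset.1 (not_le_of_gt h)
  have hb0 : algebraMap Z (FractionRing Z) b ≠ 0 := by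
    rw [Ne, map_eq_zero_iff _ (IsFractionRing.injective Z (FractionRing Z))]
    exact nonZeroDivisors.ne_zero hb
  obtain ⟨z, hz⟩ := hall ((algebraMap Z _ b)⁻¹ * (algebraMap Z _ (ψ t))⁻¹) trivial
  rw [Algebra.smul_def, mul_inv_cancel_left₀ hb0, ← mul_eq_one_iff_eq_inv₀ (hψ.map_ne_zero htQ),
    ← map_mul, ← map_one (algebraMap Z (FractionRing Z))] at hz
  have hz' := IsFractionRing.injective Z (FractionRing Z) hz
  obtain ⟨a, s, hs, hzs⟩ := hψ.surj z
  have h1 : ψ (s - a * t) = 0 := by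
    rw [map_sub, map_mul, ← hzs, mul_assoc, hz', mul_one, sub_self]
  rw [hψ.ker] at h1
  refine hs ?_
  have h2 := P.add_mem (h.le h1) (P.mul_mem_left a htP)
  rwa [sub_add_cancel] at h2

theorem isFractional_of_ne_top (K : Type*) [Field K] [Algebra D K] [IsFractionRing D K]
    (hp : IsPrufer D K) (h : Q < P) {J : Submodule Z (FractionRing Z)}
    (hJ : J ≠ ⊤) : IsFractional Z⁰ J := by
  obtain ⟨y, -, hy⟩ := Set.not_subset.1 (fun h' => hJ (top_le_iff.1 h'))
  obtain ⟨c, hc, rfl⟩ := hψ.exists_rho_eq (K := K) h.le y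
  have hcI : c ∉ hψ.preimage J := fun h' => hy h'.2
  have hle := le_smul_m hp (hψ.loc_preimage_le h.le J)
    (g := Units.mk0 c (ne_zero_of_notMem hcI)) hcI
  obtain ⟨s, hs, hsc⟩ := exists_smul_mem_m h hc
  refine ⟨ψ s, mem_nonZeroDivisors_of_ne_zero fun h0 => hs ((hψ.ker s).1 h0), fun w hw => ?_⟩
  obtain ⟨x, hx, rfl⟩ := hψ.exists_rho_eq (K := K) h.le w
  have hx1 := hle (show x ∈ hψ.preimage J from ⟨hx, hw⟩)
  rw [Submodule.mem_units_smul_iff, Units.val_mk0] at hx1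
  have h2 : algebraMap D K s * x ∈ O K P := by
    have h3 := mul_mem_O (m_le_O hsc) (m_le_O hx1)
    rwa [Algebra.smul_def, mul_assoc, mul_inv_cancel_left₀ (ne_zero_of_notMem hcI)] at h3
  obtain ⟨z, hz⟩ := hψ.exists_rho_eq_algebraMap h.le h2
  rw [hψ.rho_mul (algebraMap_mem_O s) hx, hψ.rho_algebraMap] at hz
  exact ⟨z, by rw [← hz, Algebra.smul_def]⟩

end IsResidue

omit [IsDomain D] hQ in
theorem isResidue_Zring [hQ : Q.IsPrime] (h : Q ≤ P) :
    IsResidue P Q ((Ideal.Quotient.mk (Ideal.map (algebraMap D (locRing D P hP)) Q)).comp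
      (algebraMap D (locRing D P hP))) where
  ker a := by
    rw [RingHom.comp_apply, Ideal.Quotient.eq_zero_iff_mem, ← Ideal.mem_comap]
    have h1 := IsLocalization.under_map_of_isPrime_disjoint P.primeCompl (locRing D P hP) hQ
      (Set.disjoint_left.2 fun x hx hx' => hx (h hx'))
    rw [Ideal.under] at h1
    rw [h1]
  isUnit s hs := (IsLocalization.map_units (locRing D P hP) (⟨s, hs⟩ : P.primeCompl)).map
    (Ideal.Quotient.mk (Ideal.map (algebraMap D (locRing D P hP)) Q))
  surj z := by
    obtain ⟨w, rfl⟩ := Ideal.Quotient.mk_surjective z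
    obtain ⟨⟨a, s⟩, hs⟩ := IsLocalization.surj P.primeCompl w
    exact ⟨a, s, s.2, by rw [RingHom.comp_apply, RingHom.comp_apply, ← map_mul, mul_comm, hs]⟩

variable (Q P) in
theorem isDomain_Zring (h : Q ≤ P) : IsDomain (Zring D P Q hP) := by
  have : (Ideal.map (algebraMap D (locRing D P hP)) Q).IsPrime :=
    IsLocalization.isPrime_of_isPrime_disjoint P.primeCompl (locRing D P hP) Q hQ
      (Set.disjoint_left.2 fun x hx hx' => hx (h hx'))
  infer_instance

theorem nonempty_cloVset_orderIso (hp : IsPrufer D K) (h : Q < P) :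
    Nonempty (WithTop (AFracStar (Zring D P Q hP)) ≃o Clo Kˣ (Vset K Q P)) := by
  have := isDomain_Zring Q P h.le
  have hψ := isResidue_Zring (D := D) h.le
  exact ⟨(withTopOrderIso (hψ.not_isFractional_top h)
    fun _ => hψ.isFractional_of_ne_top K hp h).trans (hψ.cloOrderIso h.le).symm⟩

end

end Paper

namespace Paper

section

variable {D₁ : Type*} [CommRing D₁] [IsDomain D₁]
variable {K₁ : Type*} [Field K₁] [Algebra D₁ K₁] [IsFractionRing D₁ K₁]
variable {D₂ : Type*} [CommRing D₂] [IsDomain D₂]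
variable {K₂ : Type*} [Field K₂] [Algebra D₂ K₂] [IsFractionRing D₂ K₂]
variable (hp₁ : IsPrufer D₁ K₁) (hsl₁ : IsSemilocal D₁)
variable (hp₂ : IsPrufer D₂ K₂) (hsl₂ : IsSemilocal D₂)
variable (ν : ↥(hiSpec D₁) ≃o ↥(hiSpec D₂))

theorem directlyBelow_map {Q P : ↥(hiSpec D₁)} (h : DirectlyBelow D₁ Q.1 P.1) :
    DirectlyBelow D₂ (ν Q).1 (ν P).1 := by
  refine ⟨(ν Q).2, (ν P).2, ν.lt_iff_lt.2 h.2.2.1, fun R hR h1 h2 => ?_⟩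
  refine h.2.2.2 _ (ν.symm ⟨R, hR⟩).2 ?_ ?_
  · exact ν.lt_symm_apply.2 h1
  · exact ν.symm_apply_lt.2 h2

/-- An isomorphism of trees preserves the elements covering a given one. -/
def covEquiv (Q : ↥(hiSpec D₁)) : Cov Q.1 ≃ Cov (ν Q).1 where
  toFun P := ⟨ν ⟨P.1, P.2.2.1⟩, directlyBelow_map ν P.2⟩
  invFun P := ⟨ν.symm ⟨P.1, P.2.2.1⟩, by
    have h := directlyBelow_map ν.symm (Q := ν Q) (P := ⟨P.1, P.2.2.1⟩) P.2
    rwa [ν.symm_apply_apply] at h⟩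
  left_inv P := by
    have h := congrArg Subtype.val (ν.symm_apply_apply ⟨P.1, P.2.2.1⟩)
    exact Subtype.ext h
  right_inv P := by
    have h := congrArg Subtype.val (ν.apply_symm_apply ⟨P.1, P.2.2.1⟩)
    exact Subtype.ext h

theorem exists_dat_orderIso (Q : ↥(hiSpec D₁))
    (h : ∀ P : ↥(hiSpec D₁), DirectlyBelow D₁ Q.1 P.1 →
      Nonempty (Clo K₁ˣ (Yset K₁ Q.1 P.1) ≃o Clo K₂ˣ (Yset K₂ (ν Q).1 (ν P).1))) :
    ∃ Φ : (Dat fun P : Cov Q.1 => Clo K₁ˣ (Yset K₁ Q.1 P.1)) ≃o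
        (Dat fun P : Cov (ν Q).1 => Clo K₂ˣ (Yset K₂ (ν Q).1 P.1)),
      ∀ f S, covEquiv ν Q '' S ∈ (Φ f).supp ↔ S ∈ f.supp := by
  obtain ⟨Ψ, hΨ⟩ := Dat.exists_orderIso
    (C := fun P : Cov (ν Q).1 => Clo K₂ˣ (Yset K₂ (ν Q).1 P.1))
    (E := fun P : Cov Q.1 => Clo K₁ˣ (Yset K₁ Q.1 P.1)) (covEquiv ν Q)
    (fun P => (h ⟨P.1, P.2.2.1⟩ P.2).some.symm)
  exact ⟨Ψ.symm, fun f S => by rw [hΨ, OrderIso.apply_symm_apply]⟩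

include hp₁ hsl₁ hp₂ hsl₂ in
theorem nonempty_cloYset_orderIso
    (hZ : ∀ P Q : ↥(hiSpec D₁), DirectlyBelow D₁ Q.1 P.1 →
      Nonempty (AFracStar (Zring D₁ P.1 Q.1 (mem_hiSpec_prime P.2)) ≃o
        AFracStar (Zring D₂ (ν P).1 (ν Q).1 (mem_hiSpec_prime (ν P).2))))
    (P Q : ↥(hiSpec D₁)) (h : DirectlyBelow D₁ Q.1 P.1) :
    Nonempty (Clo K₁ˣ (Yset K₁ Q.1 P.1) ≃o Clo K₂ˣ (Yset K₂ (ν Q).1 (ν P).1)) := by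
  have : Finite ↥(hiSpec D₁) := hiSpec_finite hp₁ hsl₁
  induction P using WellFoundedGT.induction generalizing Q with
  | ind P ih =>
    obtain ⟨Φ, -⟩ := exists_dat_orderIso ν P fun P' h' => ih P' h'.2.2.1 P h'
    have h₂ := directlyBelow_map ν h
    obtain ⟨v₁⟩ := nonempty_cloVset_orderIso hp₁ h.2.2.1
    obtain ⟨v₂⟩ := nonempty_cloVset_orderIso hp₂ h₂.2.2.1
    obtain ⟨z⟩ := hZ P Q h
    have eX := (decomp hp₁ hsl₁ P.2).orderIso.symm.trans
      (Φ.trans (decomp hp₂ hsl₂ (ν P).2).orderIso)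
    have eV := v₁.symm.trans (z.withTopCongr.trans v₂)
    exact ⟨(glueData hp₁ h.2.2.1).orderIso.trans
      ((Glue.congr eX eV).trans (glueData hp₂ h₂.2.2.1).orderIso.symm)⟩

end

end Paper

namespace Paper

section

variable {D : Type*} [CommRing D] [IsDomain D]
variable {K : Type*} [Field K] [Algebra D K] [IsFractionRing D K]
variable {Q : Ideal D} [hQ : Q.IsPrime] (h0 : Q = ⊥)

variable (K) in
/-- The intersection of the localizations of `D` at the maximal ideals containing `P`. -/
def satRing (P : Ideal D) : Subalgebra D K :=
  sInf {A | ∃ (N : Ideal D) (hN : N.IsMaximal), P ≤ N ∧ A = locAt D K N hN.isPrime}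

theorem mem_satRing {P : Ideal D} {x : K} : x ∈ satRing K P ↔ x ∈ sat P (1 : Submodule D K) := by
  rw [satRing, Algebra.mem_sInf, mem_sat]
  constructor
  · intro h M hM hPM
    have := hM.isPrime
    exact mem_loc.1 (mem_locAt.1 (h _ ⟨M, hM, hPM, rfl⟩))
  · rintro h _ ⟨N, hN, hPN, rfl⟩
    have := hN.isPrime
    exact mem_locAt.2 (mem_loc.2 (h N hN hPN))

variable (K) in
/-- The intersection of the rings `satRing K P` for `P` in a set of covers of `Q`. -/
def sk (S : Set (Cov Q)) : Subalgebra D K := sInf ((fun P : Cov Q => satRing K P.1) '' S)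

omit hQ in
theorem mem_sk {S : Set (Cov Q)} {x : K} :
    x ∈ sk K S ↔ ∀ P ∈ S, x ∈ sat P.1 (1 : Submodule D K) := by
  simp only [sk, Algebra.mem_sInf, Set.forall_mem_image, mem_satRing]

include h0

theorem O_eq_top : O K Q = ⊤ := by
  refine top_le_iff.1 fun x _ => mem_O.2 ?_
  obtain ⟨a, b, hb, rfl⟩ := IsFractionRing.div_surjective (A := D) x
  have hb0 := nonZeroDivisors.ne_zero hb
  have hb1 : algebraMap D K b ≠ 0 := by
    rwa [Ne, map_eq_zero_iff _ (IsFractionRing.injective D K)]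
  refine ⟨b, fun h => hb0 (by simpa [h0] using h), a, ?_⟩
  rw [Algebra.smul_def]
  field_simp

theorem m_eq_bot : m K Q = ⊥ := by
  refine le_bot_iff.1 fun x hx => ?_
  obtain ⟨d, hd, a, ha, h⟩ := mem_m.1 hx
  have hd1 := ne_zero_of_notMem_prime (K := K) hd
  rw [h0, Ideal.mem_bot] at ha
  rw [ha, map_zero, Algebra.smul_def] at h
  exact (Submodule.mem_bot D).2 ((mul_eq_zero.1 h).resolve_left hd1)

theorem mem_Xset_iff {I : Submodule D K} : I ∈ Xset K Q ↔ I ≠ ⊥ := by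
  rw [Set.mem_Ioc, O_eq_top h0, m_eq_bot h0, bot_lt_iff_ne_bot]
  exact and_iff_left le_top

omit hQ in
theorem mem_hiSpec_of_eq_bot : Q ∈ hiSpec D := h0 ▸ bot_mem_hiSpec

theorem sat_mem_Yset_of_ne_bot (P : Cov Q) {I : Submodule D K} (hI : I ≠ ⊥) :
    sat P.1 I ∈ Yset K Q P.1 := sat_mem_Yset P.lt.le ((mem_Xset_iff h0).2 hI)

theorem sat_one_ne_top (P : Cov Q) : sat P.1 (1 : Submodule D K) ≠ ⊤ := fun h => by
  have := (h ▸ sat_le_loc : ⊤ ≤ O K P.1)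
  exact not_le_of_gt ((O_lt_O (K := K) P.lt).trans_le le_top) this

omit hQ h0 in
theorem one_le_sk (S : Set (Cov Q)) : 1 ≤ Subalgebra.toSubmodule (sk K S) := by
  intro x hx
  obtain ⟨a, rfl⟩ := Submodule.mem_one.1 hx
  exact (sk K S).algebraMap_mem a

omit hQ h0 in
theorem sk_ne_bot (S : Set (Cov Q)) : Subalgebra.toSubmodule (sk K S) ≠ ⊥ := fun h =>
  one_ne_zero ((Submodule.mem_bot D).1 (h ▸ (sk K S).one_mem : (1 : K) ∈ (⊥ : Submodule D K)))

omit hQ h0 in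
theorem sat_sk_of_mem {S : Set (Cov Q)} {P : Cov Q} (hP : P ∈ S) :
    sat P.1 (Subalgebra.toSubmodule (sk K S)) = sat P.1 1 := by
  refine le_antisymm ?_ (hull_mono (one_le_sk S))
  refine le_trans (hull_mono fun x hx => ?_) hull_hull.le
  exact mem_sk.1 hx P hP

omit hQ h0 in
theorem sk_anti {S S' : Set (Cov Q)} (h : S ⊆ S') : sk K S' ≤ sk K S := fun _ hx =>
  mem_sk.2 fun P hP => mem_sk.1 hx P (h hP)

omit hQ h0 in
theorem sk_empty : sk K (∅ : Set (Cov Q)) = ⊤ := top_le_iff.1 fun _ _ =>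
  mem_sk.2 fun _ hP => hP.elim

variable (hp : IsPrufer D K) (hsl : IsSemilocal D)
include hp hsl

theorem iInf_sat {I : Submodule D K} (hI : I ≠ ⊥) : ⨅ P : Cov Q, sat P.1 I = I := by
  have := eq_inf_sat hp hsl (mem_hiSpec_of_eq_bot h0) ((mem_Xset_iff h0).2 hI)
  rwa [O_eq_top h0, top_inf_eq] at this

theorem sat_sk_of_notMem {S : Set (Cov Q)} {P : Cov Q} (hP : P ∉ S) :
    sat P.1 (Subalgebra.toSubmodule (sk K S)) = ⊤ := by
  classical
  let y : ∀ P : Cov Q, Yset K Q P.1 := fun P =>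
    if P ∈ S then ⟨sat P.1 1, sat_mem_Yset_of_ne_bot h0 P one_ne_zero⟩
    else ⟨O K Q, Vset_subset_Yset (top_mem_Vset P.lt.le)⟩
  have h1 : O K Q ⊓ ⨅ P, (y P).1 = Subalgebra.toSubmodule (sk K S) := by
    rw [O_eq_top h0, top_inf_eq]
    ext x
    rw [Submodule.mem_iInf, Subalgebra.mem_toSubmodule, mem_sk]
    refine forall_congr' fun P => ?_
    by_cases h : P ∈ S
    · simp [y, h]
    · simp [y, h, O_eq_top h0]
  have h2 := sat_inf hp hsl y P
  rw [h1] at h2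
  rw [h2, show y P = ⟨O K Q, _⟩ from if_neg hP]
  exact O_eq_top h0

theorem sk_le_sk_iff {S S' : Set (Cov Q)} : sk K S ≤ sk K S' ↔ S' ⊆ S := by
  refine ⟨fun h P hP => by_contra fun hPS => ?_, sk_anti⟩
  have h1 : sat P.1 (Subalgebra.toSubmodule (sk K S)) ≤ sat P.1 (Subalgebra.toSubmodule (sk K S')) :=
    hull_mono h
  rw [sat_sk_of_notMem h0 hp hsl hPS, sat_sk_of_mem hP] at h1
  exact sat_one_ne_top h0 P (top_le_iff.1 h1)

theorem sk_injective : Function.Injective (sk K : Set (Cov Q) → Subalgebra D K) := fun _ _ h =>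
  subset_antisymm ((sk_le_sk_iff h0 hp hsl).1 h.ge) ((sk_le_sk_iff h0 hp hsl).1 h.le)

theorem sk_univ : sk K (Set.univ : Set (Cov Q)) = ⊥ := by
  refine le_bot_iff.1 fun x hx => ?_
  have h1 : x ∈ ⨅ P : Cov Q, sat P.1 (1 : Submodule D K) :=
    (Submodule.mem_iInf _).2 fun P => mem_sk.1 hx P trivial
  rw [iInf_sat h0 hp hsl one_ne_zero] at h1
  exact Algebra.mem_bot.2 (Submodule.mem_one.1 h1)

theorem exists_cov_le {M : Ideal D} (hM : M.IsMaximal) (h : M ≠ ⊥) : ∃ P : Cov Q, P.1 ≤ M := by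
  have := hM.isPrime
  obtain ⟨P, hP, hPM⟩ := exists_directlyBelow hp hsl (mem_hiSpec_of_eq_bot h0)
    (maximal_mem_hiSpec hM) (h0 ▸ bot_lt_iff_ne_bot.2 h)
  exact ⟨⟨P, hP⟩, hPM⟩

theorem dependent_iff {P : Cov Q} {M N : Ideal D} (hPM : P.1 ≤ M) (hM : M.IsMaximal)
    (hN : N.IsMaximal) : Dependent D M N ↔ P.1 ≤ N := by
  have hP0 : P.1 ≠ ⊥ := fun h => absurd P.lt (by rw [h]; exact not_lt_bot)
  refine ⟨fun ⟨R, hR, hR0, hRM, hRN⟩ => ?_, fun h => ⟨P.1, P.2.isPrime_right, hP0, hPM, h⟩⟩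
  have := hM.isPrime
  have := hN.isPrime
  obtain ⟨P', hP'⟩ := exists_cov_le h0 hp hsl hN fun h => hR0 (le_bot_iff.1 (hRN.trans h.le))
  by_contra hne
  have hne' : P.1 ≠ P'.1 := fun h => hne (h.trans_le hP')
  have key : ∀ R : Ideal D, R.IsPrime → R ≠ ⊥ → ¬(R ≤ P.1 ∧ R ≤ P'.1) := fun R hR hR0 h =>
    hR0 (le_bot_iff.1 ((le_of_le_of_le hp P.2 P'.2 hne' hR h.1 h.2).trans h0.le))
  have hP'0 : P'.1 ≠ ⊥ := fun h => absurd P'.lt (by rw [h]; exact not_lt_bot)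
  rcases prime_total hp hRM hPM with h1 | h1
  · rcases prime_total hp hRN hP' with h2 | h2
    · exact key R hR hR0 ⟨h1, h2⟩
    · exact key P'.1 P'.2.isPrime_right hP'0 ⟨h2.trans h1, le_rfl⟩
  · exact hne (h1.trans hRN)

theorem TOf_eq_satRing {P : Cov Q} {M : Ideal D} (hPM : P.1 ≤ M) (hM : M.IsMaximal) :
    TOf D K M = satRing K P.1 := by
  refine congrArg sInf (Set.ext fun A => exists_congr fun N => exists_congr fun hN => ?_)
  rw [dependent_iff h0 hp hsl hPM hM hN]

omit hQ h0 hp hsl in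
theorem sk_singleton (P : Cov Q) : sk K {P} = satRing K P.1 := by simp [sk]

omit hQ h0 hp hsl in
theorem TOf_bot : TOf D K ⊥ = ⊤ := by
  refine top_le_iff.1 fun x _ => Algebra.mem_sInf.2 ?_
  rintro _ ⟨N, hN, ⟨P, _, hP0, hP, _⟩, _⟩
  exact (hP0 (le_bot_iff.1 hP)).elim

omit hQ hp hsl in
theorem isEmpty_cov (h : (⊥ : Ideal D).IsMaximal) : IsEmpty (Cov Q) := by
  refine ⟨fun P => ?_⟩
  exact P.2.isPrime_right.ne_top (h.out.2 _ (h0.symm.trans_lt P.lt))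

omit hQ h0 hp hsl in
theorem Cov.exists_le_maximal (P : Cov Q) : ∃ M : Ideal D, M.IsMaximal ∧ P.1 ≤ M :=
  Ideal.exists_le_maximal _ P.2.isPrime_right.ne_top

theorem satRing_mem_stdDecomp (P : Cov Q) : satRing K P.1 ∈ stdDecomp D K := by
  obtain ⟨M, hM, hPM⟩ := P.exists_le_maximal
  exact ⟨M, hM, (TOf_eq_satRing h0 hp hsl hPM hM).symm⟩

theorem mem_stdDecomp_iff {A : Subalgebra D K} : A ∈ stdDecomp D K ↔
    (∃ P : Cov Q, A = sk K {P}) ∨ IsEmpty (Cov Q) ∧ A = ⊤ := by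
  constructor
  · rintro ⟨M, hM, rfl⟩
    by_cases hM0 : M = ⊥
    · subst hM0
      exact Or.inr ⟨isEmpty_cov h0 hM, TOf_bot⟩
    · obtain ⟨P, hPM⟩ := exists_cov_le h0 hp hsl hM hM0
      exact Or.inl ⟨P, by rw [TOf_eq_satRing h0 hp hsl hPM hM, sk_singleton]⟩
  · rintro (⟨P, rfl⟩ | ⟨hE, rfl⟩)
    · rw [sk_singleton]
      exact satRing_mem_stdDecomp h0 hp hsl P
    · obtain ⟨M, hM⟩ := Ideal.exists_maximal D
      refine ⟨M, hM, ?_⟩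
      by_cases hM0 : M = ⊥
      · rw [hM0, TOf_bot]
      · exact hE.elim (exists_cov_le h0 hp hsl hM hM0).choose

theorem sk_mem_stdDecomp_iff {S : Set (Cov Q)} :
    sk K S ∈ stdDecomp D K ↔ (∃ P, S = {P}) ∨ IsEmpty (Cov Q) := by
  rw [mem_stdDecomp_iff h0 hp hsl]
  refine or_congr (exists_congr fun P => (sk_injective h0 hp hsl).eq_iff)
    (and_iff_left_of_imp fun hE => ?_)
  rw [Set.eq_empty_of_isEmpty S, sk_empty]

theorem mem_SkOver_iff {A : Subalgebra D K} :
    A ∈ SkOver D K ↔ ∃ S : Set (Cov Q), sk K S = A := by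
  constructor
  · rintro ⟨S', hS', rfl⟩
    refine ⟨{P | sk K {P} ∈ S'}, le_antisymm (le_sInf fun A hA => ?_) ?_⟩
    · rcases (mem_stdDecomp_iff h0 hp hsl).1 (hS' hA) with ⟨P, rfl⟩ | ⟨_, rfl⟩
      · exact sk_anti (Set.singleton_subset_iff.2 hA)
      · exact le_top
    · refine le_sInf ?_
      rintro _ ⟨P, hP, rfl⟩
      change _ ≤ satRing K P.1
      rw [← sk_singleton]
      exact sInf_le hP
  · rintro ⟨S, rfl⟩
    refine ⟨_, ?_, rfl⟩
    rintro _ ⟨P, _, rfl⟩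
    exact satRing_mem_stdDecomp h0 hp hsl P

/-- The skeleton, as the order dual of the power set of the set of covers. -/
def skEquiv : (Set (Cov Q))ᵒᵈ ≃o SkOver D K :=
  RelIso.ofSurjective
    (OrderEmbedding.ofMapLEIff
      (fun S => (⟨sk K (OrderDual.ofDual S), (mem_SkOver_iff h0 hp hsl).2 ⟨_, rfl⟩⟩ : SkOver D K))
      fun _ _ => sk_le_sk_iff h0 hp hsl)
    fun A => by
      obtain ⟨S, hS⟩ := (mem_SkOver_iff h0 hp hsl).1 A.2
      exact ⟨OrderDual.toDual S, Subtype.ext hS⟩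

end

end Paper

namespace Paper

section

variable {D : Type*} [CommRing D] [IsDomain D]
variable {K : Type*} [Field K] [Algebra D K] [IsFractionRing D K]

theorem span_singleton_mul_eq_units_smul (g : Kˣ) (I : Submodule D K) :
    Submodule.span D {(g : K)} * I = g • I := by
  ext x
  rw [Submodule.mem_units_smul_iff, Submodule.mem_span_singleton_mul]
  constructor
  · rintro ⟨z, hz, rfl⟩
    simpa using hz
  · exact fun h => ⟨_, h, by simp⟩

theorem Submodule.units_smul_top (g : Kˣ) : g • (⊤ : Submodule D K) = ⊤ := by
  ext x; simp [Submodule.mem_units_smul_iff]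

theorem Submodule.units_smul_bot (g : Kˣ) : g • (⊥ : Submodule D K) = ⊥ := by
  ext x; simp [Submodule.mem_units_smul_iff]

namespace Semistar

theorem map_units_smul (s : Semistar D K) (g : Kˣ) (I : Submodule D K) :
    s.toFun (g • I) = g • s.toFun I := by
  rw [← span_singleton_mul_eq_units_smul, s.smul' _ g.ne_zero, span_singleton_mul_eq_units_smul]

theorem map_bot (s : Semistar D K) : s.toFun ⊥ = ⊥ ∨ s.toFun ⊥ = ⊤ := by
  refine or_iff_not_imp_left.2 fun h => top_le_iff.1 fun x _ => ?_
  obtain ⟨y, hy, hy0⟩ := Submodule.exists_mem_ne_zero_of_ne_bot h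
  by_cases hx : x = 0
  · rw [hx]; exact zero_mem _
  have h1 := s.map_units_smul (Units.mk0 (x * y⁻¹) (mul_ne_zero hx (inv_ne_zero hy0))) ⊥
  rw [Submodule.units_smul_bot] at h1
  rw [h1, Submodule.mem_units_smul_iff, Units.val_mk0]
  convert hy using 1
  field_simp

variable (D K) in
/-- The semistar operation sending every submodule to the quotient field. -/
def top : Semistar D K where
  toFun _ := ⊤
  le_star' _ := le_top
  mono' _ _ _ := le_rfl
  idem' _ := rfl
  smul' x hx I := by
    rw [show x = (Units.mk0 x hx : K) from rfl, span_singleton_mul_eq_units_smul,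
      Submodule.units_smul_top]

theorem eq_top_of_map_bot {s : Semistar D K} (h : s.toFun ⊥ = ⊤) : s = top D K :=
  ext' (funext fun _ => top_le_iff.1 (h ▸ s.mono' bot_le))

end Semistar

theorem isFracOf_toFun_iff (s : Semistar D K) (A : Subalgebra D K) :
    IsFracOf D K A (s.toFun (Subalgebra.toSubmodule A)) ↔
      ∃ d : K, d ≠ 0 ∧ ∀ x ∈ s.toFun (Subalgebra.toSubmodule A), d * x ∈ A := by
  refine and_iff_right fun a ha x hx => ?_
  by_cases ha0 : a = 0
  · rw [ha0, zero_mul]; exact zero_mem _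
  have h1 : Units.mk0 a ha0 • Subalgebra.toSubmodule A ≤ Subalgebra.toSubmodule A := fun y hy => by
    rw [Submodule.mem_units_smul_iff, Units.val_mk0] at hy
    have := A.mul_mem ha hy
    rwa [mul_inv_cancel_left₀ ha0] at this
  have h2 := s.mono' h1
  rw [s.map_units_smul] at h2
  refine h2 ?_
  rw [Submodule.mem_units_smul_iff, Units.val_mk0, inv_mul_cancel_left₀ ha0]
  exact hx

variable {Q : Ideal D} [hQ : Q.IsPrime] (h0 : Q = ⊥) (hp : IsPrufer D K) (hsl : IsSemilocal D)

omit hQ in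
theorem Cov.exists_ne_zero (P : Cov Q) : ∃ t ∈ P.1, t ≠ 0 :=
  Submodule.exists_mem_ne_zero_of_ne_bot fun h => absurd P.lt (by rw [h]; exact not_lt_bot)

include hp in
theorem exists_mul_mem_sat_one {P : Cov Q} {J : Submodule D K} (hJ : sat P.1 J ≠ ⊤) :
    ∃ a : D, a ≠ 0 ∧ ∀ x ∈ J, a • x ∈ sat P.1 (1 : Submodule D K) := by
  obtain ⟨c, -, hc⟩ := exists_of_not_le (I := ⊤) hp fun h => hJ (top_le_iff.1 h)
  have hle := le_smul_O_of_sat hp hull_hull.le hc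
  obtain ⟨t, ht, ht0⟩ := P.exists_ne_zero
  have hD : ∀ t : D, t ≠ 0 → algebraMap D K t ≠ 0 := fun t ht => by
    rwa [Ne, map_eq_zero_iff _ (IsFractionRing.injective D K)]
  obtain ⟨a, b, hb, hab⟩ := IsFractionRing.div_surjective (A := D) (algebraMap D K t * (c : K)⁻¹)
  have hb0 := hD b (nonZeroDivisors.ne_zero hb)
  have hab' : algebraMap D K a = algebraMap D K b * (algebraMap D K t * (c : K)⁻¹) := by
    rw [← hab]; field_simp
  refine ⟨a, fun h => ?_, fun x hx => ?_⟩
  · rw [h, map_zero] at hab'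
    exact mul_ne_zero hb0 (mul_ne_zero (hD t ht0) (inv_ne_zero c.ne_zero)) hab'.symm
  · have h1 := Submodule.mem_units_smul_iff.1 (hle (le_sat hx))
    have h2 := m_mul_mem_of_sat (I := sat P.1 (1 : Submodule D K)) hp hull_hull.le
      (mul_mem_m h1 (algebraMap_mem_m_iff.2 ht)) (le_sat (Submodule.one_le.1 le_rfl))
    have h3 := Submodule.smul_mem _ b h2
    convert h3 using 1
    rw [Algebra.smul_def, Algebra.smul_def, hab']
    ring

include hp hsl h0 in
theorem exists_mul_mem_sk_iff {S : Set (Cov Q)} {J : Submodule D K} :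
    (∃ d : K, d ≠ 0 ∧ ∀ x ∈ J, d * x ∈ sk K S) ↔ ∀ P ∈ S, sat P.1 J ≠ ⊤ := by
  classical
  constructor
  · rintro ⟨d, hd, hdJ⟩ P hP htop
    refine sat_one_ne_top (K := K) h0 P (top_le_iff.1 fun y _ => ?_)
    refine hull_hull.le (mem_sat.2 fun M hM hPM => ?_)
    obtain ⟨e, he, hey⟩ := mem_sat.1 (htop.ge (Submodule.mem_top (x := d⁻¹ * y))) M hM hPM
    refine ⟨e, he, ?_⟩
    have := mem_sk.1 (hdJ _ hey) P hP
    rwa [mul_smul_comm, mul_inv_cancel_left₀ hd] at this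
  · intro h
    have := Cov.finite (Q := Q) hp hsl
    have := Fintype.ofFinite (Cov Q)
    have key : ∀ P : Cov Q, ∃ a : D, a ≠ 0 ∧ (P ∈ S → ∀ x ∈ J, a • x ∈ sat P.1 (1 : Submodule D K)) :=
      fun P => by
        by_cases hP : P ∈ S
        · obtain ⟨a, ha, haJ⟩ := exists_mul_mem_sat_one hp (h P hP)
          exact ⟨a, ha, fun _ => haJ⟩
        · exact ⟨1, one_ne_zero, fun h => (hP h).elim⟩
    choose a ha haJ using key
    refine ⟨algebraMap D K (∏ P, a P), ?_, fun x hx => mem_sk.2 fun P hP => ?_⟩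
    · rw [Ne, map_eq_zero_iff _ (IsFractionRing.injective D K)]
      exact Finset.prod_ne_zero_iff.2 fun P _ => ha P
    · rw [← Algebra.smul_def, ← Finset.prod_erase_mul _ _ (Finset.mem_univ P), mul_smul]
      exact Submodule.smul_mem _ _ (haJ P hP x hx)

include hp hsl h0 in
theorem sk_mem_supp_iff {s : Semistar D K} {S : Set (Cov Q)} : sk K S ∈ supp D K s ↔
    ∀ P ∈ S, sat P.1 (s.toFun (Subalgebra.toSubmodule (sk K S))) ≠ ⊤ := by
  rw [← exists_mul_mem_sk_iff h0 hp hsl, ← isFracOf_toFun_iff]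
  exact and_iff_right ((mem_SkOver_iff h0 hp hsl).2 ⟨_, rfl⟩)

open Classical in
/-- The semistar operation induced by a closure on nonzero submodules. -/
def Semistar.ofClo (c : Clo Kˣ (Xset K Q)) : Semistar D K where
  toFun I := if h : I ≠ ⊥ then c.toFun ⟨I, (mem_Xset_iff h0).2 h⟩ else ⊥
  le_star' I := by
    split_ifs with h
    · exact c.le_cl' ⟨I, (mem_Xset_iff h0).2 h⟩
    · exact (not_not.1 h).le
  mono' I J hIJ := by
    by_cases h : I = ⊥
    · simp [h]
    · have hJ : J ≠ ⊥ := fun hJ => h (le_bot_iff.1 (hIJ.trans hJ.le))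
      rw [dif_pos h, dif_pos hJ]
      exact c.mono' (show (⟨I, _⟩ : Xset K Q) ≤ ⟨J, _⟩ from hIJ)
  idem' I := by
    by_cases h : I = ⊥
    · simp [h]
    · have := (mem_Xset_iff h0).1 (c.toFun ⟨I, (mem_Xset_iff h0).2 h⟩).2
      simp only [dif_pos h, dif_pos this, Subtype.coe_eta, c.idem']
  smul' x hx I := by
    rw [show x = (Units.mk0 x hx : K) from rfl, span_singleton_mul_eq_units_smul,
      span_singleton_mul_eq_units_smul]
    by_cases h : I = ⊥
    · simp [h]
    · have h' : Units.mk0 x hx • I ≠ ⊥ := fun h' => h (by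
        rw [← inv_smul_smul (Units.mk0 x hx) I, h', Submodule.units_smul_bot])
      rw [dif_pos h, dif_pos h']
      exact c.smul' (Units.mk0 x hx) _ _ rfl

theorem Semistar.ofClo_of_ne {c : Clo Kˣ (Xset K Q)} {I : Submodule D K} (h : I ≠ ⊥) :
    (Semistar.ofClo h0 c).toFun I = c.toFun ⟨I, (mem_Xset_iff h0).2 h⟩ := dif_pos h

theorem Semistar.ofClo_bot {c : Clo Kˣ (Xset K Q)} : (Semistar.ofClo h0 c).toFun ⊥ = ⊥ :=
  dif_neg (not_not.2 rfl)

/-- Closures on nonzero submodules, together with an additional largest element, are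
the semistar operations. -/
def semistarEquiv : WithTop (Clo Kˣ (Xset K Q)) ≃o Semistar D K :=
  RelIso.ofSurjective
    (OrderEmbedding.ofMapLEIff (WithTop.recTopCoe (Semistar.top D K) (Semistar.ofClo h0))
      fun c c' => by
        induction c' with
        | top => exact iff_of_true (fun I => le_top (α := Submodule D K)) le_top
        | coe c' =>
          induction c with
          | top =>
            refine iff_of_false (fun h => ?_) (WithTop.not_top_le_coe _)
            exact top_ne_bot (le_bot_iff.1 ((h ⊥).trans (Semistar.ofClo_bot h0).le))
          | coe c =>
            rw [WithTop.coe_le_coe]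
            constructor
            · intro h I
              have hI := (mem_Xset_iff h0).1 I.2
              have := h I.1
              simp only [WithTop.recTopCoe_coe] at this
              rwa [Semistar.ofClo_of_ne h0 hI, Semistar.ofClo_of_ne h0 hI] at this
            · intro h I
              simp only [WithTop.recTopCoe_coe]
              by_cases hI : I = ⊥
              · rw [hI, Semistar.ofClo_bot, Semistar.ofClo_bot]
              · rw [Semistar.ofClo_of_ne h0 hI, Semistar.ofClo_of_ne h0 hI]
                exact h _)
    fun s => by
      rcases s.map_bot with h | h
      · refine ⟨((⟨fun I => ⟨s.toFun I.1, (mem_Xset_iff h0).2 fun h =>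
            (mem_Xset_iff h0).1 I.2 (le_bot_iff.1 ((s.le_star' _).trans h.le))⟩,
          fun I => s.le_star' _, fun I J hIJ => s.mono' hIJ, fun I => Subtype.ext (s.idem' _),
          fun g I J hIJ => ?_⟩ : Clo Kˣ (Xset K Q)) : WithTop _), Semistar.ext' (funext fun I => ?_)⟩
        · change s.toFun J.1 = g • s.toFun I.1
          rw [hIJ, s.map_units_smul]
        · by_cases hI : I = ⊥
          · rw [hI, h]; exact Semistar.ofClo_bot h0
          · exact Semistar.ofClo_of_ne h0 hI
      · exact ⟨⊤, (Semistar.eq_top_of_map_bot h).symm⟩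

variable (K Q) in
/-- The combinatorial data describing the semistar operations. -/
abbrev SemiDat : Type _ := WithTop (Dat fun P : Cov Q => Clo Kˣ (Yset K Q P.1))

/-- The support of the combinatorial data of a semistar operation. -/
def SemiDat.supp (w : SemiDat K Q) : Set (Set (Cov Q)) := WithTop.recTopCoe {∅} Dat.supp w

/-- The semistar operations, described by combinatorial data. -/
def semiDatEquiv : SemiDat K Q ≃o Semistar D K :=
  (decomp hp hsl (mem_hiSpec_of_eq_bot h0)).orderIso.withTopCongr.trans (semistarEquiv h0)

theorem sk_mem_supp_semiDatEquiv {w : SemiDat K Q} {S : Set (Cov Q)} :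
    sk K S ∈ supp D K (semiDatEquiv h0 hp hsl w) ↔ S ∈ w.supp := by
  rw [sk_mem_supp_iff h0 hp hsl]
  induction w using WithTop.recTopCoe with
  | top =>
    change (∀ P ∈ S, sat P.1 (⊤ : Submodule D K) ≠ ⊤) ↔ S = ∅
    have : ∀ P : Cov Q, sat P.1 (⊤ : Submodule D K) = ⊤ := fun P => top_le_iff.1 le_sat
    simp [this, Set.eq_empty_iff_forall_notMem]
  | coe f =>
    set d := decomp hp hsl (mem_hiSpec_of_eq_bot h0) with hd
    change (∀ P ∈ S, sat P.1 ((Semistar.ofClo h0 (d.orderIso f)).toFun _) ≠ ⊤) ↔ S ∈ f.supp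
    rw [Semistar.ofClo_of_ne h0 (sk_ne_bot S)]
    have hpat : d.pat ⟨_, (mem_Xset_iff h0).2 (sk_ne_bot S)⟩ = S := by
      ext P
      change sat P.1 (Subalgebra.toSubmodule (sk K S)) ≠ O K Q ↔ P ∈ S
      rw [O_eq_top h0]
      by_cases hP : P ∈ S
      · rw [sat_sk_of_mem hP]
        exact iff_of_true (sat_one_ne_top h0 P) hP
      · exact iff_of_false (not_not.2 (sat_sk_of_notMem h0 hp hsl hP)) hP
    have key := d.pat_subset_pat_orderIso_iff f ⟨_, (mem_Xset_iff h0).2 (sk_ne_bot S)⟩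
    rw [hpat] at key
    rw [← key]
    refine forall_congr' fun P => imp_congr_right fun hP => ?_
    exact not_congr ⟨fun h => h.trans (O_eq_top h0).symm, fun h => h.trans (O_eq_top h0)⟩

end

end Paper

namespace Paper

section

variable {D : Type*} [CommRing D] [IsDomain D]
variable {K : Type*} [Field K] [Algebra D K] [IsFractionRing D K]
variable {I J : Submodule D K}

theorem isFracOf_bot_iff_exists_mul : IsFracOf D K ⊥ I ↔
    ∃ d : K, d ≠ 0 ∧ ∀ x ∈ I, d * x ∈ (⊥ : Subalgebra D K) := by
  refine and_iff_right fun a ha x hx => ?_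
  obtain ⟨b, rfl⟩ := Algebra.mem_bot.1 ha
  rw [← Algebra.smul_def]
  exact I.smul_mem b hx

theorem isFracOf_bot_iff : IsFracOf D K ⊥ I ↔ ∃ g : Kˣ, I ≤ g • 1 := by
  rw [isFracOf_bot_iff_exists_mul]
  constructor
  · rintro ⟨d, hd, h⟩
    refine ⟨(Units.mk0 d hd)⁻¹, fun x hx => ?_⟩
    rw [Submodule.mem_units_smul_iff, Units.val_inv_eq_inv_val, inv_inv]
    exact Submodule.mem_one.2 (Algebra.mem_bot.1 (h x hx))
  · rintro ⟨g, h⟩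
    exact ⟨(g : K)⁻¹, inv_ne_zero g.ne_zero, fun x hx =>
      Algebra.mem_bot.2 (Submodule.mem_one.1 (Submodule.mem_units_smul_iff.1 (h hx)))⟩

theorem isFracOf_bot_mono (h : I ≤ J) (hJ : IsFracOf D K ⊥ J) : IsFracOf D K ⊥ I :=
  isFracOf_bot_iff.2 ((isFracOf_bot_iff.1 hJ).imp fun _ hg => h.trans hg)

theorem isFracOf_bot_units_smul (g : Kˣ) (h : IsFracOf D K ⊥ I) : IsFracOf D K ⊥ (g • I) := by
  obtain ⟨u, hu⟩ := isFracOf_bot_iff.1 h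
  exact isFracOf_bot_iff.2 ⟨g * u, by
    rw [mul_smul]; exact Submodule.units_smul_mono _ _ _ hu⟩

theorem isFracOf_bot_units_smul_iff {g : Kˣ} : IsFracOf D K ⊥ (g • I) ↔ IsFracOf D K ⊥ I :=
  ⟨fun h => by simpa using isFracOf_bot_units_smul g⁻¹ h, isFracOf_bot_units_smul g⟩

namespace Semistar

/-- The semistar operations preserving fractional ideals and sending all the other submodules
to the quotient field. -/
def IsFractional (s : Semistar D K) : Prop :=
  IsFracOf D K ⊥ (s.toFun 1) ∧ ∀ I, ¬IsFracOf D K ⊥ I → s.toFun I = ⊤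

theorem IsFractional.isFracOf {s : Semistar D K} (hs : s.IsFractional) (h : IsFracOf D K ⊥ I) :
    IsFracOf D K ⊥ (s.toFun I) := by
  obtain ⟨g, hg⟩ := isFracOf_bot_iff.1 h
  have := s.mono' hg
  rw [s.map_units_smul] at this
  exact isFracOf_bot_mono this (isFracOf_bot_units_smul g hs.1)

end Semistar

namespace FracStar

theorem map_units_smul (f : FracStar D K ⊥) (g : Kˣ) (h : IsFracOf D K ⊥ I) :
    (f.toFun ⟨g • I, isFracOf_bot_units_smul g h⟩).1 = g • (f.toFun ⟨I, h⟩).1 := by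
  rw [f.smul' g g.ne_zero ⟨I, h⟩ _ (span_singleton_mul_eq_units_smul g I).symm,
    span_singleton_mul_eq_units_smul]

open Classical in
/-- The extension of a fractional star operation by the quotient field. -/
def extend (f : FracStar D K ⊥) (I : Submodule D K) : Submodule D K :=
  if h : IsFracOf D K ⊥ I then (f.toFun ⟨I, h⟩).1 else ⊤

theorem extend_of_isFracOf (f : FracStar D K ⊥) (h : IsFracOf D K ⊥ I) :
    f.extend I = (f.toFun ⟨I, h⟩).1 := dif_pos h

theorem extend_of_not (f : FracStar D K ⊥) (h : ¬IsFracOf D K ⊥ I) : f.extend I = ⊤ := dif_neg h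

/-- The semistar operation extending a fractional star operation by the quotient field. -/
def toSemistar (f : FracStar D K ⊥) : Semistar D K where
  toFun := f.extend
  le_star' I := by
    by_cases h : IsFracOf D K ⊥ I
    · rw [f.extend_of_isFracOf h]; exact f.le_star' ⟨I, h⟩
    · rw [f.extend_of_not h]; exact le_top
  mono' I J hIJ := by
    by_cases h : IsFracOf D K ⊥ J
    · rw [f.extend_of_isFracOf h, f.extend_of_isFracOf (isFracOf_bot_mono hIJ h)]
      exact f.mono' ⟨I, isFracOf_bot_mono hIJ h⟩ ⟨J, h⟩ hIJ
    · rw [f.extend_of_not h]; exact le_top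
  idem' I := by
    by_cases h : IsFracOf D K ⊥ I
    · rw [f.extend_of_isFracOf h, f.extend_of_isFracOf (f.toFun ⟨I, h⟩).2]
      exact congrArg Subtype.val (f.idem' ⟨I, h⟩)
    · rw [f.extend_of_not h]
      by_cases h' : IsFracOf D K ⊥ (⊤ : Submodule D K)
      · exact (h (isFracOf_bot_mono le_top h')).elim
      · exact f.extend_of_not h'
  smul' x hx I := by
    rw [show x = (Units.mk0 x hx : K) from rfl, span_singleton_mul_eq_units_smul,
      span_singleton_mul_eq_units_smul]
    by_cases h : IsFracOf D K ⊥ I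
    · rw [f.extend_of_isFracOf h, f.extend_of_isFracOf (isFracOf_bot_units_smul _ h),
        f.map_units_smul]
    · rw [f.extend_of_not h, f.extend_of_not (mt isFracOf_bot_units_smul_iff.1 h),
        Submodule.units_smul_top]

theorem toSemistar_isFractional (f : FracStar D K ⊥) : f.toSemistar.IsFractional := by
  refine ⟨?_, fun I hI => f.extend_of_not hI⟩
  have h : IsFracOf D K ⊥ (1 : Submodule D K) := isFracOf_bot_iff.2 ⟨1, by rw [one_smul]⟩
  change IsFracOf D K ⊥ (f.extend 1)
  rw [f.extend_of_isFracOf h]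
  exact (f.toFun ⟨1, h⟩).2

end FracStar

variable (D K) in
/-- Fractional star operations as semistar operations. -/
def fracStarEquiv : FracStar D K ⊥ ≃o {s : Semistar D K // s.IsFractional} where
  toFun f := ⟨f.toSemistar, f.toSemistar_isFractional⟩
  invFun s :=
    { toFun I := ⟨s.1.toFun I.1, s.2.isFracOf I.2⟩
      le_star' I := s.1.le_star' _
      mono' I J h := s.1.mono' h
      idem' I := Subtype.ext (s.1.idem' _)
      smul' x hx I J h := by
        change s.1.toFun J.1 = _
        rw [h, s.1.smul' x hx] }
  left_inv f := FracStar.ext' (funext fun I => Subtype.ext (f.extend_of_isFracOf I.2))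
  right_inv s := by
    refine Subtype.ext (Semistar.ext' (funext fun I => ?_))
    by_cases h : IsFracOf D K ⊥ I
    · exact FracStar.extend_of_isFracOf _ h
    · exact (FracStar.extend_of_not _ h).trans (s.2.2 I h).symm
  map_rel_iff' {f f'} := by
    constructor
    · intro h I
      have : f.extend I.1 ≤ f'.extend I.1 := h I.1
      rwa [f.extend_of_isFracOf I.2, f'.extend_of_isFracOf I.2] at this
    · intro h I
      change f.extend I ≤ f'.extend I
      by_cases hI : IsFracOf D K ⊥ I
      · rw [f.extend_of_isFracOf hI, f'.extend_of_isFracOf hI]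
        exact h ⟨I, hI⟩
      · rw [f'.extend_of_not hI]; exact le_top

variable {Q : Ideal D} [hQ : Q.IsPrime] (h0 : Q = ⊥) (hp : IsPrufer D K) (hsl : IsSemilocal D)
include h0 hp hsl

theorem isFracOf_bot_iff_forall_cov :
    IsFracOf D K ⊥ I ↔ ∀ P : Cov Q, sat P.1 I ≠ ⊤ := by
  rw [isFracOf_bot_iff_exists_mul, ← sk_univ h0 hp hsl, exists_mul_mem_sk_iff h0 hp hsl]
  simp

theorem units_smul_sk_le {J : Submodule D K} (hJ : J ≠ ⊥) {y : Kˣ} (hy : (y : K) ∈ J) :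
    y • Subalgebra.toSubmodule (sk K {P : Cov Q | sat P.1 J ≠ ⊤}) ≤ J := by
  intro z hz
  rw [Submodule.mem_units_smul_iff] at hz
  rw [← iInf_sat h0 hp hsl hJ, Submodule.mem_iInf]
  intro P
  by_cases hP : sat P.1 J = ⊤
  · rw [hP]; trivial
  · refine mem_sat.2 fun M hM hPM => ?_
    obtain ⟨e, he, hez⟩ := mem_sat.1 (mem_sk.1 hz P hP) M hM hPM
    obtain ⟨a, ha⟩ := Submodule.mem_one.1 hez
    refine ⟨e, he, ?_⟩
    have : e • z = a • (y : K) := by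
      rw [Algebra.smul_def a, ha, smul_mul_assoc, mul_right_comm, inv_mul_cancel₀ y.ne_zero, one_mul]
    rw [this]
    exact J.smul_mem a hy

theorem isFractional_iff_supp_eq {s : Semistar D K} : s.IsFractional ↔ supp D K s = {⊥, ⊤} := by
  have hbot : ⊥ ∈ supp D K s ↔ IsFracOf D K ⊥ (s.toFun 1) := by
    rw [← Algebra.toSubmodule_bot]
    exact and_iff_right ((mem_SkOver_iff h0 hp hsl).2 ⟨_, sk_univ h0 hp hsl⟩)
  constructor
  · rintro ⟨h1, h2⟩
    refine subset_antisymm (fun A hA => ?_) (Set.insert_subset_iff.2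
      ⟨hbot.2 h1, Set.singleton_subset_iff.2 ?_⟩)
    · obtain ⟨S, rfl⟩ := (mem_SkOver_iff h0 hp hsl).1 hA.1
      rw [sk_mem_supp_iff h0 hp hsl] at hA
      by_cases h : IsFracOf D K ⊥ (Subalgebra.toSubmodule (sk K S))
      · left
        rw [← sk_univ h0 hp hsl]
        congr 1
        refine Set.eq_univ_of_forall fun P => by_contra fun hP => ?_
        exact (isFracOf_bot_iff_forall_cov h0 hp hsl).1 h P (sat_sk_of_notMem h0 hp hsl hP)
      · right
        rw [h2 _ h] at hA
        rw [Set.mem_singleton_iff, ← sk_empty (Q := Q)]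
        congr 1
        exact Set.eq_empty_of_forall_notMem fun P hP => hA P hP (top_le_iff.1 le_sat)
    · rw [← sk_empty (Q := Q), sk_mem_supp_iff h0 hp hsl]
      exact fun P hP => hP.elim
  · intro h
    refine ⟨hbot.1 (h ▸ Or.inl rfl), fun I hI => by_contra fun hJ => ?_⟩
    have hI' : ¬IsFracOf D K ⊥ (s.toFun I) := fun h => hI (isFracOf_bot_mono (s.le_star' I) h)
    have hJ0 : s.toFun I ≠ ⊥ := fun h => hI' (h ▸ isFracOf_bot_iff.2 ⟨1, bot_le⟩)
    obtain ⟨y, hy, hy0⟩ := Submodule.exists_mem_ne_zero_of_ne_bot hJ0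
    let S := {P : Cov Q | sat P.1 (s.toFun I) ≠ ⊤}
    have hle := s.mono' (units_smul_sk_le h0 hp hsl hJ0 (y := Units.mk0 y hy0) hy)
    rw [s.idem', s.map_units_smul] at hle
    obtain ⟨d, hd, hdJ⟩ := (exists_mul_mem_sk_iff h0 hp hsl (S := S)).2 fun P hP => hP
    have hS : sk K S ∈ supp D K s := by
      refine ⟨(mem_SkOver_iff h0 hp hsl).2 ⟨_, rfl⟩, (isFracOf_toFun_iff _ _).2
        ⟨d * y, mul_ne_zero hd hy0, fun x hx => ?_⟩⟩
      rw [mul_assoc]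
      refine hdJ _ (hle ?_)
      rw [Submodule.mem_units_smul_iff, Units.val_mk0, inv_mul_cancel_left₀ hy0]
      exact hx
    rw [h] at hS
    rcases hS with hS | hS
    · rw [← sk_univ h0 hp hsl] at hS
      have hS := sk_injective h0 hp hsl hS
      exact hI' ((isFracOf_bot_iff_forall_cov h0 hp hsl).2 fun P => hS.symm.subset (Set.mem_univ P))
    · rw [Set.mem_singleton_iff, ← sk_empty (Q := Q)] at hS
      have hS := sk_injective h0 hp hsl hS
      refine hJ ?_
      rw [← iInf_sat h0 hp hsl hJ0, iInf_eq_top]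
      exact fun P => by_contra fun hP => hS.subset hP

end

end Paper

namespace Paper

section

variable {D₁ : Type*} [CommRing D₁] [IsDomain D₁]
variable {K₁ : Type*} [Field K₁] [Algebra D₁ K₁] [IsFractionRing D₁ K₁]
variable {D₂ : Type*} [CommRing D₂] [IsDomain D₂]
variable {K₂ : Type*} [Field K₂] [Algebra D₂ K₂] [IsFractionRing D₂ K₂]
variable (hp₁ : IsPrufer D₁ K₁) (hsl₁ : IsSemilocal D₁)
variable (hp₂ : IsPrufer D₂ K₂) (hsl₂ : IsSemilocal D₂)
variable {Q₁ : Ideal D₁} [Q₁.IsPrime] (h0₁ : Q₁ = ⊥)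
variable {Q₂ : Ideal D₂} [Q₂.IsPrime] (h0₂ : Q₂ = ⊥)
variable (e : Cov Q₁ ≃ Cov Q₂)

/-- A bijection between the covers of the zero ideals induces an isomorphism of the skeletons. -/
def skCongr : SkOver D₁ K₁ ≃o SkOver D₂ K₂ :=
  (skEquiv h0₁ hp₁ hsl₁).symm.trans
    ((e.toOrderIsoSet.dual).trans (skEquiv h0₂ hp₂ hsl₂))

theorem skCongr_sk (S : Set (Cov Q₁)) (h : sk K₁ S ∈ SkOver D₁ K₁) :
    (skCongr hp₁ hsl₁ hp₂ hsl₂ h0₁ h0₂ e ⟨sk K₁ S, h⟩).1 = sk K₂ (e '' S) := by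
  have : (⟨sk K₁ S, h⟩ : SkOver D₁ K₁) = skEquiv h0₁ hp₁ hsl₁ (OrderDual.toDual S) := rfl
  rw [skCongr, OrderIso.trans_apply, this, OrderIso.symm_apply_apply]
  rfl

theorem skCongr_mem_stdDecomp_iff (A : SkOver D₁ K₁) :
    (skCongr hp₁ hsl₁ hp₂ hsl₂ h0₁ h0₂ e A).1 ∈ stdDecomp D₂ K₂ ↔ A.1 ∈ stdDecomp D₁ K₁ := by
  obtain ⟨A, hA⟩ := A
  obtain ⟨S, rfl⟩ := (mem_SkOver_iff h0₁ hp₁ hsl₁).1 hA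
  rw [skCongr_sk, sk_mem_stdDecomp_iff h0₁ hp₁ hsl₁, sk_mem_stdDecomp_iff h0₂ hp₂ hsl₂]
  refine or_congr ⟨?_, ?_⟩ e.isEmpty_congr.symm
  · rintro ⟨P, hP⟩
    refine ⟨e.symm P, ?_⟩
    rw [← e.symm_image_image S, hP, Set.image_singleton]
  · rintro ⟨P, rfl⟩
    exact ⟨e P, Set.image_singleton⟩

theorem SemiDat.image_mem_supp_iff
    {Φ : (Dat fun P : Cov Q₁ => Clo K₁ˣ (Yset K₁ Q₁ P.1)) ≃o
      (Dat fun P : Cov Q₂ => Clo K₂ˣ (Yset K₂ Q₂ P.1))}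
    (hΦ : ∀ f S, e '' S ∈ (Φ f).supp ↔ S ∈ f.supp) (w : SemiDat K₁ Q₁) (S : Set (Cov Q₁)) :
    e '' S ∈ SemiDat.supp (Φ.withTopCongr w) ↔ S ∈ w.supp := by
  induction w using WithTop.recTopCoe with
  | top => exact Set.image_eq_empty
  | coe f => exact hΦ f S

theorem exists_orderIso_of_dat
    (Φ : (Dat fun P : Cov Q₁ => Clo K₁ˣ (Yset K₁ Q₁ P.1)) ≃o
      (Dat fun P : Cov Q₂ => Clo K₂ˣ (Yset K₂ Q₂ P.1)))
    (hΦ : ∀ f S, e '' S ∈ (Φ f).supp ↔ S ∈ f.supp) :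
    ∃ bnu : Semistar D₁ K₁ ≃o Semistar D₂ K₂, ∀ s (A : SkOver D₁ K₁),
      (skCongr hp₁ hsl₁ hp₂ hsl₂ h0₁ h0₂ e A).1 ∈ supp D₂ K₂ (bnu s) ↔ A.1 ∈ supp D₁ K₁ s := by
  refine ⟨(semiDatEquiv h0₁ hp₁ hsl₁).symm.trans
    (Φ.withTopCongr.trans (semiDatEquiv h0₂ hp₂ hsl₂)), fun s ⟨A, hA⟩ => ?_⟩
  obtain ⟨w, rfl⟩ := (semiDatEquiv h0₁ hp₁ hsl₁).surjective s
  obtain ⟨S, rfl⟩ := (mem_SkOver_iff h0₁ hp₁ hsl₁).1 hA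
  rw [skCongr_sk, OrderIso.trans_apply, OrderIso.symm_apply_apply, OrderIso.trans_apply,
    sk_mem_supp_semiDatEquiv, sk_mem_supp_semiDatEquiv]
  exact SemiDat.image_mem_supp_iff e hΦ w S

variable {bnu : Semistar D₁ K₁ ≃o Semistar D₂ K₂} {νbar : SkOver D₁ K₁ ≃o SkOver D₂ K₂}
  (h : ∀ s (A : SkOver D₁ K₁), (νbar A).1 ∈ supp D₂ K₂ (bnu s) ↔ A.1 ∈ supp D₁ K₁ s)

include h in
theorem supp_eq_image_iff (s : Semistar D₁ K₁) {Δ : Set (Subalgebra D₁ K₁)}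
    (hΔ : Δ ⊆ SkOver D₁ K₁) :
    supp D₂ K₂ (bnu s) = (fun A : SkOver D₁ K₁ => (νbar A).1) '' {A | A.1 ∈ Δ} ↔
      supp D₁ K₁ s = Δ := by
  have hmem : ∀ A : SkOver D₁ K₁,
      (νbar A).1 ∈ (fun A : SkOver D₁ K₁ => (νbar A).1) '' {A | A.1 ∈ Δ} ↔ A.1 ∈ Δ := fun A =>
    (Subtype.val_injective.comp νbar.injective).mem_set_image
  constructor
  · refine fun hs => Set.ext fun A => ⟨fun hA => ?_, fun hA => ?_⟩
    · exact (hmem ⟨A, hA.1⟩).1 (hs ▸ (h s ⟨A, hA.1⟩).2 hA)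
    · exact (h s ⟨A, hΔ hA⟩).1 (hs ▸ (hmem ⟨A, hΔ hA⟩).2 hA)
  · rintro rfl
    refine Set.ext fun B => ⟨fun hB => ?_, ?_⟩
    · obtain ⟨A, hA⟩ := νbar.surjective ⟨B, hB.1⟩
      obtain rfl : (νbar A).1 = B := congrArg Subtype.val hA
      exact (hmem A).2 ((h s A).1 hB)
    · rintro ⟨A, hA, rfl⟩
      exact (h s A).2 hA

include hp₁ hsl₁ hp₂ hsl₂ h in
theorem isFractional_map_iff (s : Semistar D₁ K₁) : s.IsFractional ↔ (bnu s).IsFractional := by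
  have hQ₁ : (⊥ : Ideal D₁).IsPrime := Ideal.isPrime_bot
  have hQ₂ : (⊥ : Ideal D₂).IsPrime := Ideal.isPrime_bot
  have hb₁ : ⊥ ∈ SkOver D₁ K₁ := (mem_SkOver_iff rfl hp₁ hsl₁).2 ⟨_, sk_univ rfl hp₁ hsl₁⟩
  have hb₂ : ⊥ ∈ SkOver D₂ K₂ := (mem_SkOver_iff rfl hp₂ hsl₂).2 ⟨_, sk_univ rfl hp₂ hsl₂⟩
  have ht₁ : ⊤ ∈ SkOver D₁ K₁ := (mem_SkOver_iff rfl hp₁ hsl₁).2 ⟨_, sk_empty⟩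
  have ht₂ : ⊤ ∈ SkOver D₂ K₂ := (mem_SkOver_iff rfl hp₂ hsl₂).2 ⟨_, sk_empty⟩
  have hb : νbar ⟨⊥, hb₁⟩ = ⟨⊥, hb₂⟩ :=
    le_antisymm (νbar.le_symm_apply.1 (bot_le : (⊥ : Subalgebra D₁ K₁) ≤ _))
      (bot_le : (⊥ : Subalgebra D₂ K₂) ≤ _)
  have ht : νbar ⟨⊤, ht₁⟩ = ⟨⊤, ht₂⟩ :=
    le_antisymm (le_top : _ ≤ (⊤ : Subalgebra D₂ K₂))
      (νbar.symm_apply_le.1 (le_top : _ ≤ (⊤ : Subalgebra D₁ K₁)))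
  rw [isFractional_iff_supp_eq rfl hp₁ hsl₁, isFractional_iff_supp_eq rfl hp₂ hsl₂,
    ← supp_eq_image_iff h s (Set.insert_subset_iff.2 ⟨hb₁, Set.singleton_subset_iff.2 ht₁⟩)]
  have : {A : SkOver D₁ K₁ | A.1 ∈ ({⊥, ⊤} : Set (Subalgebra D₁ K₁))} =
      {⟨⊥, hb₁⟩, ⟨⊤, ht₁⟩} := by
    ext A
    simp [Subtype.ext_iff]
  rw [this, Set.image_pair, hb, ht]

end

end Paper

namespace Paper

/-- If `ν : hiSpec(D₁) → hiSpec(D₂)` is an order isomorphism with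
`FStar(Z(P)) ≅ FStar(Z(ν(P)))` (as ordered sets) for every `P`, then there are order
isomorphisms `𝛎 : SStar(D₁) → SStar(D₂)` and `𝛎_F : FStar(D₁) → FStar(D₂)`, with `𝛎`
carrying the semistar operations of support `Δ` onto those of support `ν̄(Δ)`,
where `ν̄` is the skeleton isomorphism induced by `ν`. -/
theorem statement9
    (D₁ : Type*) [CommRing D₁] [IsDomain D₁]
    (K₁ : Type*) [Field K₁] [Algebra D₁ K₁] [IsFractionRing D₁ K₁]
    (D₂ : Type*) [CommRing D₂] [IsDomain D₂]
    (K₂ : Type*) [Field K₂] [Algebra D₂ K₂] [IsFractionRing D₂ K₂]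
    (hp₁ : IsPrufer D₁ K₁) (hsl₁ : IsSemilocal D₁)
    (hp₂ : IsPrufer D₂ K₂) (hsl₂ : IsSemilocal D₂)
    (ν : ↥(hiSpec D₁) ≃o ↥(hiSpec D₂))
    (hK : Nonempty (AFracStar K₁ ≃o AFracStar K₂))
    (hZ : ∀ P Q : ↥(hiSpec D₁), DirectlyBelow D₁ Q.1 P.1 →
      Nonempty (AFracStar (Zring D₁ P.1 Q.1 (mem_hiSpec_prime P.2)) ≃o
        AFracStar (Zring D₂ (ν P).1 (ν Q).1 (mem_hiSpec_prime (ν P).2)))) :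
    ∃ (bnu : Semistar D₁ K₁ ≃o Semistar D₂ K₂)
      (_ : FracStar D₁ K₁ ⊥ ≃o FracStar D₂ K₂ ⊥)
      (νbar : ↥(SkOver D₁ K₁) ≃o ↥(SkOver D₂ K₂)),
      (∀ T : ↥(SkOver D₁ K₁), T.1 ∈ stdDecomp D₁ K₁ ↔ (νbar T).1 ∈ stdDecomp D₂ K₂) ∧
      ∀ Δ : Set (Subalgebra D₁ K₁), Δ ⊆ SkOver D₁ K₁ →
        (⇑bnu) '' {s | supp D₁ K₁ s = Δ} =
          {s | supp D₂ K₂ s =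
            (fun A : ↥(SkOver D₁ K₁) => (νbar A).1) '' {A | A.1 ∈ Δ}} := by
  have hb : (ν ⟨⊥, bot_mem_hiSpec⟩).1 = ⊥ := by
    have : ν ⟨⊥, bot_mem_hiSpec⟩ ≤ ⟨⊥, bot_mem_hiSpec⟩ :=
      ν.le_symm_apply.1 (bot_le : (⊥ : Ideal D₁) ≤ _)
    exact le_bot_iff.1 this
  set Q : ↥(hiSpec D₁) := ⟨⊥, bot_mem_hiSpec⟩
  have hQ₁ : Q.1.IsPrime := mem_hiSpec_prime Q.2
  have hQ₂ : (ν Q).1.IsPrime := mem_hiSpec_prime (ν Q).2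
  obtain ⟨Φ, hΦ⟩ := exists_dat_orderIso (K₁ := K₁) (K₂ := K₂) ν Q fun P h =>
    nonempty_cloYset_orderIso hp₁ hsl₁ hp₂ hsl₂ ν hZ P Q h
  obtain ⟨bnu, h⟩ := exists_orderIso_of_dat hp₁ hsl₁ hp₂ hsl₂ rfl hb (covEquiv ν Q) Φ hΦ
  refine ⟨bnu, (fracStarEquiv D₁ K₁).trans (OrderIso.trans
    ⟨bnu.toEquiv.subtypeEquiv (isFractional_map_iff hp₁ hsl₁ hp₂ hsl₂ h), bnu.le_iff_le⟩
    (fracStarEquiv D₂ K₂).symm), skCongr hp₁ hsl₁ hp₂ hsl₂ rfl hb (covEquiv ν Q),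
    fun T => (skCongr_mem_stdDecomp_iff hp₁ hsl₁ hp₂ hsl₂ rfl hb (covEquiv ν Q) T).symm,
    fun Δ hΔ => ?_⟩
  ext t
  obtain ⟨s, rfl⟩ := bnu.surjective t
  rw [bnu.injective.mem_set_image]
  exact (supp_eq_image_iff h s hΔ).symm

end Paper
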